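/- arXiv:math/0412483 — 6 statements merged into one kernel-verified Lean document; each statement's English description precedes it below -/
import Mathlib

section
/- Let d ≥ 1 and let D be any set of 16d distinct points in ℝ^4. Then there exists a collection H_1, H_2, H_3, H_4 of four pairwise distinct hyperplanes in ℝ^4 such that each of the 16 associated open orthants contains at most 2d points of D. -/
open RealInnerProductSpace

/-- The open half-space of `ℝ^n` bounded by the hyperplane with normal vector `a` and
constant `c`. -/
def openHalfspace {n : ℕ} (a : EuclideanSpace ℝ (Fin n)) (c : ℝ) (ε : Bool) :
    Set (EuclideanSpace ℝ (Fin n)) :=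
  if ε then {x | ⟪a, x⟫ < c} else {x | c < ⟪a, x⟫}

/-- The hyperplane of `ℝ^n` with normal vector `a` and constant `c`. -/
def hyperplane {n : ℕ} (a : EuclideanSpace ℝ (Fin n)) (c : ℝ) :
    Set (EuclideanSpace ℝ (Fin n)) :=
  {x | ⟪a, x⟫ = c}

open Classical in
/-- The hyperplane with normal vector `a` and constant `c` has at most half of the points of `A`
in each of its open half-spaces. -/
def Halves {n : ℕ} (a : EuclideanSpace ℝ (Fin n)) (c : ℝ)
    (A : Finset (EuclideanSpace ℝ (Fin n))) : Prop :=
  ∀ ε, 2 * (A.filter (· ∈ openHalfspace a c ε)).card ≤ A.card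

open Classical in
/-- An upper median of the values `⟪a, x⟫`, `x ∈ A`, that depends continuously on `a`. -/
theorem exists_continuous_upper_median {n : ℕ} {A : Finset (EuclideanSpace ℝ (Fin n))}
    (hA : A.Nonempty) :
    ∃ v : EuclideanSpace ℝ (Fin n) → ℝ, Continuous v ∧
      (∀ a, 2 * (A.filter (fun x => v a < ⟪a, x⟫)).card ≤ A.card) ∧
      ∀ a, 2 * (A.filter (fun x => ⟪a, x⟫ < v a)).card ≤ A.card := by
  set k := A.card / 2 + 1 with hk
  have hpos : 0 < A.card := hA.card_pos
  have hS : (A.powersetCard k).attach.Nonempty :=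
    Finset.attach_nonempty_iff.2 (Finset.powersetCard_nonempty.2 (by omega))
  have hT (T : {T // T ∈ A.powersetCard k}) : T.1.Nonempty :=
    Finset.card_pos.1 (by rw [(Finset.mem_powersetCard.1 T.2).2]; omega)
  refine ⟨fun a => (A.powersetCard k).attach.sup' hS
    fun T => T.1.inf' (hT T) fun x => ⟪a, x⟫, ?_, fun a => ?_, fun a => ?_⟩
  · exact Continuous.finset_sup'_apply _ fun T _ =>
      Continuous.finset_inf'_apply _ fun x _ => by fun_prop
  · by_contra! h
    obtain ⟨T, hTs, hTc⟩ := Finset.exists_subset_card_eq (Nat.div_lt_of_lt_mul h)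
    have hmem : T ∈ A.powersetCard k :=
      Finset.mem_powersetCard.2 ⟨hTs.trans (Finset.filter_subset _ _), hTc⟩
    refine (Finset.le_sup' (fun T : {T // T ∈ A.powersetCard k} =>
      T.1.inf' (hT T) fun x => ⟪a, x⟫) (Finset.mem_attach _ ⟨T, hmem⟩)).not_gt ?_
    exact (Finset.lt_inf'_iff _).2 fun x hx => (Finset.mem_filter.1 (hTs hx)).2
  · obtain ⟨T, -, hTv⟩ := Finset.exists_mem_eq_sup' hS
      fun T : {T // T ∈ A.powersetCard k} => T.1.inf' (hT T) fun x => ⟪a, x⟫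
    obtain ⟨hTA, hTc⟩ := Finset.mem_powersetCard.1 T.2
    have hsub : A.filter (fun x => ⟪a, x⟫ < (A.powersetCard k).attach.sup' hS
        fun T => T.1.inf' (hT T) fun x => ⟪a, x⟫) ⊆ A \ T.1 := fun x hx => by
      rw [Finset.mem_filter, hTv] at hx
      exact Finset.mem_sdiff.2 ⟨hx.1, fun hxT =>
        (Finset.inf'_le (fun x => ⟪a, x⟫) hxT).not_gt hx.2⟩
    have hle := Finset.card_le_card hsub
    rw [Finset.card_sdiff_of_subset hTA] at hle
    beta_reduce
    omega

/-- A median of the values `⟪a, x⟫`, `x ∈ A`, that is continuous and odd in `a`. -/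
theorem exists_continuous_odd_median {n : ℕ} (A : Finset (EuclideanSpace ℝ (Fin n))) :
    ∃ m : EuclideanSpace ℝ (Fin n) → ℝ, Continuous m ∧ (∀ a, m (-a) = -m a) ∧
      ∀ a, Halves a (m a) A := by
  classical
  obtain rfl | hA := A.eq_empty_or_nonempty
  · exact ⟨0, continuous_zero, by simp, fun a ε => by simp⟩
  obtain ⟨v, hv, hgt, hlt⟩ := exists_continuous_upper_median hA
  refine ⟨fun a => (v a - v (-a)) / 2, by fun_prop, fun a => by simp only [neg_neg]; ring,
    fun a ε => ?_⟩
  have hgt' := hgt (-a)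
  have hlt' := hlt (-a)
  simp only [inner_neg_left] at hgt' hlt'
  have mono {p q : EuclideanSpace ℝ (Fin n) → Prop} (hq : 2 * (A.filter q).card ≤ A.card)
      (hpq : ∀ x, p x → q x) : 2 * (A.filter p).card ≤ A.card :=
    (Nat.mul_le_mul_left 2 (Finset.card_le_card
      (Finset.monotone_filter_right A fun x _ => hpq x))).trans hq
  obtain h | h := le_total (v a) (-v (-a)) <;> cases ε
  · exact mono (hgt a) fun x hx => by simp [openHalfspace] at hx; linarith
  · exact mono hgt' fun x hx => by simp [openHalfspace] at hx; linarith
  · exact mono hlt' fun x hx => by simp [openHalfspace] at hx; linarith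
  · exact mono (hlt a) fun x hx => by simp [openHalfspace] at hx; linarith

/-- Planar ham sandwich theorem for finite sets: the normal vector can be found in the span
of any two given vectors. -/
theorem exists_halves_halves {n : ℕ} (p q : EuclideanSpace ℝ (Fin n))
    (A B : Finset (EuclideanSpace ℝ (Fin n))) :
    ∃ s t c : ℝ, s ^ 2 + t ^ 2 = 1 ∧ Halves (s • p + t • q) c A ∧ Halves (s • p + t • q) c B := by
  obtain ⟨f, hf, hfo, hfA⟩ := exists_continuous_odd_median A
  obtain ⟨g, hg, hgo, hgB⟩ := exists_continuous_odd_median B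
  let u (θ : ℝ) := Real.cos θ • p + Real.sin θ • q
  have hF : Continuous fun θ => f (u θ) - g (u θ) := by fun_prop
  have hπ : u Real.pi = -u 0 := by simp [u]
  obtain ⟨θ, hθ⟩ : ∃ θ, f (u θ) - g (u θ) = 0 := by
    have hodd : f (u Real.pi) - g (u Real.pi) = -(f (u 0) - g (u 0)) := by
      rw [hπ, hfo, hgo]; ring
    obtain h | h := le_total (f (u 0) - g (u 0)) 0
    · exact mem_range_of_exists_le_of_exists_ge hF ⟨0, h⟩ ⟨Real.pi, by linarith⟩
    · exact mem_range_of_exists_le_of_exists_ge hF ⟨Real.pi, by linarith⟩ ⟨0, h⟩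
  refine ⟨Real.cos θ, Real.sin θ, f (u θ), Real.cos_sq_add_sin_sq θ, hfA _, ?_⟩
  rw [sub_eq_zero.1 hθ]
  exact hgB _

/-- Equal hyperplanes have parallel normal vectors. -/
theorem exists_eq_smul_of_hyperplane_eq {n : ℕ} {a b : EuclideanSpace ℝ (Fin n)} {c c' : ℝ}
    (ha : a ≠ 0) (h : hyperplane a c = hyperplane b c') : ∃ r : ℝ, b = r • a := by
  have haa : ⟪a, a⟫ ≠ 0 := inner_self_ne_zero.2 ha
  have horth (y) (hy : ⟪a, y⟫ = 0) : ⟪b, y⟫ = 0 := by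
    have h₀ : (c / ⟪a, a⟫) • a ∈ hyperplane b c' := by
      rw [← h]
      simp [hyperplane, -inner_self_eq_norm_sq_to_K, inner_smul_right, haa]
    have h₁ : (c / ⟪a, a⟫) • a + y ∈ hyperplane b c' := by
      rw [← h]
      simp [hyperplane, -inner_self_eq_norm_sq_to_K, inner_add_right, inner_smul_right, haa, hy]
    simp only [hyperplane, Set.mem_ofPred_eq, inner_add_right] at h₀ h₁
    linarith
  have hay : ⟪a, b - (⟪a, b⟫ / ⟪a, a⟫) • a⟫ = 0 := by
    rw [inner_sub_right, inner_smul_right, div_mul_cancel₀ _ haa, sub_self]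
  refine ⟨⟪a, b⟫ / ⟪a, a⟫, sub_eq_zero.1 ((inner_self_eq_zero (𝕜 := ℝ)).1 ?_)⟩
  nth_rewrite 1 [inner_sub_left]
  rw [horth _ hay, inner_smul_left, hay, mul_zero, sub_zero]

/-- For any set `D` of `16d` distinct points in `ℝ^4` there are four pairwise distinct
hyperplanes such that each of the `16` associated open orthants contains at most `2d`
points of `D`. -/
theorem point_partition
    (d : ℕ) (hd : 1 ≤ d) (D : Finset (EuclideanSpace ℝ (Fin 4)))
    (hcard : D.card = 16 * d) :
    ∃ (a : Fin 4 → EuclideanSpace ℝ (Fin 4)) (c : Fin 4 → ℝ),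
      (∀ i, a i ≠ 0) ∧
      (∀ i j, i ≠ j → hyperplane (a i) (c i) ≠ hyperplane (a j) (c j)) ∧
      ∀ ε : Fin 4 → Bool,
        ((D : Set (EuclideanSpace ℝ (Fin 4))) ∩ ⋂ i, openHalfspace (a i) (c i) (ε i)).ncard
          ≤ 2 * d := by
  classical
  obtain ⟨f, -, -, hf⟩ := exists_continuous_odd_median D
  let a₀ : EuclideanSpace ℝ (Fin 4) := !₂[1, 0, 2, 0]
  have h₀ := hf a₀
  let A (ε : Bool) := D.filter (· ∈ openHalfspace a₀ (f a₀) ε)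
  obtain ⟨s₁, t₁, c₁, hst₁, h₁⟩ :=
    exists_halves_halves !₂[1, 0, 0, 0] !₂[0, 1, 0, 0] (A true) (A false)
  set a₁ := s₁ • !₂[(1 : ℝ), 0, 0, 0] + t₁ • !₂[(0 : ℝ), 1, 0, 0] with ha₁
  let B (ε δ : Bool) := (A ε).filter (· ∈ openHalfspace a₁ c₁ δ)
  obtain ⟨s₂, t₂, c₂, hst₂, h₂⟩ :=
    exists_halves_halves !₂[0, 0, 1, 0] !₂[0, 0, 0, 1] (B true true) (B true false)
  set a₂ := s₂ • !₂[(0 : ℝ), 0, 1, 0] + t₂ • !₂[(0 : ℝ), 0, 0, 1] with ha₂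
  obtain ⟨s₃, t₃, c₃, hst₃, h₃⟩ :=
    exists_halves_halves !₂[1, 0, 1, 0] !₂[0, 1, 0, 1] (B false true) (B false false)
  set a₃ := s₃ • !₂[(1 : ℝ), 0, 1, 0] + t₃ • !₂[(0 : ℝ), 1, 0, 1] with ha₃
  have hne : ∀ i, ![a₀, a₁, a₂, a₃] i ≠ 0 := by
    intro i h
    have e (k : Fin 4) := congrArg (· k) h
    have e0 := e 0
    have e1 := e 1
    have e2 := e 2
    have e3 := e 3
    fin_cases i <;> simp [a₀, ha₁, ha₂, ha₃] at e0 e1 e2 e3 <;> simp_all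
  have hlt : ∀ i j, i < j → hyperplane (![a₀, a₁, a₂, a₃] i) (![f a₀, c₁, c₂, c₃] i) ≠
      hyperplane (![a₀, a₁, a₂, a₃] j) (![f a₀, c₁, c₂, c₃] j) := by
    intro i j hij h
    obtain ⟨r, hr⟩ := exists_eq_smul_of_hyperplane_eq (hne i) h
    have e (k : Fin 4) := congrArg (· k) hr
    have e0 := e 0
    have e1 := e 1
    have e2 := e 2
    have e3 := e 3
    fin_cases i <;> fin_cases j <;> first | exact absurd hij (by decide) | skip
    all_goals simp [a₀, ha₁, ha₂, ha₃] at e0 e1 e2 e3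
    all_goals grind
  refine ⟨![a₀, a₁, a₂, a₃], ![f a₀, c₁, c₂, c₃], hne, fun i j hij => ?_, fun ε => ?_⟩
  · obtain h | h := lt_or_gt_of_ne hij
    · exact hlt i j h
    · exact (hlt j i h).symm
  have hA : 2 * (A (ε 0)).card ≤ D.card := h₀ _
  have hB : 2 * (B (ε 0) (ε 1)).card ≤ (A (ε 0)).card := by
    cases ε 0
    exacts [h₁.2 _, h₁.1 _]
  have bound (C : Finset (EuclideanSpace ℝ (Fin 4)))
      (hC : 2 * C.card ≤ (B (ε 0) (ε 1)).card)
      (hsub : (D : Set (EuclideanSpace ℝ (Fin 4))) ∩ ⋂ i, openHalfspace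
        (![a₀, a₁, a₂, a₃] i) (![f a₀, c₁, c₂, c₃] i) (ε i) ⊆ C) :
      ((D : Set (EuclideanSpace ℝ (Fin 4))) ∩ ⋂ i, openHalfspace
        (![a₀, a₁, a₂, a₃] i) (![f a₀, c₁, c₂, c₃] i) (ε i)).ncard ≤ 2 * d := by
    have := Set.ncard_le_ncard hsub C.finite_toSet
    rw [Set.ncard_coe_finset] at this
    omega
  have hmem {x} (hx : x ∈ (D : Set (EuclideanSpace ℝ (Fin 4))) ∩ ⋂ i, openHalfspace
      (![a₀, a₁, a₂, a₃] i) (![f a₀, c₁, c₂, c₃] i) (ε i)) : x ∈ B (ε 0) (ε 1) :=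
    Finset.mem_filter.2 ⟨Finset.mem_filter.2 ⟨hx.1, Set.mem_iInter.1 hx.2 0⟩,
      Set.mem_iInter.1 hx.2 1⟩
  cases hε : ε 0
  · refine bound ((B (ε 0) (ε 1)).filter (· ∈ openHalfspace a₃ c₃ (ε 3))) ?_ fun x hx =>
      Finset.mem_coe.2 (Finset.mem_filter.2 ⟨hmem hx, Set.mem_iInter.1 hx.2 3⟩)
    rw [hε]
    cases ε 1
    exacts [h₃.2 _, h₃.1 _]
  · refine bound ((B (ε 0) (ε 1)).filter (· ∈ openHalfspace a₂ c₂ (ε 2))) ?_ fun x hx =>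
      Finset.mem_coe.2 (Finset.mem_filter.2 ⟨hmem hx, Set.mem_iInter.1 hx.2 2⟩)
    rw [hε]
    cases ε 1
    exacts [h₂.2 _, h₂.1 _]
end

section
/- Let μ be a continuous mass distribution on ℝ^4 that has a center of symmetry O, i.e. μ(2O − A) = μ(A) for every Borel set A. Then μ admits a 4-equipartition by hyperplanes H_1, H_2, H_3, H_4. Moreover, the hyperplane H_1 can be chosen in advance to be an arbitrary hyperplane of ℝ^4 passing through the center of symmetry O. -/
open MeasureTheory RealInnerProductSpace

/-- The closed half-space of `ℝ^n` bounded by the hyperplane with normal vector `a` and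
constant `c`. -/
def closedHalfspace {n : ℕ} (a : EuclideanSpace ℝ (Fin n)) (c : ℝ) (ε : Bool) :
    Set (EuclideanSpace ℝ (Fin n)) :=
  if ε then {x | ⟪a, x⟫ ≤ c} else {x | c ≤ ⟪a, x⟫}

/-- The hyperplanes with normal vectors `a i` and constants `c i` form an equipartition of
the measure `μ` on `ℝ^n`: every closed orthant has measure `μ(ℝ^n)/2^n`. -/
def IsEquipartition {n : ℕ} (μ : Measure (EuclideanSpace ℝ (Fin n)))
    (a : Fin n → EuclideanSpace ℝ (Fin n)) (c : Fin n → ℝ) : Prop :=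
  ∀ ε : Fin n → Bool, μ (⋂ i, closedHalfspace (a i) (c i) (ε i)) = μ Set.univ / 2 ^ n

/-- A continuous logarithm of a constant function is constant. -/
theorem Complex.eq_of_exp_comp_eq_const {X : Type*} [TopologicalSpace X] [PreconnectedSpace X]
    {h : X → ℂ} (hc : Continuous h) {k : ℂ} (hk : ∀ x, Complex.exp (h x) = k) (x y : X) :
    h x = h y :=
  Complex.isCoveringMap_exp.const_of_comp hc (fun a a' => Subtype.ext ((hk a).trans (hk a').symm))
    x y

/-- A symmetric planar map on the torus which is antiperiodic in each variable and takes values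
with positive real part on the diagonal has a zero. -/
theorem exists_eq_zero_of_antiperiodic_of_symm {T : ℝ} {g : ℝ → ℝ → ℂ}
    (hg : Continuous fun p : ℝ × ℝ => g p.1 p.2) (hanti : ∀ s t, g (s + T) t = -g s t)
    (hsymm : ∀ s t, g s t = g t s) (hdiag : ∀ t, 0 < (g t t).re) :
    ∃ s t, g s t = 0 := by
  by_contra! hne
  obtain ⟨L, ⟨-, hL⟩, -⟩ := Complex.isCoveringMapOn_exp.existsUnique_continuousMap_lifts
    (⟨fun p : ℝ × ℝ => g p.1 p.2, hg⟩ : C(ℝ × ℝ, ℂ)) (a₀ := (0, 0))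
    (e₀ := Complex.log (g 0 0)) (Complex.exp_log (hne 0 0)) (fun p => hne p.1 p.2)
  replace hL : ∀ s t, Complex.exp (L (s, t)) = g s t := fun s t => congrFun hL (s, t)
  have hLc : Continuous L := L.continuous
  have hswap := Complex.eq_of_exp_comp_eq_const
    (h := fun p : ℝ × ℝ => L p - L p.swap) (k := 1) (by fun_prop)
    (fun p => by rw [Complex.exp_sub, hL p.1 p.2, Prod.swap, hL, hsymm, div_self (hne _ _)])
    (T, 0) (0, 0)
  have hshift := Complex.eq_of_exp_comp_eq_const
    (h := fun p : ℝ × ℝ => L (p.1 + T, p.2) - L p) (k := -1) (by fun_prop)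
    (fun p => by rw [Complex.exp_sub, hL, hL p.1 p.2, hanti, neg_div, div_self (hne _ _)])
    (0, T) (0, 0)
  have hd := Complex.eq_of_exp_comp_eq_const
    (h := fun t : ℝ => L (t, t) - Complex.log (g t t)) (k := 1)
    (((by fun_prop : Continuous fun t : ℝ => L (t, t))).sub
      (Continuous.clog (hg.comp (continuous_id.prodMk continuous_id)) fun t => Or.inl (hdiag t)))
    (fun t => by rw [Complex.exp_sub, hL, Complex.exp_log (hne _ _), div_self (hne _ _)])
    T 0
  have hg0 : g T T = g 0 0 := by
    rw [← zero_add T, hanti, hsymm, hanti, neg_neg]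
  have h0 := hL (0 + T) 0
  rw [hanti, ← hL] at h0
  simp only [zero_add, Prod.swap, hg0] at hswap hshift hd h0
  have key : L (T, 0) = L (0, 0) := by linear_combination (hd - hshift + hswap) / 2
  rw [key, eq_neg_iff_add_eq_zero, ← two_mul] at h0
  simp [Complex.exp_ne_zero] at h0

/-- The root of a strictly increasing function depends continuously on parameters. -/
theorem exists_continuous_root {X : Type*} [TopologicalSpace X] {h : X → ℝ → ℝ}
    (hc : Continuous fun p : X × ℝ => h p.1 p.2) (hm : ∀ t, StrictMono (h t))
    (hpos : ∀ t, ∃ y, 0 < h t y) (hneg : ∀ t, ∃ y, h t y < 0) :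
    ∃ Y : X → ℝ, Continuous Y ∧ ∀ t, h t (Y t) = 0 := by
  have hroot : ∀ t, ∃ y, h t y = 0 := fun t => by
    obtain ⟨y₁, h₁⟩ := hpos t
    obtain ⟨y₂, h₂⟩ := hneg t
    exact mem_range_of_exists_le_of_exists_ge (by fun_prop) ⟨y₂, h₂.le⟩ ⟨y₁, h₁.le⟩
  choose Y hY using hroot
  refine ⟨Y, continuous_iff_continuousAt.2 fun t₀ => ?_, hY⟩
  refine tendsto_order.2 ⟨fun y hy => ?_, fun y hy => ?_⟩
  · have hlt : h t₀ y < 0 := hY t₀ ▸ hm t₀ hy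
    have hev : ∀ᶠ t in nhds t₀, h t y < 0 :=
      (by fun_prop : Continuous fun t => h t y).continuousAt.eventually_lt_const hlt
    filter_upwards [hev] with t ht
    exact (hm t).lt_iff_lt.1 (by rwa [hY t])
  · have hlt : 0 < h t₀ y := hY t₀ ▸ hm t₀ hy
    have hev : ∀ᶠ t in nhds t₀, 0 < h t y :=
      (by fun_prop : Continuous fun t => h t y).continuousAt.eventually_const_lt hlt
    filter_upwards [hev] with t ht
    exact (hm t).lt_iff_lt.1 (by rwa [hY t])

theorem measurable_real_sign : Measurable Real.sign := by
  unfold Real.sign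
  exact Measurable.ite measurableSet_Iio measurable_const
    (Measurable.ite measurableSet_Ioi measurable_const measurable_const)

theorem abs_real_sign_le_one (x : ℝ) : |Real.sign x| ≤ 1 := by
  rcases Real.sign_apply_eq x with h | h | h <;> simp [h]

theorem real_sign_mul_self {x : ℝ} (hx : x ≠ 0) : Real.sign x * Real.sign x = 1 := by
  rcases Real.sign_apply_eq_of_ne_zero x hx with h | h <;> simp [h]

/-- Along rescalings going to infinity, `arctan` converges to a multiple of the sign. -/
theorem tendsto_arctan_mul_sign {ι : Type*} {l : Filter ι} {r x : ι → ℝ} {x₀ : ℝ} (hx₀ : x₀ ≠ 0)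
    (hr : Filter.Tendsto r l Filter.atTop) (hx : Filter.Tendsto x l (nhds x₀)) :
    Filter.Tendsto (fun i => Real.arctan (r i * x i)) l
      (nhds (Real.pi / 2 * Real.sign x₀)) := by
  rcases hx₀.lt_or_gt with h | h
  · rw [Real.sign_of_neg h, mul_neg_one]
    exact (Real.tendsto_arctan_atBot.mono_right nhdsWithin_le_nhds).comp (hr.atTop_mul_neg h hx)
  · rw [Real.sign_of_pos h, mul_one]
    exact (Real.tendsto_arctan_atTop.mono_right nhdsWithin_le_nhds).comp (hr.atTop_mul_pos h hx)

theorem continuousAt_real_sign {x : ℝ} (hx : x ≠ 0) : ContinuousAt Real.sign x := by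
  rcases hx.lt_or_gt with h | h
  · exact continuousAt_const.congr (f := fun _ => (-1 : ℝ))
      ((eventually_lt_nhds h).mono fun y hy => (Real.sign_of_neg hy).symm)
  · exact continuousAt_const.congr (f := fun _ => (1 : ℝ))
      ((eventually_gt_nhds h).mono fun y hy => (Real.sign_of_pos hy).symm)

theorem abs_arctan_le_pi_div_two (x : ℝ) : |Real.arctan x| ≤ Real.pi / 2 :=
  abs_le.2 ⟨(Real.neg_pi_div_two_lt_arctan x).le, (Real.arctan_lt_pi_div_two x).le⟩

theorem norm_mul_arctan_mul_arctan_le {c : ℝ} (hc : |c| ≤ 1) (x y : ℝ) :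
    ‖c * (Real.arctan x * Real.arctan y)‖ ≤ 1 * (Real.pi / 2 * (Real.pi / 2)) := by
  rw [norm_mul, norm_mul]
  gcongr
  · exact hc
  · exact abs_arctan_le_pi_div_two x
  · exact abs_arctan_le_pi_div_two y

section Balance

variable {E : Type*} [NormedAddCommGroup E] [InnerProductSpace ℝ E] [MeasurableSpace E]
  [BorelSpace E]

theorem measurable_sign_inner (a : E) : Measurable fun z => Real.sign ⟪a, z⟫ :=
  measurable_real_sign.comp (by fun_prop : Continuous fun z : E => ⟪a, z⟫).measurable

theorem measurable_arctan_inner (a : E) : Measurable fun z => Real.arctan ⟪a, z⟫ :=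
  Real.measurable_arctan.comp (by fun_prop : Continuous fun z : E => ⟪a, z⟫).measurable

variable (μ : Measure E)

/-- The smoothed imbalance of the hyperplane with normal `w` on the double wedge where the
hyperplanes with normals `a` and `b` have the same sign. -/
noncomputable def balance (a b w : E) : ℝ :=
  ∫ z, (Real.sign ⟪a, z⟫ + Real.sign ⟪b, z⟫) * Real.arctan ⟪w, z⟫ ∂μ

omit [BorelSpace E] in
theorem balance_comm (a b w : E) : balance μ a b w = balance μ b a w := by
  simp only [balance, add_comm]

omit [BorelSpace E] in
theorem balance_neg (a b w : E) : balance μ a b (-w) = -balance μ a b w := by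
  simp [balance, inner_neg_left, Real.arctan_neg, integral_neg]

omit [MeasurableSpace E] [BorelSpace E] in
theorem abs_balance_integrand_le (a b w z : E) :
    ‖(Real.sign ⟪a, z⟫ + Real.sign ⟪b, z⟫) * Real.arctan ⟪w, z⟫‖ ≤ 2 * (Real.pi / 2) := by
  rw [norm_mul]
  refine mul_le_mul ((norm_add_le _ _).trans ?_) (abs_arctan_le_pi_div_two _) (norm_nonneg _)
    zero_le_two
  have h₁ := abs_real_sign_le_one ⟪a, z⟫
  have h₂ := abs_real_sign_le_one ⟪b, z⟫
  simp only [Real.norm_eq_abs]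
  linarith

theorem measurable_balance_integrand (a b w : E) :
    Measurable fun z => (Real.sign ⟪a, z⟫ + Real.sign ⟪b, z⟫) * Real.arctan ⟪w, z⟫ :=
  ((measurable_sign_inner a).add (measurable_sign_inner b)).mul (measurable_arctan_inner w)

variable [IsFiniteMeasure μ]

theorem integrable_balance_integrand (a b w : E) :
    Integrable (fun z => (Real.sign ⟪a, z⟫ + Real.sign ⟪b, z⟫) * Real.arctan ⟪w, z⟫) μ :=
  Integrable.of_bound (measurable_balance_integrand a b w).aestronglyMeasurable _
    (Filter.Eventually.of_forall (abs_balance_integrand_le a b w))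

theorem continuous_balance (a b : E) : Continuous (balance μ a b) := by
  refine continuous_of_dominated (bound := fun _ => 2 * (Real.pi / 2))
    (fun w => (measurable_balance_integrand a b w).aestronglyMeasurable)
    (fun w => Filter.Eventually.of_forall (abs_balance_integrand_le a b w))
    (integrable_const _) (Filter.Eventually.of_forall fun z => ?_)
  exact continuous_const.mul (Real.continuous_arctan.comp (by fun_prop))

variable {μ}

theorem integrable_sign_mul_sign (a b : E) :
    Integrable (fun z => Real.sign ⟪a, z⟫ * Real.sign ⟪b, z⟫) μ := by
  refine Integrable.of_bound
    ((measurable_sign_inner a).mul (measurable_sign_inner b)).aestronglyMeasurable 1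
    (Filter.Eventually.of_forall fun z => ?_)
  rw [norm_mul]
  exact mul_le_one₀ (abs_real_sign_le_one _) (norm_nonneg _) (abs_real_sign_le_one _)

variable (hH : ∀ u : E, u ≠ 0 → ∀ᵐ z ∂μ, ⟪u, z⟫ ≠ 0)
include hH

omit [BorelSpace E] [IsFiniteMeasure μ] in
theorem integral_sign_mul_self {a : E} (ha : a ≠ 0) :
    ∫ z, Real.sign ⟪a, z⟫ * Real.sign ⟪a, z⟫ ∂μ = μ.real Set.univ := by
  rw [integral_congr_ae (g := fun _ => (1 : ℝ))
    ((hH a ha).mono fun z hz => real_sign_mul_self hz)]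
  simp

theorem balance_lt_balance_add [NeZero μ] {a b : E} (ha : a ≠ 0) (hb : b ≠ 0)
    (hab : ∫ z, Real.sign ⟪a, z⟫ * Real.sign ⟪b, z⟫ ∂μ = 0) (w : E) {c d : ℝ} (hc : 0 ≤ c)
    (hd : 0 ≤ d) (hcd : 0 < c + d) :
    balance μ a b w < balance μ a b (w + c • a + d • b) := by
  have hinner : ∀ z, ⟪w + c • a + d • b, z⟫ = ⟪w, z⟫ + (c * ⟪a, z⟫ + d * ⟪b, z⟫) := fun z => by
    simp only [inner_add_left, real_inner_smul_left]; ring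
  have hcase : ∀ᵐ z ∂μ, Real.sign ⟪a, z⟫ * Real.sign ⟪b, z⟫ = -1 ∨
      (Real.sign ⟪a, z⟫ + Real.sign ⟪b, z⟫) * Real.arctan ⟪w, z⟫ <
        (Real.sign ⟪a, z⟫ + Real.sign ⟪b, z⟫) * Real.arctan ⟪w + c • a + d • b, z⟫ := by
    filter_upwards [hH a ha, hH b hb] with z hza hzb
    rw [hinner]
    rcases hza.lt_or_gt with h₁ | h₁ <;> rcases hzb.lt_or_gt with h₂ | h₂
    · right
      rw [Real.sign_of_neg h₁, Real.sign_of_neg h₂]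
      refine mul_lt_mul_of_neg_left (Real.arctan_strictMono ?_) (by norm_num)
      rcases hc.eq_or_lt with rfl | hc'
      · nlinarith
      · nlinarith [mul_neg_of_pos_of_neg hc' h₁]
    · left; rw [Real.sign_of_neg h₁, Real.sign_of_pos h₂]; norm_num
    · left; rw [Real.sign_of_pos h₁, Real.sign_of_neg h₂]; norm_num
    · right
      rw [Real.sign_of_pos h₁, Real.sign_of_pos h₂]
      refine mul_lt_mul_of_pos_left (Real.arctan_strictMono ?_) (by norm_num)
      rcases hc.eq_or_lt with rfl | hc'
      · nlinarith
      · nlinarith [mul_pos hc' h₁]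
  have hle : ∀ᵐ z ∂μ, (Real.sign ⟪a, z⟫ + Real.sign ⟪b, z⟫) * Real.arctan ⟪w, z⟫ ≤
      (Real.sign ⟪a, z⟫ + Real.sign ⟪b, z⟫) * Real.arctan ⟪w + c • a + d • b, z⟫ := by
    filter_upwards [hcase, hH a ha, hH b hb] with z hz hza hzb
    rcases hz with hz | hz
    · have : Real.sign ⟪a, z⟫ + Real.sign ⟪b, z⟫ = 0 := by
        rcases Real.sign_apply_eq_of_ne_zero _ hza with h₁ | h₁ <;>
          rcases Real.sign_apply_eq_of_ne_zero _ hzb with h₂ | h₂ <;>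
          rw [h₁, h₂] at hz ⊢ <;> linarith
      simp [this]
    · exact hz.le
  refine lt_of_le_of_ne (integral_mono_ae (integrable_balance_integrand μ a b w)
    (integrable_balance_integrand μ a b _) hle) fun heq => ?_
  have hae := (integral_eq_iff_of_ae_le (integrable_balance_integrand μ a b w)
    (integrable_balance_integrand μ a b _) hle).1 heq
  have hneg : ∀ᵐ z ∂μ, Real.sign ⟪a, z⟫ * Real.sign ⟪b, z⟫ = -1 := by
    filter_upwards [hcase, hae] with z hz hz'
    exact hz.resolve_right hz'.not_lt
  rw [integral_congr_ae (g := fun _ => (-1 : ℝ)) hneg] at hab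
  simp only [integral_const, smul_eq_mul, mul_neg_one, neg_eq_zero] at hab
  exact (measureReal_univ_pos (μ := μ)).ne' hab

theorem tendsto_balance_add_smul {a b : E} (ha : a ≠ 0)
    (hab : ∫ z, Real.sign ⟪a, z⟫ * Real.sign ⟪b, z⟫ ∂μ = 0) (w : E) :
    Filter.Tendsto (fun x : ℝ => balance μ a b (w + x • a)) Filter.atTop
      (nhds (Real.pi / 2 * μ.real Set.univ)) := by
  have hlim : ∫ z, (Real.sign ⟪a, z⟫ + Real.sign ⟪b, z⟫) * (Real.pi / 2 * Real.sign ⟪a, z⟫) ∂μ =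
      Real.pi / 2 * μ.real Set.univ := by
    rw [← add_zero (μ.real Set.univ), ← integral_sign_mul_self hH ha, ← hab,
      ← integral_add (integrable_sign_mul_sign a a) (integrable_sign_mul_sign a b),
      ← integral_const_mul]
    exact integral_congr_ae (Filter.Eventually.of_forall fun z => by ring)
  rw [← hlim]
  refine tendsto_integral_filter_of_dominated_convergence (fun _ => 2 * (Real.pi / 2))
    (Filter.Eventually.of_forall fun x =>
      (measurable_balance_integrand a b _).aestronglyMeasurable)
    (Filter.Eventually.of_forall fun x =>
      Filter.Eventually.of_forall (abs_balance_integrand_le a b _))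
    (integrable_const _) ?_
  filter_upwards [hH a ha] with z hz
  refine Filter.Tendsto.const_mul _ (Filter.Tendsto.congr' ?_ (tendsto_arctan_mul_sign
    (r := fun x : ℝ => x) (x := fun x : ℝ => ⟪a, z⟫ + x⁻¹ * ⟪w, z⟫) hz Filter.tendsto_id ?_))
  · filter_upwards [Filter.eventually_ne_atTop 0] with x hx
    rw [inner_add_left, real_inner_smul_left]
    congr 1
    field_simp
    ring
  · simpa using (tendsto_inv_atTop_zero.mul_const ⟪w, z⟫).const_add ⟪a, z⟫

theorem eventually_balance_pos [NeZero μ] {a b : E} (ha : a ≠ 0)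
    (hab : ∫ z, Real.sign ⟪a, z⟫ * Real.sign ⟪b, z⟫ ∂μ = 0) (w : E) :
    ∀ᶠ x : ℝ in Filter.atTop, 0 < balance μ a b (w + x • a) :=
  (tendsto_balance_add_smul hH ha hab w).eventually_const_lt
    (mul_pos (by positivity) (measureReal_univ_pos))

theorem eventually_balance_neg [NeZero μ] {a b : E} (ha : a ≠ 0)
    (hab : ∫ z, Real.sign ⟪a, z⟫ * Real.sign ⟪b, z⟫ ∂μ = 0) (w : E) :
    ∀ᶠ x : ℝ in Filter.atTop, balance μ a b (w + (-x) • a) < 0 := by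
  filter_upwards [eventually_balance_pos hH ha hab (-w)] with x hx
  have : w + (-x) • a = -(-w + x • a) := by module
  rw [this, balance_neg]
  linarith

omit hH [BorelSpace E] [IsFiniteMeasure μ] in
theorem integral_sign_mul_sign_neg {a b : E}
    (hab : ∫ z, Real.sign ⟪a, z⟫ * Real.sign ⟪b, z⟫ ∂μ = 0) :
    ∫ z, Real.sign ⟪a, z⟫ * Real.sign ⟪-b, z⟫ ∂μ = 0 := by
  simp [inner_neg_left, Real.sign_neg, integral_neg, hab]

/-- Two smoothly balanced normals differing by an element of `span {a, b}` coincide. -/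
theorem eq_zero_of_balance_eq_zero [NeZero μ] {a b : E} (ha : a ≠ 0) (hb : b ≠ 0)
    (hab : ∫ z, Real.sign ⟪a, z⟫ * Real.sign ⟪b, z⟫ ∂μ = 0) {w w' : E} {c d : ℝ}
    (hw' : w' = w + c • a + d • b)
    (h₁ : balance μ a b w = 0) (h₂ : balance μ a (-b) w = 0)
    (h₁' : balance μ a b w' = 0) (h₂' : balance μ a (-b) w' = 0) : c = 0 ∧ d = 0 := by
  have hab' := integral_sign_mul_sign_neg hab
  have hb' : -b ≠ 0 := neg_ne_zero.2 hb
  have key : ∀ {c d : ℝ} {w w' : E}, w' = w + c • a + d • b → balance μ a b w = 0 →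
      balance μ a (-b) w = 0 → balance μ a b w' = 0 → balance μ a (-b) w' = 0 → 0 ≤ c →
      c = 0 ∧ d = 0 := by
    intro c d w w' hw' h₁ h₂ h₁' h₂' hc
    by_contra hne
    rcases le_total 0 d with hd | hd
    · have hpos : 0 < c + d := (add_nonneg hc hd).lt_of_ne' fun h => hne (by constructor <;> linarith)
      have := balance_lt_balance_add hH ha hb hab w hc hd hpos
      rw [← hw', h₁, h₁'] at this
      exact this.false
    · have hpos : 0 < c + -d :=
        (add_nonneg hc (neg_nonneg.2 hd)).lt_of_ne' fun h => hne (by constructor <;> linarith)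
      have := balance_lt_balance_add hH ha hb' hab' w hc (neg_nonneg.2 hd) hpos
      rw [neg_smul_neg, ← hw', h₂, h₂'] at this
      exact this.false
  rcases le_total 0 c with hc | hc
  · exact key hw' h₁ h₂ h₁' h₂' hc
  · have hw : w = w' + (-c) • a + (-d) • b := by rw [hw']; module
    simpa using key hw h₁' h₂' h₁ h₂ (neg_nonneg.2 hc)

theorem exists_continuous_balance_eq_zero [NeZero μ] {a b : E} (ha : a ≠ 0) (hb : b ≠ 0)
    (hab : ∫ z, Real.sign ⟪a, z⟫ * Real.sign ⟪b, z⟫ ∂μ = 0) {q : ℝ → E} (hq : Continuous q) :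
    ∃ X Y : ℝ → ℝ, Continuous X ∧ Continuous Y ∧
      (∀ t, balance μ a b (q t + X t • a + Y t • b) = 0) ∧
      ∀ t, balance μ a (-b) (q t + X t • a + Y t • b) = 0 := by
  have hba : ∫ z, Real.sign ⟪b, z⟫ * Real.sign ⟪a, z⟫ ∂μ = 0 := by simpa only [mul_comm] using hab
  have hab' := integral_sign_mul_sign_neg hab
  have hb' : -b ≠ 0 := neg_ne_zero.2 hb
  have hB := continuous_balance μ a b
  have hB' := continuous_balance μ a (-b)
  obtain ⟨Y, hYc, hY⟩ := exists_continuous_root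
    (h := fun (p : ℝ × ℝ) y => balance μ a b (q p.1 + p.2 • a + y • b)) (by fun_prop)
    (fun p y y' hyy => by
      have := balance_lt_balance_add hH ha hb hab (q p.1 + p.2 • a + y • b) le_rfl
        (sub_nonneg.2 hyy.le) (by linarith)
      rwa [show q p.1 + p.2 • a + y • b + (0 : ℝ) • a + (y' - y) • b =
        q p.1 + p.2 • a + y' • b by module] at this)
    (fun p => by
      obtain ⟨y, hy⟩ := (eventually_balance_pos hH hb hba (q p.1 + p.2 • a)).exists
      exact ⟨y, by rwa [balance_comm]⟩)
    (fun p => by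
      obtain ⟨y, hy⟩ := (eventually_balance_neg hH hb hba (q p.1 + p.2 • a)).exists
      exact ⟨-y, by rwa [balance_comm]⟩)
  simp only [Prod.forall] at hY
  obtain ⟨X, hXc, hX⟩ := exists_continuous_root
    (h := fun (t : ℝ) x => balance μ a (-b) (q t + x • a + Y (t, x) • b)) (by fun_prop)
    (fun t x x' hxx => by
      have hYlt : Y (t, x') < Y (t, x) := by
        by_contra! hle
        have := balance_lt_balance_add hH ha hb hab (q t + x • a + Y (t, x) • b)
          (sub_nonneg.2 hxx.le) (sub_nonneg.2 hle) (by linarith)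
        have heq : q t + x • a + Y (t, x) • b + (x' - x) • a + (Y (t, x') - Y (t, x)) • b =
          q t + x' • a + Y (t, x') • b := by module
        rw [heq, hY, hY] at this
        exact this.false
      have := balance_lt_balance_add hH ha hb' hab' (q t + x • a + Y (t, x) • b)
        (sub_nonneg.2 hxx.le) (sub_nonneg.2 hYlt.le) (by linarith)
      rwa [show q t + x • a + Y (t, x) • b + (x' - x) • a + (Y (t, x) - Y (t, x')) • -b =
        q t + x' • a + Y (t, x') • b by module] at this)
    (fun t => by
      obtain ⟨x, hx, hx'⟩ := ((eventually_balance_pos hH ha hab (q t)).and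
        (eventually_balance_pos hH ha hab' (q t))).exists
      have hneg : Y (t, x) < 0 := by
        by_contra! hle
        rcases hle.eq_or_lt with h0 | hlt
        · have := hY t x
          rw [← h0, zero_smul, add_zero] at this
          exact hx.ne' this
        · have := balance_lt_balance_add hH ha hb hab (q t + x • a) le_rfl hlt.le (by linarith)
          rw [zero_smul, add_zero, hY] at this
          exact hx.not_gt this
      have := balance_lt_balance_add hH ha hb' hab' (q t + x • a) le_rfl
        (neg_nonneg.2 hneg.le) (by linarith)
      rw [zero_smul, add_zero, neg_smul_neg] at this
      exact ⟨x, hx'.trans this⟩)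
    (fun t => by
      obtain ⟨x, hx, hx'⟩ := ((eventually_balance_neg hH ha hab (q t)).and
        (eventually_balance_neg hH ha hab' (q t))).exists
      have hpos : 0 < Y (t, -x) := by
        by_contra! hle
        rcases hle.eq_or_lt with h0 | hlt
        · have := hY t (-x)
          rw [h0, zero_smul, add_zero] at this
          exact hx.ne this
        · have := balance_lt_balance_add hH ha hb hab (q t + (-x) • a + Y (t, -x) • b) le_rfl
            (neg_nonneg.2 hlt.le) (by linarith)
          rw [zero_smul, add_zero, neg_smul (Y (t, -x)), add_neg_cancel_right, hY] at this
          exact hx.not_gt this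
      have := balance_lt_balance_add hH ha hb' hab' (q t + (-x) • a + Y (t, -x) • b) le_rfl
        hpos.le (by linarith)
      rw [zero_smul, add_zero, smul_neg, add_neg_cancel_right] at this
      exact ⟨-x, this.trans hx'⟩)
  exact ⟨X, fun t => Y (t, X t), hXc, by fun_prop, fun t => hY t (X t), hX⟩

omit hH in
theorem continuous_integral_mul_arctan_mul_arctan {f : E → ℝ} (hf : Measurable f)
    (hf1 : ∀ z, |f z| ≤ 1) :
    Continuous fun p : E × E =>
      ∫ z, f z * (Real.arctan ⟪p.1, z⟫ * Real.arctan ⟪p.2, z⟫) ∂μ := by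
  refine continuous_of_dominated (bound := fun _ => 1 * (Real.pi / 2 * (Real.pi / 2)))
    (fun p => (hf.mul ((measurable_arctan_inner p.1).mul
      (measurable_arctan_inner p.2))).aestronglyMeasurable)
    (fun p => Filter.Eventually.of_forall fun z => norm_mul_arctan_mul_arctan_le (hf1 z) _ _)
    (integrable_const _) (Filter.Eventually.of_forall fun z => ?_)
  exact continuous_const.mul ((Real.continuous_arctan.comp (by fun_prop)).mul
    (Real.continuous_arctan.comp (by fun_prop)))

theorem integral_arctan_mul_self_pos [NeZero μ] {u : E} (hu : u ≠ 0) :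
    0 < ∫ z, Real.arctan ⟪u, z⟫ * Real.arctan ⟪u, z⟫ ∂μ := by
  refine (integral_nonneg fun z => mul_self_nonneg _).lt_of_ne' fun h0 => ?_
  have hint : Integrable (fun z => Real.arctan ⟪u, z⟫ * Real.arctan ⟪u, z⟫) μ :=
    Integrable.of_bound ((measurable_arctan_inner u).mul
      (measurable_arctan_inner u)).aestronglyMeasurable _ (Filter.Eventually.of_forall fun z => by
        simpa using norm_mul_arctan_mul_arctan_le (c := 1) (by simp) ⟪u, z⟫ ⟪u, z⟫)
  have hae := (integral_eq_zero_iff_of_nonneg (fun z => mul_self_nonneg _) hint).1 h0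
  obtain ⟨z, hz, hz'⟩ := (hae.and (hH u hu)).exists
  exact hz' (by simpa using hz)

/-- Smoothed simultaneous quartering: two normals of large norm which are balanced with respect
to `a` and `b` and uncorrelated on both double wedges. -/
theorem exists_smoothed_quartering [NeZero μ] {a b : E} (ha : a ≠ 0) (hb : b ≠ 0)
    (hab : ∫ z, Real.sign ⟪a, z⟫ * Real.sign ⟪b, z⟫ ∂μ = 0) {p₁ p₂ : E}
    (hp₁ : ‖p₁‖ = 1) (hp₂ : ‖p₂‖ = 1) (hp : ⟪p₁, p₂⟫ = 0) (h₁a : ⟪p₁, a⟫ = 0)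
    (h₁b : ⟪p₁, b⟫ = 0) (h₂a : ⟪p₂, a⟫ = 0) (h₂b : ⟪p₂, b⟫ = 0) {R : ℝ} (hR : 0 < R) :
    ∃ u v : E, (∀ w ∈ ({u, v} : Set E), R ≤ ‖w‖ ∧
        ∫ z, Real.sign ⟪a, z⟫ * Real.arctan ⟪w, z⟫ ∂μ = 0 ∧
        ∫ z, Real.sign ⟪b, z⟫ * Real.arctan ⟪w, z⟫ ∂μ = 0) ∧
      ∫ z, Real.arctan ⟪u, z⟫ * Real.arctan ⟪v, z⟫ ∂μ = 0 ∧
      ∫ z, Real.sign ⟪a, z⟫ * Real.sign ⟪b, z⟫ *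
        (Real.arctan ⟪u, z⟫ * Real.arctan ⟪v, z⟫) ∂μ = 0 := by
  let q : ℝ → E := fun t => R • (Real.cos t • p₁ + Real.sin t • p₂)
  obtain ⟨X, Y, hX, hY, hU₁, hU₂⟩ := exists_continuous_balance_eq_zero hH ha hb hab
    (by fun_prop : Continuous q)
  let U : ℝ → E := fun t => q t + X t • a + Y t • b
  have hUc : Continuous U := by fun_prop
  have hUneg : ∀ t, U (t + Real.pi) = -U t := fun t => by
    have hq : q (t + Real.pi) = -q t := by
      simp only [q, Real.cos_add_pi, Real.sin_add_pi]; module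
    obtain ⟨hx, hy⟩ := eq_zero_of_balance_eq_zero hH ha hb hab (w := -U t) (w' := U (t + Real.pi))
      (c := X (t + Real.pi) + X t) (d := Y (t + Real.pi) + Y t)
      (by simp only [U, hq]; module)
      (by rw [balance_neg, hU₁, neg_zero]) (by rw [balance_neg, hU₂, neg_zero]) (hU₁ _) (hU₂ _)
    simp only [U, hq, eq_neg_of_add_eq_zero_left hx, eq_neg_of_add_eq_zero_left hy]
    module
  have hnorm : ∀ t, R ≤ ‖U t‖ := fun t => by
    have h₁₁ : ⟪p₁, p₁⟫ = (1 : ℝ) := by rw [real_inner_self_eq_norm_sq, hp₁, one_pow]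
    have h₂₂ : ⟪p₂, p₂⟫ = (1 : ℝ) := by rw [real_inner_self_eq_norm_sq, hp₂, one_pow]
    have h₂₁ : ⟪p₂, p₁⟫ = (0 : ℝ) := by rw [real_inner_comm, hp]
    have hcs := Real.cos_sq_add_sin_sq t
    let e := Real.cos t • p₁ + Real.sin t • p₂
    have he : ⟪e, e⟫ = (1 : ℝ) := by
      simp only [e, inner_add_left, inner_add_right, real_inner_smul_left, real_inner_smul_right,
        h₁₁, h₂₂, h₂₁, hp]
      linear_combination hcs
    have he1 : ‖e‖ = 1 := by
      rw [real_inner_self_eq_norm_sq] at he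
      exact (pow_eq_one_iff_of_nonneg (norm_nonneg e) two_ne_zero).1 he
    have hea : ⟪e, a⟫ = (0 : ℝ) := by simp [e, inner_add_left, real_inner_smul_left, h₁a, h₂a]
    have heb : ⟪e, b⟫ = (0 : ℝ) := by simp [e, inner_add_left, real_inner_smul_left, h₁b, h₂b]
    have heU : ⟪e, U t⟫ = R := by
      change ⟪e, R • e + X t • a + Y t • b⟫ = R
      simp only [inner_add_right, real_inner_smul_right, he, hea, heb, mul_zero, add_zero, mul_one]
    calc R = ⟪e, U t⟫ := heU.symm
      _ ≤ ‖e‖ * ‖U t‖ := real_inner_le_norm _ _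
      _ = ‖U t‖ := by rw [he1, one_mul]
  have hU0 : ∀ t, U t ≠ 0 := fun t => norm_pos_iff.1 (hR.trans_le (hnorm t))
  have hsplit : ∀ t, ∫ z, Real.sign ⟪a, z⟫ * Real.arctan ⟪U t, z⟫ ∂μ = 0 ∧
      ∫ z, Real.sign ⟪b, z⟫ * Real.arctan ⟪U t, z⟫ ∂μ = 0 := fun t => by
    have i₁ := integrable_balance_integrand μ a b (U t)
    have i₂ := integrable_balance_integrand μ a (-b) (U t)
    have hadd := integral_add i₁ i₂
    have hsub := integral_sub i₁ i₂
    change _ = balance μ a b (U t) + balance μ a (-b) (U t) at hadd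
    change _ = balance μ a b (U t) - balance μ a (-b) (U t) at hsub
    rw [hU₁, hU₂, add_zero] at hadd
    rw [hU₁, hU₂, sub_zero] at hsub
    simp only [inner_neg_left, Real.sign_neg] at hadd hsub
    constructor
    · refine (mul_eq_zero.1 (?_ : (2 : ℝ) * _ = 0)).resolve_left two_ne_zero
      rw [← integral_const_mul, ← hadd]
      exact integral_congr_ae (Filter.Eventually.of_forall fun z => by ring)
    · refine (mul_eq_zero.1 (?_ : (2 : ℝ) * _ = 0)).resolve_left two_ne_zero
      rw [← integral_const_mul, ← hsub]
      exact integral_congr_ae (Filter.Eventually.of_forall fun z => by ring)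
  have hc₁ := continuous_integral_mul_arctan_mul_arctan (μ := μ) (f := fun _ => 1)
    measurable_const (by simp)
  have hc₂ := continuous_integral_mul_arctan_mul_arctan (μ := μ)
    (f := fun z => Real.sign ⟪a, z⟫ * Real.sign ⟪b, z⟫)
    ((measurable_sign_inner a).mul (measurable_sign_inner b)) (fun z => by
      rw [abs_mul]
      exact mul_le_one₀ (abs_real_sign_le_one _) (abs_nonneg _) (abs_real_sign_le_one _))
  simp only [one_mul] at hc₁
  have hUU : Continuous fun p : ℝ × ℝ => (U p.1, U p.2) := by fun_prop
  obtain ⟨s, t, hst⟩ := exists_eq_zero_of_antiperiodic_of_symm (T := Real.pi)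
    (g := fun s t => ((∫ z, Real.arctan ⟪U s, z⟫ * Real.arctan ⟪U t, z⟫ ∂μ : ℝ) : ℂ) +
      (∫ z, Real.sign ⟪a, z⟫ * Real.sign ⟪b, z⟫ *
        (Real.arctan ⟪U s, z⟫ * Real.arctan ⟪U t, z⟫) ∂μ : ℝ) * Complex.I)
    ((Complex.continuous_ofReal.comp (hc₁.comp hUU)).add
      ((Complex.continuous_ofReal.comp (hc₂.comp hUU)).mul continuous_const))
    (fun s t => by
      simp only [hUneg, inner_neg_left, Real.arctan_neg, neg_mul, mul_neg, integral_neg,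
        Complex.ofReal_neg]
      ring)
    (fun s t => by simp only [mul_comm (Real.arctan ⟪U s, _⟫)])
    (fun t => by simpa using integral_arctan_mul_self_pos hH (hU0 t))
  refine ⟨U s, U t, ?_, by simpa using congrArg Complex.re hst,
    by simpa using congrArg Complex.im hst⟩
  rintro w (rfl | rfl)
  exacts [⟨hnorm s, hsplit s⟩, ⟨hnorm t, hsplit t⟩]

theorem tendsto_integral_mul_arctan {f : E → ℝ} (hf : Measurable f) (hf1 : ∀ z, |f z| ≤ 1)
    {r : ℕ → ℝ} (hr : Filter.Tendsto r Filter.atTop Filter.atTop) {x : ℕ → E} {u : E}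
    (hu : u ≠ 0) (hx : Filter.Tendsto x Filter.atTop (nhds u)) :
    Filter.Tendsto (fun n => ∫ z, f z * Real.arctan (r n * ⟪x n, z⟫) ∂μ) Filter.atTop
      (nhds (∫ z, f z * (Real.pi / 2 * Real.sign ⟪u, z⟫) ∂μ)) := by
  refine tendsto_integral_of_dominated_convergence (fun _ => 1 * (Real.pi / 2))
    (fun n => ?_) (integrable_const _) (fun n => Filter.Eventually.of_forall fun z => ?_) ?_
  · simp only [← real_inner_smul_left]
    exact (hf.mul (measurable_arctan_inner _)).aestronglyMeasurable
  · rw [norm_mul]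
    exact mul_le_mul (hf1 z) (abs_arctan_le_pi_div_two _) (norm_nonneg _) zero_le_one
  · filter_upwards [hH u hu] with z hz
    exact (tendsto_arctan_mul_sign hz hr (hx.inner tendsto_const_nhds)).const_mul _

theorem tendsto_integral_mul_arctan_mul_arctan {f : E → ℝ} (hf : Measurable f)
    (hf1 : ∀ z, |f z| ≤ 1) {r s : ℕ → ℝ} (hr : Filter.Tendsto r Filter.atTop Filter.atTop)
    (hs : Filter.Tendsto s Filter.atTop Filter.atTop) {x y : ℕ → E} {u v : E}
    (hu : u ≠ 0) (hv : v ≠ 0) (hx : Filter.Tendsto x Filter.atTop (nhds u))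
    (hy : Filter.Tendsto y Filter.atTop (nhds v)) :
    Filter.Tendsto
      (fun n => ∫ z, f z * (Real.arctan (r n * ⟪x n, z⟫) * Real.arctan (s n * ⟪y n, z⟫)) ∂μ)
      Filter.atTop (nhds (∫ z, f z * ((Real.pi / 2 * Real.sign ⟪u, z⟫) *
        (Real.pi / 2 * Real.sign ⟪v, z⟫)) ∂μ)) := by
  refine tendsto_integral_of_dominated_convergence
    (fun _ => 1 * (Real.pi / 2 * (Real.pi / 2))) (fun n => ?_) (integrable_const _)
    (fun n => Filter.Eventually.of_forall fun z => norm_mul_arctan_mul_arctan_le (hf1 z) _ _) ?_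
  · simp only [← real_inner_smul_left]
    exact (hf.mul ((measurable_arctan_inner _).mul
      (measurable_arctan_inner _))).aestronglyMeasurable
  · filter_upwards [hH u hu, hH v hv] with z hzu hzv
    exact ((tendsto_arctan_mul_sign hzu hr (hx.inner tendsto_const_nhds)).mul
      (tendsto_arctan_mul_sign hzv hs (hy.inner tendsto_const_nhds))).const_mul _

/-- Simultaneous quartering of both double wedges cut out by `a` and `b`. -/
theorem exists_quartering [FiniteDimensional ℝ E] [NeZero μ] {a b : E} (ha : a ≠ 0) (hb : b ≠ 0)
    (hab : ∫ z, Real.sign ⟪a, z⟫ * Real.sign ⟪b, z⟫ ∂μ = 0) {p₁ p₂ : E}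
    (hp₁ : ‖p₁‖ = 1) (hp₂ : ‖p₂‖ = 1) (hp : ⟪p₁, p₂⟫ = 0) (h₁a : ⟪p₁, a⟫ = 0)
    (h₁b : ⟪p₁, b⟫ = 0) (h₂a : ⟪p₂, a⟫ = 0) (h₂b : ⟪p₂, b⟫ = 0) :
    ∃ u v : E, (∀ w ∈ ({u, v} : Set E), w ≠ 0 ∧
        ∫ z, Real.sign ⟪a, z⟫ * Real.sign ⟪w, z⟫ ∂μ = 0 ∧
        ∫ z, Real.sign ⟪b, z⟫ * Real.sign ⟪w, z⟫ ∂μ = 0) ∧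
      ∫ z, Real.sign ⟪u, z⟫ * Real.sign ⟪v, z⟫ ∂μ = 0 ∧
      ∫ z, Real.sign ⟪a, z⟫ * Real.sign ⟪b, z⟫ *
        (Real.sign ⟪u, z⟫ * Real.sign ⟪v, z⟫) ∂μ = 0 := by
  choose U V hUV hc₁ hc₂ using fun n : ℕ => exists_smoothed_quartering hH ha hb hab hp₁ hp₂ hp
    h₁a h₁b h₂a h₂b (Nat.cast_add_one_pos n : (0 : ℝ) < n + 1)
  have hmem : ∀ (W : ℕ → E), (∀ n : ℕ, (n + 1 : ℝ) ≤ ‖W n‖) → ∀ n,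
      ‖W n‖⁻¹ • W n ∈ Metric.sphere (0 : E) 1 := fun W hW n => by
    have : 0 < ‖W n‖ := (Nat.cast_add_one_pos n).trans_le (hW n)
    rw [mem_sphere_zero_iff_norm, norm_smul, norm_inv, norm_norm, inv_mul_cancel₀ this.ne']
  have hUn : ∀ n : ℕ, (n + 1 : ℝ) ≤ ‖U n‖ := fun n => (hUV n (U n) (by simp)).1
  have hVn : ∀ n : ℕ, (n + 1 : ℝ) ≤ ‖V n‖ := fun n => (hUV n (V n) (by simp)).1
  obtain ⟨⟨u, v⟩, ⟨hu, hv⟩, φ, hφ, hlim⟩ :=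
    ((isCompact_sphere (0 : E) 1).prod (isCompact_sphere (0 : E) 1)).tendsto_subseq
      (x := fun n => (‖U n‖⁻¹ • U n, ‖V n‖⁻¹ • V n)) fun n => ⟨hmem U hUn n, hmem V hVn n⟩
  have hu0 : u ≠ 0 := ne_zero_of_mem_unit_sphere ⟨u, hu⟩
  have hv0 : v ≠ 0 := ne_zero_of_mem_unit_sphere ⟨v, hv⟩
  have hulim := (Prod.tendsto_iff _ _).1 hlim |>.1
  have hvlim := (Prod.tendsto_iff _ _).1 hlim |>.2
  have hnorm : ∀ W : ℕ → E, (∀ n : ℕ, (n + 1 : ℝ) ≤ ‖W n‖) →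
      Filter.Tendsto (fun n => ‖W (φ n)‖) Filter.atTop Filter.atTop := fun W hW =>
    (Filter.tendsto_atTop_mono (fun n : ℕ => (lt_add_one (n : ℝ)).le.trans (hW n))
      tendsto_natCast_atTop_atTop).comp hφ.tendsto_atTop
  have hinner : ∀ W : ℕ → E, (∀ n : ℕ, (n + 1 : ℝ) ≤ ‖W n‖) → ∀ n z,
      ‖W n‖ * ⟪‖W n‖⁻¹ • W n, z⟫ = ⟪W n, z⟫ := fun W hW n z => by
    have : 0 < ‖W n‖ := (Nat.cast_add_one_pos n).trans_le (hW n)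
    rw [real_inner_smul_left, mul_inv_cancel_left₀ this.ne']
  have hπ : Real.pi / 2 ≠ 0 := by positivity
  have single : ∀ {c w : E} {W : ℕ → E}, (∀ n : ℕ, (n + 1 : ℝ) ≤ ‖W n‖) →
      Filter.Tendsto (fun n => ‖W (φ n)‖⁻¹ • W (φ n)) Filter.atTop (nhds w) → w ≠ 0 →
      (∀ n, ∫ z, Real.sign ⟪c, z⟫ * Real.arctan ⟪W n, z⟫ ∂μ = 0) →
      ∫ z, Real.sign ⟪c, z⟫ * Real.sign ⟪w, z⟫ ∂μ = 0 := by
    intro c w W hW hw hw0 h0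
    have := tendsto_integral_mul_arctan hH (measurable_sign_inner c)
      (fun z => abs_real_sign_le_one _) (hnorm W hW) hw0 hw
    simp only [hinner W hW, h0, mul_left_comm _ (Real.pi / 2), integral_const_mul] at this
    exact (mul_eq_zero.1 (tendsto_nhds_unique this tendsto_const_nhds)).resolve_left hπ
  have double : ∀ {f : E → ℝ}, Measurable f → (∀ z, |f z| ≤ 1) →
      (∀ n, ∫ z, f z * (Real.arctan ⟪U n, z⟫ * Real.arctan ⟪V n, z⟫) ∂μ = 0) →
      ∫ z, f z * (Real.sign ⟪u, z⟫ * Real.sign ⟪v, z⟫) ∂μ = 0 := by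
    intro f hf hf1 h0
    have := tendsto_integral_mul_arctan_mul_arctan hH hf hf1 (hnorm U hUn) (hnorm V hVn) hu0 hv0
      hulim hvlim
    have heq : ∫ z, f z * ((Real.pi / 2 * Real.sign ⟪u, z⟫) * (Real.pi / 2 * Real.sign ⟪v, z⟫)) ∂μ =
        Real.pi / 2 * (Real.pi / 2) * ∫ z, f z * (Real.sign ⟪u, z⟫ * Real.sign ⟪v, z⟫) ∂μ := by
      rw [← integral_const_mul]
      exact integral_congr_ae (Filter.Eventually.of_forall fun z => by ring)
    simp only [Function.comp_apply, hinner U hUn, hinner V hVn, h0, heq] at this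
    exact (mul_eq_zero.1 (tendsto_nhds_unique this tendsto_const_nhds)).resolve_left
      (mul_ne_zero hπ hπ)
  refine ⟨u, v, ?_, ?_, ?_⟩
  · rintro w (rfl | rfl)
    · exact ⟨hu0, single hUn hulim hu0 fun n => (hUV n (U n) (by simp)).2.1,
        single hUn hulim hu0 fun n => (hUV n (U n) (by simp)).2.2⟩
    · exact ⟨hv0, single hVn hvlim hv0 fun n => (hUV n (V n) (by simp)).2.1,
        single hVn hvlim hv0 fun n => (hUV n (V n) (by simp)).2.2⟩
  · simpa using double (f := fun _ => 1) measurable_const (by simp) (by simpa using hc₁)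
  · refine double ((measurable_sign_inner a).mul (measurable_sign_inner b)) (fun z => ?_) hc₂
    rw [abs_mul]
    exact mul_le_one₀ (abs_real_sign_le_one _) (abs_nonneg _) (abs_real_sign_le_one _)

/-- Given two orthogonal normals, some normal in their span has a hyperplane which halves both
sides of the hyperplane of the first one. -/
theorem exists_integral_sign_mul_sign_eq_zero {a e : E} (ha : a ≠ 0) (he : e ≠ 0)
    (hae : ⟪a, e⟫ = 0) :
    ∃ b : E, b ≠ 0 ∧ ∫ z, Real.sign ⟪a, z⟫ * Real.sign ⟪b, z⟫ ∂μ = 0 := by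
  let B : ℝ → E := fun t => Real.cos t • a + Real.sin t • e
  have hB : ∀ t, B t ≠ 0 := fun t h => by
    have h₁ : ⟪a, B t⟫ = (0 : ℝ) := by rw [h, inner_zero_right]
    have h₂ : ⟪e, B t⟫ = (0 : ℝ) := by rw [h, inner_zero_right]
    rw [inner_add_right, real_inner_smul_right, real_inner_smul_right] at h₁ h₂
    rw [hae, mul_zero, add_zero, mul_eq_zero, inner_self_eq_zero] at h₁
    rw [real_inner_comm, hae, mul_zero, zero_add, mul_eq_zero, inner_self_eq_zero] at h₂
    have hcs := Real.cos_sq_add_sin_sq t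
    rw [h₁.resolve_right ha, h₂.resolve_right he] at hcs
    norm_num at hcs
  have hc : Continuous fun t => ∫ z, Real.sign ⟪a, z⟫ * Real.sign ⟪B t, z⟫ ∂μ := by
    refine continuous_iff_continuousAt.2 fun t => ?_
    refine continuousAt_of_dominated (bound := fun _ => 1)
      (Filter.Eventually.of_forall fun s =>
        ((measurable_sign_inner a).mul (measurable_sign_inner (B s))).aestronglyMeasurable)
      (Filter.Eventually.of_forall fun s => Filter.Eventually.of_forall fun z => ?_)
      (integrable_const _) ?_
    · rw [norm_mul]
      exact mul_le_one₀ (abs_real_sign_le_one _) (norm_nonneg _) (abs_real_sign_le_one _)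
    · filter_upwards [hH (B t) (hB t)] with z hz
      refine continuousAt_const.mul (ContinuousAt.comp (f := fun s => ⟪B s, z⟫)
        (continuousAt_real_sign hz) (Continuous.continuousAt ?_))
      fun_prop
  obtain ⟨t, ht⟩ := mem_range_of_exists_le_of_exists_ge hc (c := 0)
    ⟨Real.pi, by simp [B, Real.sign_neg, integral_neg, integral_sign_mul_self hH ha]⟩
    ⟨0, by simp [B, integral_sign_mul_self hH ha]⟩
  exact ⟨B t, hB t, ht⟩

end Balance

/-- If all mixed sign moments of the linear forms `a i` vanish, each orthant cut out by their
kernels gets its proportional share. -/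
theorem isEquipartition_of_integral_prod_sign_eq_zero {n : ℕ}
    {μ : Measure (EuclideanSpace ℝ (Fin n))} [IsFiniteMeasure μ]
    {a : Fin n → EuclideanSpace ℝ (Fin n)} (ha : ∀ i, ∀ᵐ z ∂μ, ⟪a i, z⟫ ≠ 0)
    (h : ∀ S : Finset (Fin n), S.Nonempty → ∫ z, ∏ i ∈ S, Real.sign ⟪a i, z⟫ ∂μ = 0) :
    IsEquipartition μ a 0 := by
  classical
  intro ε
  let e : Fin n → ℝ := fun i => if ε i then -1 else 1
  have hmeas : MeasurableSet (⋂ i, closedHalfspace (a i) ((0 : Fin n → ℝ) i) (ε i)) := by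
    refine MeasurableSet.iInter fun i => ?_
    unfold closedHalfspace
    split_ifs
    · exact measurableSet_le (by fun_prop) (by fun_prop)
    · exact measurableSet_le (by fun_prop) (by fun_prop)
  have hind : (⋂ i, closedHalfspace (a i) ((0 : Fin n → ℝ) i) (ε i)).indicator
      (1 : EuclideanSpace ℝ (Fin n) → ℝ) =ᵐ[μ]
      fun z => (2 ^ n)⁻¹ * ∏ i, (1 + e i * Real.sign ⟪a i, z⟫) := by
    filter_upwards [ae_all_iff.2 ha] with z hz
    have hfac : ∀ i, 1 + e i * Real.sign ⟪a i, z⟫ =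
        if z ∈ closedHalfspace (a i) ((0 : Fin n → ℝ) i) (ε i) then 2 else 0 := fun i => by
      rcases (hz i).lt_or_gt with hi | hi <;> cases hε : ε i <;>
        simp [e, hε, closedHalfspace, Real.sign_of_neg, Real.sign_of_pos, hi, hi.le, hi.not_ge] <;>
        norm_num
    simp only [hfac]
    by_cases hmem : z ∈ ⋂ i, closedHalfspace (a i) ((0 : Fin n → ℝ) i) (ε i)
    · rw [Set.indicator_of_mem hmem, Finset.prod_congr rfl fun i _ =>
        if_pos (Set.mem_iInter.1 hmem i)]
      simp
    · rw [Set.indicator_of_notMem hmem]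
      simp only [Set.mem_iInter, not_forall] at hmem
      obtain ⟨i, hi⟩ := hmem
      rw [Finset.prod_eq_zero (Finset.mem_univ i) (if_neg hi), mul_zero]
  have hint : ∀ S : Finset (Fin n), Integrable (fun z => ∏ i ∈ S, e i * Real.sign ⟪a i, z⟫) μ :=
    fun S => by
      refine Integrable.of_bound (Finset.measurable_fun_prod S fun i _ =>
        (measurable_sign_inner (a i)).const_mul (e i)).aestronglyMeasurable 1
        (Filter.Eventually.of_forall fun z => ?_)
      rw [norm_prod]
      refine Finset.prod_le_one (fun i _ => norm_nonneg _) fun i _ => ?_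
      rw [norm_mul]
      refine mul_le_one₀ ?_ (norm_nonneg _) (abs_real_sign_le_one _)
      simp only [e]
      split_ifs <;> simp
  have hreal : μ.real (⋂ i, closedHalfspace (a i) ((0 : Fin n → ℝ) i) (ε i)) =
      (2 ^ n)⁻¹ * μ.real Set.univ := by
    rw [← integral_indicator_one hmeas, integral_congr_ae hind, integral_const_mul]
    simp only [Finset.prod_one_add]
    rw [integral_finsetSum _ fun S _ => hint S, Finset.sum_eq_single ∅]
    · simp
    · intro S _ hS
      simp only [Finset.prod_mul_distrib]
      rw [integral_const_mul, h S (Finset.nonempty_iff_ne_empty.2 hS), mul_zero]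
    · simp
  rw [← ofReal_measureReal (s := ⋂ i, _), hreal, ENNReal.ofReal_mul (by positivity),
    ofReal_measureReal, ENNReal.ofReal_inv_of_pos (by positivity), mul_comm, ENNReal.div_eq_inv_mul,
    mul_comm, ENNReal.ofReal_pow zero_le_two]
  simp

theorem integral_prod_sign_eq_zero_of_odd {n : ℕ} {μ : Measure (EuclideanSpace ℝ (Fin n))}
    (hneg : μ.map (fun z => -z) = μ) (a : Fin n → EuclideanSpace ℝ (Fin n))
    {S : Finset (Fin n)} (hS : Odd S.card) :
    ∫ z, ∏ i ∈ S, Real.sign ⟪a i, z⟫ ∂μ = 0 := by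
  have hmap := integral_map (μ := μ) (φ := fun z => -z) measurable_neg.aemeasurable
    (f := fun z => ∏ i ∈ S, Real.sign ⟪a i, z⟫)
    (Finset.measurable_fun_prod S fun i _ => measurable_sign_inner (a i)).aestronglyMeasurable
  simp only [hneg, inner_neg_right, Real.sign_neg, Finset.prod_neg, hS.neg_one_pow, neg_one_mul,
    integral_neg] at hmap
  linarith

theorem exists_isEquipartition_of_map_neg {μ : Measure (EuclideanSpace ℝ (Fin 4))}
    [IsFiniteMeasure μ] [NeZero μ]
    (hH : ∀ u : EuclideanSpace ℝ (Fin 4), u ≠ 0 → ∀ᵐ z ∂μ, ⟪u, z⟫ ≠ 0)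
    (hneg : μ.map (fun z => -z) = μ) {a₁ : EuclideanSpace ℝ (Fin 4)} (ha₁ : a₁ ≠ 0) :
    ∃ a : Fin 4 → EuclideanSpace ℝ (Fin 4),
      a 0 = a₁ ∧ (∀ i, a i ≠ 0) ∧ IsEquipartition μ a 0 := by
  have hfin : Module.finrank ℝ (EuclideanSpace ℝ (Fin 4)) = 4 := by simp
  obtain ⟨e, he, he0⟩ : ∃ e ∈ (Submodule.span ℝ {a₁})ᗮ, e ≠ 0 := by
    refine Submodule.exists_mem_ne_zero_of_ne_bot fun hbot => ?_
    have h₁ := (Submodule.span ℝ {a₁}).finrank_add_finrank_orthogonal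
    rw [hbot, finrank_bot, finrank_span_singleton ha₁, hfin] at h₁
    omega
  obtain ⟨b, hb, hab⟩ := exists_integral_sign_mul_sign_eq_zero hH ha₁ he0
    (Submodule.mem_orthogonal_singleton_iff_inner_right.1 he)
  let K := Submodule.span ℝ (({a₁, b} : Finset (EuclideanSpace ℝ (Fin 4))) :
    Set (EuclideanSpace ℝ (Fin 4)))
  have hK : 2 ≤ Module.finrank ℝ Kᗮ := by
    have h₁ := K.finrank_add_finrank_orthogonal
    have h₂ : Module.finrank ℝ K ≤ 2 := (finrank_span_finset_le_card _).trans Finset.card_le_two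
    omega
  let p := stdOrthonormalBasis ℝ Kᗮ
  have horth : ∀ (x : Kᗮ) (c : EuclideanSpace ℝ (Fin 4)),
      c ∈ ({a₁, b} : Finset (EuclideanSpace ℝ (Fin 4))) → ⟪(x : EuclideanSpace ℝ (Fin 4)), c⟫ = 0 :=
    fun x c hc => Submodule.inner_left_of_mem_orthogonal (Submodule.subset_span hc) x.2
  let i₀ : Fin (Module.finrank ℝ Kᗮ) := ⟨0, by omega⟩
  let i₁ : Fin (Module.finrank ℝ Kᗮ) := ⟨1, by omega⟩
  obtain ⟨u, v, hw, huv, hauv⟩ := exists_quartering hH ha₁ hb hab (p₁ := p i₀) (p₂ := p i₁)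
    (p.orthonormal.1 i₀) (p.orthonormal.1 i₁) (p.orthonormal.2 (by simp [i₀, i₁]))
    (horth _ _ (by simp)) (horth _ _ (by simp)) (horth _ _ (by simp)) (horth _ _ (by simp))
  obtain ⟨hu0, hau, hbu⟩ := hw u (by simp)
  obtain ⟨hv0, hav, hbv⟩ := hw v (by simp)
  have ha0 : ∀ i, (![a₁, b, u, v] : Fin 4 → EuclideanSpace ℝ (Fin 4)) i ≠ 0 := by
    intro i
    fin_cases i <;> assumption
  refine ⟨![a₁, b, u, v], rfl, ha0,
    isEquipartition_of_integral_prod_sign_eq_zero (fun i => hH _ (ha0 i)) fun S hS => ?_⟩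
  have hcases : ∀ S : Finset (Fin 4), S.Nonempty → Odd S.card ∨ S = {0, 1} ∨ S = {0, 2} ∨
      S = {0, 3} ∨ S = {1, 2} ∨ S = {1, 3} ∨ S = {2, 3} ∨ S = {0, 1, 2, 3} := by decide
  rcases hcases S hS with h | rfl | rfl | rfl | rfl | rfl | rfl | rfl
  · exact integral_prod_sign_eq_zero_of_odd hneg _ h
  · simpa using hab
  · simpa using hau
  · simpa using hav
  · simpa using hbu
  · simpa using hbv
  · simpa using huv
  · simpa [mul_assoc] using hauv

/-- Every continuous mass distribution on `ℝ^4` with a center of symmetry `O` admits an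
equipartition by `4` hyperplanes; moreover the first hyperplane can be prescribed in
advance to be an arbitrary hyperplane through `O`. -/
theorem equipartition_of_central_symmetry
    (μ : Measure (EuclideanSpace ℝ (Fin 4))) [IsFiniteMeasure μ]
    (hμ0 : μ ≠ 0) (hac : μ ≪ volume)
    (O : EuclideanSpace ℝ (Fin 4))
    (hsym : ∀ A : Set (EuclideanSpace ℝ (Fin 4)), MeasurableSet A →
      μ ((fun x => (2 : ℝ) • O - x) '' A) = μ A) :
    ∀ a₁ : EuclideanSpace ℝ (Fin 4), a₁ ≠ 0 →
      ∃ (a : Fin 4 → EuclideanSpace ℝ (Fin 4)) (c : Fin 4 → ℝ),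
        a 0 = a₁ ∧ c 0 = ⟪a₁, O⟫ ∧ (∀ i, a i ≠ 0) ∧ IsEquipartition μ a c := by
  intro a₁ ha₁
  let τ : EuclideanSpace ℝ (Fin 4) ≃ᵐ EuclideanSpace ℝ (Fin 4) := MeasurableEquiv.subRight O
  have hτ : ∀ z, τ z = z - O := fun z => rfl
  have : NeZero (μ.map τ) := ⟨by rwa [Ne, Measure.map_eq_zero_iff τ.measurable.aemeasurable]⟩
  have hH : ∀ u : EuclideanSpace ℝ (Fin 4), u ≠ 0 → ∀ᵐ z ∂μ.map τ, ⟪u, z⟫ ≠ 0 := by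
    intro u hu
    have hvol : ∀ᵐ z : EuclideanSpace ℝ (Fin 4), ⟪u, z⟫ ≠ 0 := by
      have h0 := Measure.addHaar_submodule volume (Submodule.span ℝ {u})ᗮ (by
        rw [Ne, Submodule.orthogonal_eq_top_iff, Submodule.span_singleton_eq_bot]
        exact hu)
      filter_upwards [measure_eq_zero_iff_ae_notMem.1 h0] with z hz h
      exact hz (Submodule.mem_orthogonal_singleton_iff_inner_right.2 h)
    have hac' : μ.map τ ≪ volume := by
      have := hac.map τ.measurable
      rwa [show (volume : Measure (EuclideanSpace ℝ (Fin 4))).map τ = volume from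
        (measurePreserving_sub_right volume O).map_eq] at this
    exact hac'.ae_le hvol
  have hneg : (μ.map τ).map (fun z => -z) = μ.map τ := by
    ext A hA
    rw [Measure.map_apply measurable_neg hA, Measure.map_apply τ.measurable (measurable_neg hA),
      Measure.map_apply τ.measurable hA, ← hsym _ (τ.measurable hA)]
    congr 1
    ext z
    simp only [Set.mem_preimage, hτ, Set.mem_image]
    constructor
    · exact fun h => ⟨(2 : ℝ) • O - z, by convert h using 1; module, by module⟩
    · rintro ⟨x, hx, rfl⟩
      convert hx using 1
      module
  obtain ⟨a, h0, hne, heq⟩ := exists_isEquipartition_of_map_neg hH hneg ha₁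
  refine ⟨a, fun i => ⟪a i, O⟫, h0, congrArg (⟪·, O⟫) h0, hne, fun ε => ?_⟩
  have hpre : ⋂ i, closedHalfspace (a i) ⟪a i, O⟫ (ε i) =
      τ ⁻¹' ⋂ i, closedHalfspace (a i) ((0 : Fin 4 → ℝ) i) (ε i) := by
    ext z
    simp only [Set.mem_iInter, Set.mem_preimage]
    refine forall_congr' fun i => ?_
    cases ε i <;> simp [closedHalfspace, hτ, inner_sub_right]
  rw [hpre, ← τ.map_apply, heq, τ.map_apply, Set.preimage_univ]
end

section
/- Every continuous mass distribution μ on ℝ^3 admits a 3-equipartition: there exist three planes H_1, H_2, H_3 in ℝ^3 dissecting ℝ^3 into eight closed octants each of measure μ(ℝ^3)/8. Moreover, the first plane H_1 can be chosen to contain any two points A, B ∈ ℝ^3 prescribed in advance. -/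
open MeasureTheory RealInnerProductSpace

open Topology

theorem exists_continuous_exp_eq {X : Type*} [TopologicalSpace X] [SimplyConnectedSpace X]
    [LocallyPathConnectedSpace X] {f : X → ℂ} (hf : Continuous f) (h0 : ∀ x, f x ≠ 0) :
    ∃ L : X → ℂ, Continuous L ∧ ∀ x, Complex.exp (L x) = f x := by
  obtain ⟨x₀⟩ : Nonempty X := inferInstance
  obtain ⟨L, ⟨-, hL⟩, -⟩ := Complex.isCoveringMapOn_exp.existsUnique_continuousMap_lifts
    (⟨f, hf⟩ : C(X, ℂ)) (a₀ := x₀) (e₀ := Complex.log (f x₀))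
    (by simp [Complex.exp_log (h0 x₀)]) (fun a => by simpa using h0 a)
  exact ⟨L, L.continuous, fun x => congrFun hL x⟩

theorem eq_of_exp_eq {X : Type*} [TopologicalSpace X] [PreconnectedSpace X]
    {L M : X → ℂ} (hL : Continuous L) (hM : Continuous M)
    (h : ∀ x, Complex.exp (L x) = Complex.exp (M x)) (x₀ : X) (h₀ : L x₀ = M x₀) (x : X) :
    L x = M x := by
  refine congrFun (Complex.isCoveringMap_exp.eq_of_comp_eq hL hM ?_ x₀ h₀) x
  ext y
  exact h y

/-- The Borsuk–Ulam theorem for maps from the two-dimensional sphere to the plane. -/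
theorem exists_eq_zero_of_odd {g : EuclideanSpace ℝ (Fin 3) → ℂ} (hg : ContinuousOn g {0}ᶜ)
    (hodd : ∀ x ≠ 0, g (-x) = -g x) : ∃ x ≠ 0, g x = 0 := by
  by_contra! hne
  let h : ℂ → EuclideanSpace ℝ (Fin 3) := fun z => !₂[z.re, z.im, √(1 - ‖z‖ ^ 2)]
  have hh : Continuous h := by
    refine (PiLp.continuous_toLp 2 _).comp (continuous_pi fun i => ?_)
    fin_cases i <;> simp <;> fun_prop
  have hh0 : ∀ z, h z ≠ 0 := by
    intro z hz
    have h1 : z.re = 0 := by simpa [h] using congrArg (· 0) hz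
    have h2 : z.im = 0 := by simpa [h] using congrArg (· 1) hz
    have h3 : z = 0 := Complex.ext h1 h2
    have h4 : √(1 - ‖z‖ ^ 2) = 0 := by simpa [h] using congrArg (· 2) hz
    simp [h3] at h4
  have hneg : ∀ z : ℂ, ‖z‖ = 1 → h (-z) = -h z := by
    intro z hz
    ext i
    fin_cases i <;> simp [h, hz]
  obtain ⟨L, hL, hexp⟩ := exists_continuous_exp_eq (f := fun z => g (h z))
    (hg.comp_continuous hh fun z => hh0 z) fun z => hne _ (hh0 z)
  have hexp_neg : ∀ z : ℂ, ‖z‖ = 1 → Complex.exp (L (-z)) = -Complex.exp (L z) := by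
    intro z hz
    rw [hexp, hexp, hneg z hz, hodd _ (hh0 z)]
  have : PreconnectedSpace (Metric.sphere (0 : ℂ) 1) :=
    isPreconnected_iff_preconnectedSpace.mp <|
      isPreconnected_sphere (by simp [Complex.rank_real_complex]) (0 : ℂ) 1
  have h1 := hexp_neg 1 (by simp)
  have key : ∀ z : Metric.sphere (0 : ℂ) 1, L (-(z : ℂ)) = L z + (L (-1) - L 1) := by
    refine eq_of_exp_eq (hL.comp continuous_subtype_val.neg)
      ((hL.comp continuous_subtype_val).add continuous_const) (fun z => ?_) ⟨1, by simp⟩ (by simp)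
    rw [Complex.exp_add, Complex.exp_sub, h1, hexp_neg z (by simp)]
    field_simp [Complex.exp_ne_zero]
  have h2 := key ⟨-1, by simp⟩
  simp only [neg_neg] at h2
  have h3 : L (-1) = L 1 := by linear_combination (-1 / 2 : ℂ) * h2
  rw [h3] at h1
  exact Complex.exp_ne_zero (L 1) (by linear_combination (1 / 2 : ℂ) * h1)

/-- An odd function on the two-dimensional sphere is small along a path joining some point to its
antipode. -/
theorem exists_joinedIn_neg {g : EuclideanSpace ℝ (Fin 3) → ℝ} (hg : ContinuousOn g {0}ᶜ)
    (hodd : ∀ x ≠ 0, g (-x) = -g x) {ε : ℝ} (hε : 0 < ε) :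
    ∃ x, JoinedIn {x | x ≠ 0 ∧ |g x| < ε} x (-x) := by
  by_contra! hnot
  set U : Set (EuclideanSpace ℝ (Fin 3)) := {x | x ≠ 0 ∧ |g x| < ε} with hU
  have hUo : IsOpen U := hg.abs.isOpen_inter_preimage isOpen_compl_singleton isOpen_Iio
  have hUneg : ∀ x ∈ U, -x ∈ U := fun x hx => ⟨neg_ne_zero.mpr hx.1, by
    rw [hodd x hx.1, abs_neg]; exact hx.2⟩
  let C : EuclideanSpace ℝ (Fin 3) → Set (EuclideanSpace ℝ (Fin 3)) := pathComponentIn U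
  have hC : ∀ {x y}, y ∈ C x → C y = C x := fun h => pathComponentIn_congr h
  have hCneg : ∀ {x y}, y ∈ C x → -y ∈ C (-x) := by
    intro x y h
    have := h.map (continuous_neg (G := EuclideanSpace ℝ (Fin 3)))
    refine JoinedIn.mono this ?_
    rintro _ ⟨z, hz, rfl⟩
    exact hUneg z hz
  have hCne : ∀ x ∈ U, C x ≠ C (-x) := by
    intro x hx h
    have : -x ∈ C x := h ▸ mem_pathComponentIn_self (hUneg x hx)
    exact hnot x this
  classical
  let σ : EuclideanSpace ℝ (Fin 3) → ℝ := fun x => if WellOrderingRel (C x) (C (-x)) then 1 else -1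
  have hσ_abs : ∀ x, |σ x| = 1 := by
    intro x
    simp only [σ]
    split_ifs <;> simp
  have hσ_neg : ∀ x ∈ U, σ (-x) = -σ x := by
    intro x hx
    simp only [σ, neg_neg]
    rcases trichotomous_of WellOrderingRel (C x) (C (-x)) with h | h | h
    · rw [if_pos h, if_neg (asymm_of WellOrderingRel h)]
    · exact absurd h (hCne x hx)
    · rw [if_pos h, if_neg (asymm_of WellOrderingRel h), neg_neg]
  have hσ_loc : ∀ x ∈ U, ∀ᶠ y in 𝓝 x, σ y = σ x := by
    intro x hx
    filter_upwards [(hUo.pathComponentIn x).mem_nhds (mem_pathComponentIn_self hx)] with y hy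
    simp only [σ]
    rw [hC hy, hC (hCneg hy)]
  let k : EuclideanSpace ℝ (Fin 3) → ℝ := fun x => σ x * max (ε - |g x|) 0
  have hm : ContinuousOn (fun x => max (ε - |g x|) 0) {0}ᶜ := by fun_prop
  have hk : ContinuousOn k {0}ᶜ := by
    refine continuousOn_of_forall_continuousAt fun x hx => ?_
    have hmx := hm.continuousAt (isOpen_compl_singleton.mem_nhds hx)
    by_cases hxU : x ∈ U
    · refine (hmx.const_mul (σ x)).congr ?_
      filter_upwards [hσ_loc x hxU] with y hy
      simp only [k, hy]
    · have h0 : max (ε - |g x|) 0 = 0 :=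
        max_eq_right (sub_nonpos.mpr (not_lt.mp fun h => hxU ⟨hx, h⟩))
      have hkx : k x = 0 := by simp only [k, h0, mul_zero]
      rw [ContinuousAt, hkx]
      refine squeeze_zero_norm (fun y => ?_) (h0 ▸ hmx.tendsto)
      rw [Real.norm_eq_abs, abs_mul, hσ_abs, one_mul, abs_of_nonneg (le_max_right _ _)]
  obtain ⟨x, hx, hx0⟩ := exists_eq_zero_of_odd (g := fun x => (g x : ℂ) + k x * Complex.I)
    (by fun_prop) (fun x hx => by
      have : k (-x) = -k x := by
        simp only [k, hodd x hx, abs_neg]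
        by_cases hxU : x ∈ U
        · rw [hσ_neg x hxU, neg_mul]
        · have h0 : max (ε - |g x|) 0 = 0 :=
            max_eq_right (sub_nonpos.mpr (not_lt.mp fun h => hxU ⟨hx, h⟩))
          simp [h0]
      rw [this, hodd x hx]
      push_cast
      ring)
  have hgx : g x = 0 := by simpa using congrArg Complex.re hx0
  have hkx : k x = 0 := by simpa using congrArg Complex.im hx0
  have hmx : max (ε - |g x|) 0 = ε := by simp [hgx, hε.le]
  have := hσ_abs x
  simp only [k, hmx] at hkx
  rcases mul_eq_zero.mp hkx with h | h
  · simp [h] at this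
  · exact hε.ne' h

/-- A symmetric function of two points on a loop which is odd in each of them and constant on the
diagonal vanishes somewhere. -/
theorem exists_eq_zero_of_symm_of_odd {φ : ℝ × ℝ → ℂ} (hφ : Continuous φ)
    (hsymm : ∀ s t, φ (s, t) = φ (t, s)) (hodd : ∀ t, φ (1, t) = -φ (0, t))
    (hdiag : ∀ t, φ (t, t) = φ (0, 0)) : ∃ s t, φ (s, t) = 0 := by
  by_contra! hne
  obtain ⟨L, hL, hexp⟩ := exists_continuous_exp_eq hφ fun x => hne x.1 x.2
  have hLsymm : ∀ x : ℝ × ℝ, L x = L x.swap :=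
    eq_of_exp_eq hL (hL.comp continuous_swap)
      (fun x => by simp only [hexp]; exact hsymm _ _) (0, 0) rfl
  have hLdiag : ∀ t : ℝ, L (t, t) = L (0, 0) :=
    eq_of_exp_eq (by fun_prop) continuous_const (fun t => by simp only [hexp, hdiag t]) 0 rfl
  have hexpd : ∀ t, Complex.exp (L (1, t)) = -Complex.exp (L (0, t)) := fun t => by
    rw [hexp, hexp, hodd]
  have hLodd : ∀ t : ℝ, L (1, t) = L (0, t) + (L (1, 0) - L (0, 0)) := by
    refine eq_of_exp_eq (by fun_prop) (by fun_prop) (fun t => ?_) 0 (by ring)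
    rw [Complex.exp_add, Complex.exp_sub, hexpd, hexpd]
    field_simp [Complex.exp_ne_zero]
  have h1 := hLodd 1
  have h2 := hLsymm (0, 1)
  have h3 := hLdiag 1
  simp only [Prod.swap_prod_mk] at h2
  have h4 : L (1, 0) = L (0, 0) := by linear_combination (1 / 2 : ℂ) * (h3 - h1 - h2)
  have h5 := hexpd 0
  rw [h4] at h5
  exact Complex.exp_ne_zero (L (0, 0)) (by linear_combination (1 / 2 : ℂ) * h5)

/-- The side of the hyperplane with normal vector `p.1` and constant `p.2` on which a point lies:
`1`, `-1`, or `0` on the hyperplane itself. -/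
noncomputable def hyperplaneSide {n : ℕ} (p : EuclideanSpace ℝ (Fin n) × ℝ)
    (x : EuclideanSpace ℝ (Fin n)) : ℝ :=
  (SignType.sign (⟪p.1, x⟫ - p.2) : ℝ)

/-- The measure of the pairs of opposite orthants of two hyperplanes: the part where both sides have
the same sign, minus the part where they have opposite signs. -/
noncomputable def sideCorrelation {n : ℕ} (μ : Measure (EuclideanSpace ℝ (Fin n)))
    (p q : EuclideanSpace ℝ (Fin n) × ℝ) : ℝ :=
  ∫ x, hyperplaneSide p x * hyperplaneSide q x ∂μ

/-- The measure of the half-space above a hyperplane minus that of the half-space below it. -/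
noncomputable def sideBalance {n : ℕ} (μ : Measure (EuclideanSpace ℝ (Fin n)))
    (p : EuclideanSpace ℝ (Fin n) × ℝ) : ℝ :=
  ∫ x, hyperplaneSide p x ∂μ

section Hyperplanes

variable {n : ℕ} {μ : Measure (EuclideanSpace ℝ (Fin n))} {p q : EuclideanSpace ℝ (Fin n) × ℝ}

theorem monotone_coe_sign : Monotone fun r : ℝ => (SignType.sign r : ℝ) := fun a b h => by
  have h' := SignType.sign.monotone h
  beta_reduce
  generalize SignType.sign a = s at h' ⊢
  generalize SignType.sign b = t at h' ⊢
  revert h'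
  cases s <;> cases t <;> simp

theorem measurable_hyperplaneSide : Measurable (hyperplaneSide p) :=
  monotone_coe_sign.measurable.comp (g := fun r : ℝ => (SignType.sign r : ℝ))
    (f := fun x => ⟪p.1, x⟫ - p.2) (by fun_prop)

theorem abs_hyperplaneSide_le (p : EuclideanSpace ℝ (Fin n) × ℝ) (x : EuclideanSpace ℝ (Fin n)) :
    |hyperplaneSide p x| ≤ 1 := by
  unfold hyperplaneSide
  cases SignType.sign (⟪p.1, x⟫ - p.2) <;> simp

theorem integrable_hyperplaneSide [IsFiniteMeasure μ] : Integrable (hyperplaneSide p) μ :=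
  .of_bound measurable_hyperplaneSide.aestronglyMeasurable 1
    (.of_forall fun x => abs_hyperplaneSide_le p x)

theorem integrable_hyperplaneSide_mul [IsFiniteMeasure μ] :
    Integrable (fun x => hyperplaneSide p x * hyperplaneSide q x) μ :=
  .of_bound (measurable_hyperplaneSide.mul measurable_hyperplaneSide).aestronglyMeasurable 1
    (.of_forall fun x => by
      rw [Real.norm_eq_abs, abs_mul]
      exact mul_le_one₀ (abs_hyperplaneSide_le p x) (abs_nonneg _) (abs_hyperplaneSide_le q x))

theorem hyperplaneSide_neg (p : EuclideanSpace ℝ (Fin n) × ℝ) (x : EuclideanSpace ℝ (Fin n)) :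
    hyperplaneSide (-p) x = -hyperplaneSide p x := by
  have : ⟪(-p).1, x⟫ - (-p).2 = -(⟪p.1, x⟫ - p.2) := by
    simp only [Prod.fst_neg, Prod.snd_neg, inner_neg_left]; ring
  rw [hyperplaneSide, this, Left.sign_neg, SignType.coe_neg, hyperplaneSide]

theorem hyperplaneSide_smul {r : ℝ} (hr : 0 < r) (p : EuclideanSpace ℝ (Fin n) × ℝ) :
    hyperplaneSide (r • p) = hyperplaneSide p := by
  ext x
  have : ⟪(r • p).1, x⟫ - (r • p).2 = r * (⟪p.1, x⟫ - p.2) := by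
    simp only [Prod.smul_fst, Prod.smul_snd, inner_smul_left, smul_eq_mul, RCLike.conj_to_real]
    ring
  rw [hyperplaneSide, this, sign_mul, sign_pos hr, one_mul, hyperplaneSide]

theorem hyperplaneSide_zero_left {c : ℝ} (hc : c < 0) :
    hyperplaneSide ((0, c) : EuclideanSpace ℝ (Fin n) × ℝ) = 1 := by
  ext x
  simp [hyperplaneSide, hc]

theorem hyperplaneSide_antitone (u x : EuclideanSpace ℝ (Fin n)) :
    Antitone fun c => hyperplaneSide (u, c) x := fun _ _ h =>
  monotone_coe_sign (sub_le_sub_left h _)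

theorem ae_inner_ne (hμ : μ ≪ volume) (hp : p ≠ 0) : ∀ᵐ x ∂μ, ⟪p.1, x⟫ - p.2 ≠ 0 := by
  suffices h : ∀ᵐ x, ⟪p.1, x⟫ - p.2 ≠ 0 from hμ.ae_le h
  rw [ae_iff]
  simp only [ne_eq, not_not, sub_eq_zero]
  by_cases hex : ∃ x₀, ⟪p.1, x₀⟫ = p.2
  · obtain ⟨x₀, hx₀⟩ := hex
    have hp1 : p.1 ≠ 0 := fun h => hp (Prod.ext h (by simpa [h] using hx₀.symm))
    refine measure_mono_null (fun x hx => ?_)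
      (Measure.addHaar_affineSubspace volume (AffineSubspace.mk' x₀ (ℝ ∙ p.1)ᗮ) fun h => ?_)
    · simp only [SetLike.mem_coe, AffineSubspace.mem_mk',
        Submodule.mem_orthogonal_singleton_iff_inner_right, vsub_eq_sub, inner_sub_right, hx₀]
      exact sub_eq_zero.mpr hx
    · have := congrArg AffineSubspace.direction h
      rw [AffineSubspace.direction_mk', AffineSubspace.direction_top,
        Submodule.orthogonal_eq_top_iff, Submodule.span_singleton_eq_bot] at this
      exact hp1 this
  · exact measure_mono_null (fun x hx => (hex ⟨x, hx⟩).elim) measure_empty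

theorem ae_hyperplaneSide_mul_self (hμ : μ ≪ volume) (hp : p ≠ 0) :
    ∀ᵐ x ∂μ, hyperplaneSide p x * hyperplaneSide p x = 1 := by
  filter_upwards [ae_inner_ne hμ hp] with x hx
  rcases hx.lt_or_gt with h | h <;> simp [hyperplaneSide, h]

theorem ae_continuousAt_hyperplaneSide (hμ : μ ≪ volume) (hp : p ≠ 0) :
    ∀ᵐ x ∂μ, ContinuousAt (fun p => hyperplaneSide p x) p := by
  filter_upwards [ae_inner_ne hμ hp] with x hx
  have h1 : ContinuousAt (fun p : EuclideanSpace ℝ (Fin n) × ℝ => ⟪p.1, x⟫ - p.2) p := by fun_prop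
  exact (continuous_of_discreteTopology (f := fun s : SignType => (s : ℝ))).continuousAt.comp
    (ContinuousAt.comp (f := fun p : EuclideanSpace ℝ (Fin n) × ℝ => ⟪p.1, x⟫ - p.2)
      (continuousAt_sign_of_ne_zero hx) h1)

theorem sideBalance_smul {r : ℝ} (hr : 0 < r) : sideBalance μ (r • p) = sideBalance μ p := by
  simp only [sideBalance, hyperplaneSide_smul hr]

theorem sideBalance_zero_left {c : ℝ} (hc : c < 0) :
    sideBalance μ (0, c) = μ.real Set.univ := by
  simp [sideBalance, hyperplaneSide_zero_left hc]

theorem sideCorrelation_comm : sideCorrelation μ p q = sideCorrelation μ q p := by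
  simp only [sideCorrelation, mul_comm]

theorem sideCorrelation_neg_left : sideCorrelation μ (-p) q = -sideCorrelation μ p q := by
  simp only [sideCorrelation, hyperplaneSide_neg, neg_mul, integral_neg]

theorem sideCorrelation_smul {r s : ℝ} (hr : 0 < r) (hs : 0 < s) :
    sideCorrelation μ (r • p) (s • q) = sideCorrelation μ p q := by
  simp only [sideCorrelation, hyperplaneSide_smul hr, hyperplaneSide_smul hs]

theorem sideCorrelation_self (hμ : μ ≪ volume) (hp : p ≠ 0) :
    sideCorrelation μ p p = μ.real Set.univ := by
  rw [sideCorrelation, integral_congr_ae (ae_hyperplaneSide_mul_self hμ hp)]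
  simp

theorem sideBalance_neg : sideBalance μ (-p) = -sideBalance μ p := by
  simp only [sideBalance, hyperplaneSide_neg, integral_neg]

/-- The sign of `hyperplaneSide` on the interior of a closed half-space. -/
def halfspaceSign (ε : Bool) : ℝ := if ε then -1 else 1

theorem ae_indicator_closedHalfspace (hμ : μ ≪ volume) (hp : p ≠ 0) (ε : Bool) :
    ∀ᵐ x ∂μ, (closedHalfspace p.1 p.2 ε).indicator 1 x =
      (1 + halfspaceSign ε * hyperplaneSide p x) / 2 := by
  filter_upwards [ae_inner_ne hμ hp] with x hx
  classical
  rw [Set.indicator_apply]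
  rcases hx.lt_or_gt with h | h
  · cases ε <;>
      simp [closedHalfspace, hyperplaneSide, halfspaceSign, h, not_le.mpr, sub_neg.mp h, (sub_neg.mp h).le]
  · cases ε <;>
      simp [closedHalfspace, hyperplaneSide, halfspaceSign, h, not_le.mpr, sub_pos.mp h, (sub_pos.mp h).le]

variable [IsFiniteMeasure μ]

theorem continuousAt_sideBalance (hμ : μ ≪ volume) (hp : p ≠ 0) :
    ContinuousAt (sideBalance μ) p := by
  refine continuousAt_of_dominated (bound := fun _ => 1)
    (.of_forall fun _ => measurable_hyperplaneSide.aestronglyMeasurable)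
    (.of_forall fun p => .of_forall fun x => abs_hyperplaneSide_le p x) (integrable_const _)
    (ae_continuousAt_hyperplaneSide hμ hp)

theorem continuousAt_sideCorrelation (hμ : μ ≪ volume) (hp : p ≠ 0) (hq : q ≠ 0) :
    ContinuousAt (fun r : (EuclideanSpace ℝ (Fin n) × ℝ) × (EuclideanSpace ℝ (Fin n) × ℝ) =>
      sideCorrelation μ r.1 r.2) (p, q) := by
  refine continuousAt_of_dominated (bound := fun _ => 1)
    (.of_forall fun _ => (integrable_hyperplaneSide_mul (μ := μ)).aestronglyMeasurable)
    (.of_forall fun r => .of_forall fun x => ?_) (integrable_const _) ?_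
  · rw [Real.norm_eq_abs, abs_mul]
    exact mul_le_one₀ (abs_hyperplaneSide_le _ x) (abs_nonneg _) (abs_hyperplaneSide_le _ x)
  · filter_upwards [ae_continuousAt_hyperplaneSide hμ hp, ae_continuousAt_hyperplaneSide hμ hq]
      with x hpx hqx
    exact (ContinuousAt.comp (f := Prod.fst) (x := (p, q)) hpx continuousAt_fst).mul
      (ContinuousAt.comp (f := Prod.snd) (x := (p, q)) hqx continuousAt_snd)

theorem sideBalance_antitone (u : EuclideanSpace ℝ (Fin n)) :
    Antitone fun c => sideBalance μ (u, c) := fun _ _ h =>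
  integral_mono integrable_hyperplaneSide integrable_hyperplaneSide
    fun x => hyperplaneSide_antitone u x h

theorem measurableSet_closedHalfspace (u : EuclideanSpace ℝ (Fin n)) (c : ℝ) (ε : Bool) :
    MeasurableSet (closedHalfspace u c ε) := by
  unfold closedHalfspace
  split_ifs
  · exact measurableSet_le (by fun_prop) measurable_const
  · exact measurableSet_le measurable_const (by fun_prop)

theorem measure_closedHalfspace (hμ : μ ≪ volume) (hp : p ≠ 0) (hb : sideBalance μ p = 0)
    (ε : Bool) : μ (closedHalfspace p.1 p.2 ε) = μ Set.univ / 2 := by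
  have h : μ.real (closedHalfspace p.1 p.2 ε) = μ.real Set.univ / 2 := by
    rw [← integral_indicator_one (measurableSet_closedHalfspace _ _ _),
      integral_congr_ae (ae_indicator_closedHalfspace hμ hp ε), integral_div,
      integral_add (integrable_const _) (integrable_hyperplaneSide.const_mul _),
      integral_const_mul]
    rw [sideBalance] at hb
    simp [hb]
  rw [← ENNReal.toReal_eq_toReal_iff' (by finiteness) (by finiteness), ENNReal.toReal_div]
  exact h

theorem measure_closedHalfspace_inter (hμ : μ ≪ volume) (hp : p ≠ 0) (hq : q ≠ 0)
    (hbp : sideBalance μ p = 0) (hbq : sideBalance μ q = 0) (hpq : sideCorrelation μ p q = 0)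
    (ε δ : Bool) :
    μ (closedHalfspace p.1 p.2 ε ∩ closedHalfspace q.1 q.2 δ) = μ Set.univ / 4 := by
  have h : μ.real (closedHalfspace p.1 p.2 ε ∩ closedHalfspace q.1 q.2 δ) =
      μ.real Set.univ / 4 := by
    rw [← integral_indicator_one
      ((measurableSet_closedHalfspace _ _ _).inter (measurableSet_closedHalfspace _ _ _))]
    have : ∀ᵐ x ∂μ, (closedHalfspace p.1 p.2 ε ∩ closedHalfspace q.1 q.2 δ).indicator 1 x =
        (1 + halfspaceSign ε * hyperplaneSide p x + halfspaceSign δ * hyperplaneSide q x +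
          halfspaceSign ε * halfspaceSign δ * (hyperplaneSide p x * hyperplaneSide q x)) / 4 := by
      filter_upwards [ae_indicator_closedHalfspace hμ hp ε, ae_indicator_closedHalfspace hμ hq δ]
        with x h1 h2
      rw [Set.inter_indicator_one, Pi.mul_apply, h1, h2]
      ring
    have hp' : Integrable (fun x => halfspaceSign ε * hyperplaneSide p x) μ :=
      integrable_hyperplaneSide.const_mul _
    have hq' : Integrable (fun x => halfspaceSign δ * hyperplaneSide q x) μ :=
      integrable_hyperplaneSide.const_mul _
    have hp1 : Integrable (fun x => 1 + halfspaceSign ε * hyperplaneSide p x) μ :=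
      (integrable_const 1).add hp'
    have hpq1 : Integrable (fun x => 1 + halfspaceSign ε * hyperplaneSide p x +
      halfspaceSign δ * hyperplaneSide q x) μ := hp1.add hq'
    rw [integral_congr_ae this, integral_div,
      integral_add hpq1 (integrable_hyperplaneSide_mul.const_mul _),
      integral_add hp1 hq', integral_add (integrable_const _) hp', integral_const_mul,
      integral_const_mul, integral_const_mul]
    rw [sideBalance] at hbp hbq
    rw [sideCorrelation] at hpq
    simp [hbp, hbq, hpq]
  rw [← ENNReal.toReal_eq_toReal_iff' (by finiteness) (by finiteness), ENNReal.toReal_div]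
  exact h

end Hyperplanes

/-- The zero of a function that is odd and strictly antitone in its last variable is an odd
continuous function of the other variables. -/
theorem exists_odd_zero_of_strictAnti {E : Type*} [AddCommGroup E] [TopologicalSpace E]
    [T1Space E]
    {H : E → ℝ → ℝ} (hcont : ∀ u ≠ 0, ∀ c, ContinuousAt (fun p : E × ℝ => H p.1 p.2) (u, c))
    (hanti : ∀ u, StrictAnti (H u)) (hodd : ∀ u c, H (-u) (-c) = -H u c)
    (hneg : ∀ u ≠ 0, ∃ c, H u c < 0) :
    ∃ m : E → ℝ, ContinuousOn m {0}ᶜ ∧ (∀ u ≠ 0, m (-u) = -m u) ∧ ∀ u ≠ 0, H u (m u) = 0 := by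
  have hex : ∀ u, ∃ c, u ≠ 0 → H u c = 0 := by
    intro u
    by_cases hu : u = 0
    · exact ⟨0, fun h => (h hu).elim⟩
    obtain ⟨c, hc⟩ := hneg u hu
    obtain ⟨d, hd⟩ := hneg (-u) (neg_ne_zero.mpr hu)
    have hd' : 0 < H u (-d) := by
      have := hodd u (-d)
      rw [neg_neg] at this
      linarith
    have hcu : Continuous (H u) := continuous_iff_continuousAt.mpr fun c =>
      (hcont u hu c).comp (f := fun c : ℝ => (u, c)) (by fun_prop)
    obtain ⟨m, hm⟩ := mem_range_of_exists_le_of_exists_ge hcu ⟨c, hc.le⟩ ⟨-d, hd'.le⟩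
    exact ⟨m, fun _ => hm⟩
  choose m hm using hex
  refine ⟨m, continuousOn_of_forall_continuousAt fun u hu => ?_, fun u hu => ?_, fun u hu => hm u hu⟩
  · have hsection : ∀ c, ContinuousAt (fun v => H v c) u := fun c =>
      (hcont u hu c).comp (f := fun v : E => (v, c)) (by fun_prop)
    rw [ContinuousAt, tendsto_order]
    have hne : ∀ᶠ v in 𝓝 u, v ≠ 0 := isOpen_compl_singleton.mem_nhds hu
    refine ⟨fun c hc => ?_, fun c hc => ?_⟩
    · have h0 : 0 < H u c := hm u hu ▸ hanti u hc
      filter_upwards [(hsection c).eventually (lt_mem_nhds h0), hne] with v hv hv0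
      exact (hanti v).lt_iff_gt.mp (by rwa [hm v hv0])
    · have h0 : H u c < 0 := hm u hu ▸ hanti u hc
      filter_upwards [(hsection c).eventually (gt_mem_nhds h0), hne] with v hv hv0
      exact (hanti v).lt_iff_gt.mp (by rwa [hm v hv0])
  · refine (hanti (-u)).injective ?_
    rw [hm _ (neg_ne_zero.mpr hu), hodd, hm u hu, neg_zero]

/-- The median planes of a measure can be chosen continuously, up to an arbitrarily small error. -/
theorem exists_approx_median {μ : Measure (EuclideanSpace ℝ (Fin 3))} [IsFiniteMeasure μ]
    (hμ0 : μ ≠ 0) (hμ : μ ≪ volume) {δ : ℝ} (hδ : 0 < δ) :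
    ∃ m : EuclideanSpace ℝ (Fin 3) → ℝ, ContinuousOn m {0}ᶜ ∧ (∀ u ≠ 0, m (-u) = -m u) ∧
      ∀ u ≠ 0, |sideBalance μ (u, m u)| ≤ 2 * δ := by
  obtain ⟨m, hm, hodd, hzero⟩ := exists_odd_zero_of_strictAnti
    (H := fun u c => sideBalance μ (u, c) - δ * Real.arctan c)
    (fun u hu c => (continuousAt_sideBalance hμ (p := (u, c)) (by simp [hu])).sub
      (by have := Real.continuous_arctan; fun_prop))
    (fun u c d h => by
      have h1 := sideBalance_antitone (μ := μ) u h.le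
      have h2 := mul_lt_mul_of_pos_left (Real.arctan_strictMono h) hδ
      simp only at h1 ⊢
      linarith)
    (fun u c => by
      rw [Real.arctan_neg, ← Prod.neg_mk, sideBalance_neg]
      ring)
    (fun u hu => by
      have hpos : 0 < μ.real Set.univ := by
        simpa [measureReal_def, ENNReal.toReal_pos_iff, pos_iff_ne_zero] using hμ0
      have hlim : Filter.Tendsto (fun t : ℝ => sideBalance μ (t • u, 1)) (𝓝[>] 0)
          (𝓝 (-μ.real Set.univ)) := by
        have h1 : sideBalance μ ((0 : ℝ) • u, 1) = -μ.real Set.univ := by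
          rw [← sideBalance_zero_left (c := -1) (by norm_num), ← sideBalance_neg]
          simp
        rw [← h1]
        exact ((continuousAt_sideBalance hμ (by simp)).comp
          (f := fun t : ℝ => (t • u, (1 : ℝ))) (by fun_prop)).tendsto.mono_left nhdsWithin_le_nhds
      obtain ⟨t, ht, ht0⟩ :=
        ((hlim.eventually (gt_mem_nhds (neg_lt_zero.mpr hpos))).and self_mem_nhdsWithin).exists
      refine ⟨t⁻¹, ?_⟩
      have h2 := sideBalance_smul (μ := μ) (p := (u, t⁻¹)) ht0
      rw [Prod.smul_mk, smul_eq_mul, mul_inv_cancel₀ (ne_of_gt ht0)] at h2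
      have h3 : 0 < δ * Real.arctan t⁻¹ := mul_pos hδ (Real.arctan_pos.mpr (inv_pos.mpr ht0))
      linarith)
  refine ⟨m, hm, hodd, fun u hu => ?_⟩
  have h1 : sideBalance μ (u, m u) = δ * Real.arctan (m u) := sub_eq_zero.mp (hzero u hu)
  have h2 := Real.arctan_lt_pi_div_two (m u)
  have h3 := Real.neg_pi_div_two_lt_arctan (m u)
  have h4 : |Real.arctan (m u)| ≤ 2 := abs_le.mpr (by constructor <;> linarith [Real.pi_le_four])
  rw [h1, abs_mul, abs_of_pos hδ]
  nlinarith

theorem exists_approx_two_plane_equipartition {μ ν : Measure (EuclideanSpace ℝ (Fin 3))}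
    [IsFiniteMeasure μ] [IsFiniteMeasure ν] (hμ0 : μ ≠ 0) (hμ : μ ≪ volume) (hν : ν ≪ volume)
    {ε : ℝ} (hε : 0 < ε) :
    ∃ p q : EuclideanSpace ℝ (Fin 3) × ℝ, p ≠ 0 ∧ q ≠ 0 ∧
      |sideBalance μ p| ≤ ε ∧ |sideBalance μ q| ≤ ε ∧
      |sideBalance ν p| ≤ ε ∧ |sideBalance ν q| ≤ ε ∧
      sideCorrelation μ p q = 0 ∧ sideCorrelation ν p q = 0 := by
  obtain ⟨m, hm, hodd, hbal⟩ := exists_approx_median hμ0 hμ (half_pos hε)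
  rw [mul_div_cancel₀ ε two_ne_zero] at hbal
  have hplane : ∀ u ≠ 0, (u, m u) ≠ 0 := fun u hu h => hu (congrArg Prod.fst h)
  have hplane_neg : ∀ u ≠ 0, (-u, m (-u)) = -(u, m u) := fun u hu => by
    rw [hodd u hu, Prod.neg_mk]
  have hplane_cont : ContinuousOn (fun u => (u, m u)) {0}ᶜ := by fun_prop
  obtain ⟨x, hx⟩ := exists_joinedIn_neg (g := fun u => sideBalance ν (u, m u))
    (fun u hu => (continuousAt_sideBalance hν (hplane u hu)).comp_continuousWithinAt
      (f := fun u => (u, m u)) (hplane_cont u hu))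
    (fun u hu => by rw [hplane_neg u hu, sideBalance_neg]) hε
  obtain ⟨γ, hγ⟩ := hx
  have hγ' : ∀ t, γ.extend t ≠ 0 ∧ |sideBalance ν (γ.extend t, m (γ.extend t))| < ε := fun t => hγ _
  let P : ℝ → EuclideanSpace ℝ (Fin 3) × ℝ := fun t => (γ.extend t, m (γ.extend t))
  have hP0 : ∀ t, P t ≠ 0 := fun t => hplane _ (hγ' t).1
  have hP : Continuous P := hplane_cont.comp_continuous γ.continuous_extend fun t => (hγ' t).1
  have hP1 : P 1 = -P 0 := by
    simp only [P, γ.extend_zero, γ.extend_one]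
    exact hplane_neg x (by simpa using (hγ' 0).1)
  have hcorr : ∀ {ρ : Measure (EuclideanSpace ℝ (Fin 3))} [IsFiniteMeasure ρ], ρ ≪ volume →
      Continuous fun r : ℝ × ℝ => sideCorrelation ρ (P r.1) (P r.2) := fun hρ =>
    continuous_iff_continuousAt.mpr fun r =>
      (continuousAt_sideCorrelation hρ (hP0 r.1) (hP0 r.2)).comp
        (f := fun r : ℝ × ℝ => (P r.1, P r.2)) (by fun_prop)
  have hcμ := hcorr hμ
  have hcν := hcorr hν
  obtain ⟨s, t, hst⟩ := exists_eq_zero_of_symm_of_odd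
    (φ := fun r => (sideCorrelation μ (P r.1) (P r.2) : ℂ) +
      sideCorrelation ν (P r.1) (P r.2) * Complex.I) (by fun_prop)
    (fun s t => by simp only [sideCorrelation_comm (p := P s)])
    (fun t => by
      simp only [hP1, sideCorrelation_neg_left]
      push_cast
      ring)
    (fun t => by simp only [sideCorrelation_self hμ (hP0 _), sideCorrelation_self hν (hP0 _)])
  exact ⟨P s, P t, hP0 s, hP0 t, hbal _ (hγ' s).1, hbal _ (hγ' t).1, (hγ' s).2.le, (hγ' t).2.le,
    by simpa using congrArg Complex.re hst, by simpa using congrArg Complex.im hst⟩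

/-- Two continuous mass distributions on `ℝ^3` are simultaneously cut into four equal parts by
some two planes. -/
theorem exists_two_plane_equipartition {μ ν : Measure (EuclideanSpace ℝ (Fin 3))}
    [IsFiniteMeasure μ] [IsFiniteMeasure ν] (hμ0 : μ ≠ 0) (hμ : μ ≪ volume) (hν : ν ≪ volume) :
    ∃ p q : EuclideanSpace ℝ (Fin 3) × ℝ, p ≠ 0 ∧ q ≠ 0 ∧
      sideBalance μ p = 0 ∧ sideBalance μ q = 0 ∧ sideBalance ν p = 0 ∧ sideBalance ν q = 0 ∧
      sideCorrelation μ p q = 0 ∧ sideCorrelation ν p q = 0 := by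
  let K := Metric.sphere (0 : EuclideanSpace ℝ (Fin 3) × ℝ) 1
  let F : (EuclideanSpace ℝ (Fin 3) × ℝ) × (EuclideanSpace ℝ (Fin 3) × ℝ) → ℝ := fun r =>
    |sideBalance μ r.1| + |sideBalance μ r.2| + |sideBalance ν r.1| + |sideBalance ν r.2| +
      |sideCorrelation μ r.1 r.2| + |sideCorrelation ν r.1 r.2|
  have hK : ∀ p ∈ K, p ≠ 0 := fun p hp => ne_zero_of_mem_unit_sphere (⟨p, hp⟩ : K)
  have hF : ContinuousOn F (K ×ˢ K) := by
    refine continuousOn_of_forall_continuousAt fun r hr => ?_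
    have h1 := hK _ hr.1
    have h2 := hK _ hr.2
    have hb : ∀ {ρ : Measure (EuclideanSpace ℝ (Fin 3))} [IsFiniteMeasure ρ], ρ ≪ volume →
        ContinuousAt (fun r : (EuclideanSpace ℝ (Fin 3) × ℝ) × (EuclideanSpace ℝ (Fin 3) × ℝ) =>
          sideBalance ρ r.1) r ∧
        ContinuousAt (fun r : (EuclideanSpace ℝ (Fin 3) × ℝ) × (EuclideanSpace ℝ (Fin 3) × ℝ) =>
          sideBalance ρ r.2) r := fun hρ =>
      ⟨(continuousAt_sideBalance hρ h1).comp (f := Prod.fst) continuousAt_fst,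
        (continuousAt_sideBalance hρ h2).comp (f := Prod.snd) continuousAt_snd⟩
    exact ((((((hb hμ).1.abs.add (hb hμ).2.abs).add (hb hν).1.abs).add (hb hν).2.abs).add
      (continuousAt_sideCorrelation hμ h1 h2).abs).add (continuousAt_sideCorrelation hν h1 h2).abs)
  have hKne : K.Nonempty :=
    (NormedSpace.sphere_nonempty (E := EuclideanSpace ℝ (Fin 3) × ℝ)).mpr zero_le_one
  obtain ⟨⟨p, q⟩, hpq, hmin⟩ := ((isCompact_sphere _ _).prod (isCompact_sphere _ _)).exists_isMinOn
    (hKne.prod hKne) hF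
  have hle : F (p, q) ≤ 0 := by
    refine le_of_forall_pos_le_add fun ε hε => ?_
    obtain ⟨p', q', hp', hq', h1, h2, h3, h4, h5, h6⟩ :=
      exists_approx_two_plane_equipartition hμ0 hμ hν (ε := ε / 4) (by positivity)
    have hp1 : 0 < ‖p'‖⁻¹ := inv_pos.mpr (norm_pos_iff.mpr hp')
    have hq1 : 0 < ‖q'‖⁻¹ := inv_pos.mpr (norm_pos_iff.mpr hq')
    have hmem : (‖p'‖⁻¹ • p', ‖q'‖⁻¹ • q') ∈ K ×ˢ K := by
      simp [K, norm_smul, hp', hq']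
    have h := hmin hmem
    simp only [F, Set.mem_ofPred_eq, sideBalance_smul hp1, sideBalance_smul hq1,
      sideCorrelation_smul hp1 hq1, h5, h6, abs_zero] at h ⊢
    linarith
  simp only [F] at hle
  have hz : ∀ x y z w a b : ℝ, |x| + |y| + |z| + |w| + |a| + |b| ≤ 0 →
      x = 0 ∧ y = 0 ∧ z = 0 ∧ w = 0 ∧ a = 0 ∧ b = 0 := by
    intro x y z w a b h
    simp only [← abs_nonpos_iff]
    refine ⟨?_, ?_, ?_, ?_, ?_, ?_⟩ <;>
      linarith [abs_nonneg x, abs_nonneg y, abs_nonneg z, abs_nonneg w, abs_nonneg a, abs_nonneg b]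
  exact ⟨p, q, hK p hpq.1, hK q hpq.2, hz _ _ _ _ _ _ hle⟩

theorem fst_ne_zero_of_sideBalance_eq_zero {n : ℕ} {μ : Measure (EuclideanSpace ℝ (Fin n))}
    [IsFiniteMeasure μ] (hμ0 : μ ≠ 0) {p : EuclideanSpace ℝ (Fin n) × ℝ} (hp : p ≠ 0)
    (h : sideBalance μ p = 0) : p.1 ≠ 0 := by
  obtain ⟨u, c⟩ := p
  rintro rfl
  have hμ : μ.real Set.univ ≠ 0 := by simpa [measureReal_def, ENNReal.toReal_eq_zero_iff] using hμ0
  rcases lt_trichotomy c 0 with hc | rfl | hc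
  · exact hμ (by rw [← sideBalance_zero_left hc, h])
  · exact hp rfl
  · have := sideBalance_zero_left (μ := μ) (neg_lt_zero.mpr hc)
    rw [← neg_zero (G := EuclideanSpace ℝ (Fin n)), ← Prod.neg_mk, sideBalance_neg, h,
      neg_zero] at this
    exact hμ this.symm

/-- Some plane through two given points bisects a continuous mass distribution. -/
theorem exists_bisecting_plane_through {μ : Measure (EuclideanSpace ℝ (Fin 3))}
    [IsFiniteMeasure μ] (hμ : μ ≪ volume) (A B : EuclideanSpace ℝ (Fin 3)) :
    ∃ (u : EuclideanSpace ℝ (Fin 3)) (c : ℝ), u ≠ 0 ∧ ⟪u, A⟫ = c ∧ ⟪u, B⟫ = c ∧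
      sideBalance μ (u, c) = 0 := by
  let W := (ℝ ∙ (B - A))ᗮ
  have hrank : 1 < Module.rank ℝ W := by
    have h1 := (ℝ ∙ (B - A)).finrank_add_finrank_orthogonal
    have h2 : Module.finrank ℝ (ℝ ∙ (B - A)) ≤ 1 := by
      simpa using finrank_span_le_card (R := ℝ) {B - A}
    rw [finrank_euclideanSpace_fin] at h1
    rw [← Module.finrank_eq_rank, Nat.one_lt_cast]
    change 1 < Module.finrank ℝ (ℝ ∙ (B - A))ᗮ
    omega
  let g : W → ℝ := fun w => sideBalance μ (w, ⟪(w : EuclideanSpace ℝ (Fin 3)), A⟫)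
  have hconn : IsPreconnected ({0}ᶜ : Set W) :=
    (isConnected_compl_singleton_of_one_lt_rank hrank 0).isPreconnected
  have hg : ContinuousOn g {0}ᶜ := continuousOn_of_forall_continuousAt fun w hw =>
    ContinuousAt.comp (g := sideBalance μ) (continuousAt_sideBalance hμ
      (fun h => hw (Subtype.ext (congrArg Prod.fst h))))
      (f := fun w : W => ((w : EuclideanSpace ℝ (Fin 3)), ⟪(w : EuclideanSpace ℝ (Fin 3)), A⟫))
      (by fun_prop)
  have hgneg : ∀ w, g (-w) = -g w := fun w => by
    simp only [g, Submodule.coe_neg, inner_neg_left, ← Prod.neg_mk, sideBalance_neg]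
  obtain ⟨w₀, hw₀⟩ := (isConnected_compl_singleton_of_one_lt_rank hrank 0).nonempty
  obtain ⟨w, hw, hw0⟩ : (0 : ℝ) ∈ g '' {0}ᶜ := by
    have hw₀' : -w₀ ∈ ({0}ᶜ : Set W) := by simpa using hw₀
    rcases le_total (g w₀) 0 with h | h
    · exact hconn.intermediate_value hw₀ hw₀' hg ⟨h, by rw [hgneg]; linarith⟩
    · exact hconn.intermediate_value hw₀' hw₀ hg ⟨by rw [hgneg]; linarith, h⟩
  refine ⟨w, ⟪(w : EuclideanSpace ℝ (Fin 3)), A⟫, fun h => hw (Subtype.ext h), rfl, ?_, hw0⟩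
  have := Submodule.mem_orthogonal_singleton_iff_inner_left.mp w.2
  rwa [inner_sub_right, sub_eq_zero] at this

/-- Hadwiger's theorem: every continuous mass distribution on `ℝ^3` admits an
equipartition by three planes, the first of which can be chosen to contain any two
points `A, B` prescribed in advance. -/
theorem equipartition_three_planes
    (μ : Measure (EuclideanSpace ℝ (Fin 3))) [IsFiniteMeasure μ]
    (hμ0 : μ ≠ 0) (hac : μ ≪ volume)
    (A B : EuclideanSpace ℝ (Fin 3)) :
    ∃ (a : Fin 3 → EuclideanSpace ℝ (Fin 3)) (c : Fin 3 → ℝ),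
      (∀ i, a i ≠ 0) ∧ ⟪a 0, A⟫ = c 0 ∧ ⟪a 0, B⟫ = c 0 ∧ IsEquipartition μ a c := by
  obtain ⟨u, c, hu, hA, hB, hbal⟩ := exists_bisecting_plane_through hac A B
  have hhalf := measure_closedHalfspace hac (p := (u, c)) (by simp [hu]) hbal
  have hne : ∀ ε, μ.restrict (closedHalfspace u c ε) ≠ 0 := fun ε h => by
    have h1 := (hhalf ε).symm.trans (Measure.restrict_eq_zero.mp h)
    simp [ENNReal.div_eq_zero_iff, hμ0] at h1
  have hac' : ∀ ε, μ.restrict (closedHalfspace u c ε) ≪ volume := fun ε =>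
    Measure.restrict_le_self.absolutelyContinuous.trans hac
  obtain ⟨p, q, hp, hq, hpf, hqf, hpt, hqt, hf, ht⟩ :=
    exists_two_plane_equipartition (hne false) (hac' false) (hac' true)
  refine ⟨![u, p.1, q.1], ![c, p.2, q.2], fun i => ?_, hA, hB, fun ε => ?_⟩
  · fin_cases i
    · exact hu
    · exact fst_ne_zero_of_sideBalance_eq_zero (hne false) hp hpf
    · exact fst_ne_zero_of_sideBalance_eq_zero (hne false) hq hqf
  · have hquarter : ∀ ε₀, μ.restrict (closedHalfspace u c ε₀)
        (closedHalfspace p.1 p.2 (ε 1) ∩ closedHalfspace q.1 q.2 (ε 2)) =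
        μ.restrict (closedHalfspace u c ε₀) Set.univ / 4
      | false => measure_closedHalfspace_inter (hac' _) hp hq hpf hqf hf _ _
      | true => measure_closedHalfspace_inter (hac' _) hp hq hpt hqt ht _ _
    have h := hquarter (ε 0)
    rw [Measure.restrict_apply ((measurableSet_closedHalfspace _ _ _).inter
      (measurableSet_closedHalfspace _ _ _)), Measure.restrict_apply_univ, hhalf (ε 0)] at h
    have hset : (⋂ i, closedHalfspace (![u, p.1, q.1] i) (![c, p.2, q.2] i) (ε i)) =
        (closedHalfspace p.1 p.2 (ε 1) ∩ closedHalfspace q.1 q.2 (ε 2)) ∩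
          closedHalfspace u c (ε 0) := by
      ext x
      rw [Set.mem_iInter]
      refine ⟨fun hx => ⟨⟨hx 1, hx 2⟩, hx 0⟩, fun hx i => ?_⟩
      fin_cases i
      exacts [hx.2, hx.1.1, hx.1.2]
    rw [hset, h, div_eq_mul_inv, div_eq_mul_inv, div_eq_mul_inv, mul_assoc,
      ← ENNReal.mul_inv (by simp) (by simp)]
    norm_num
end

section
/- Any two continuous mass distributions μ and ν on ℝ^3 admit a simultaneous equipartition by 2 planes: there exist two planes H_1, H_2 in ℝ^3 such that each of the 4 closed quadrants determined by H_1 and H_2 has μ-measure μ(ℝ^3)/4 and ν-measure ν(ℝ^3)/4. -/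
open MeasureTheory RealInnerProductSpace

open Filter Topology

theorem exists_continuous_exp_lift {A : Type*} [TopologicalSpace A] [SimplyConnectedSpace A]
    [LocallyPathConnectedSpace A] {f : A → ℂ} (hf : Continuous f) (h0 : ∀ a, f a ≠ 0) :
    ∃ L : A → ℂ, Continuous L ∧ ∀ a, Complex.exp (L a) = f a := by
  obtain ⟨a₀⟩ : Nonempty A := inferInstance
  obtain ⟨L, ⟨-, hL⟩, -⟩ := Complex.isCoveringMapOn_exp.existsUnique_continuousMap_lifts
    ⟨f, hf⟩ (a₀ := a₀) (e₀ := Complex.log (f a₀)) (Complex.exp_log (h0 a₀)) (fun a => h0 a)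
  exact ⟨L, L.continuous, fun a => congrFun hL a⟩

theorem eq_of_exp_eq_const {A : Type*} [TopologicalSpace A] [PreconnectedSpace A] {M : A → ℂ}
    (hM : Continuous M) {c : ℂ} (h : ∀ a, Complex.exp (M a) = c) (a b : A) : M a = M b :=
  Complex.isCoveringMap_exp.const_of_comp hM
    (fun a a' => Subtype.ext ((h a).trans (h a').symm)) a b

theorem exp_eq_neg_one_of_exp_eq_neg {z w : ℂ} (h : Complex.exp z = -Complex.exp w) :
    Complex.exp (z - w) = -1 := by
  rw [Complex.exp_sub, h, neg_div, div_self (Complex.exp_ne_zero w)]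

/-- The spherical coordinates on the sphere of radius `2`. -/
noncomputable def sphericalPoint (p : ℝ × ℝ) : EuclideanSpace ℝ (Fin 3) :=
  !₂[2 * (Real.sin p.2 * Real.cos p.1), 2 * (Real.sin p.2 * Real.sin p.1), 2 * Real.cos p.2]

theorem continuous_sphericalPoint : Continuous sphericalPoint := by
  unfold sphericalPoint
  refine (PiLp.continuous_toLp 2 _).comp (continuous_pi fun i => ?_)
  fin_cases i <;> simp <;> fun_prop

theorem norm_sphericalPoint (p : ℝ × ℝ) : ‖sphericalPoint p‖ = 2 := by
  rw [EuclideanSpace.norm_eq, Real.sqrt_eq_iff_mul_self_eq (by positivity) (by norm_num)]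
  simp only [sphericalPoint, Fin.sum_univ_three, Real.norm_eq_abs, sq_abs]
  simp
  nlinarith [Real.sin_sq_add_cos_sq p.1, Real.sin_sq_add_cos_sq p.2]

theorem sphericalPoint_antipode (p : ℝ × ℝ) :
    sphericalPoint (p.1 + Real.pi, Real.pi - p.2) = -sphericalPoint p := by
  ext i
  fin_cases i <;> simp [sphericalPoint, Real.cos_add_pi, Real.sin_add_pi, Real.cos_pi_sub]

theorem sphericalPoint_pole (s t : ℝ) : sphericalPoint (s, 0) = sphericalPoint (t, 0) := by
  simp [sphericalPoint]

/-- The Borsuk–Ulam theorem for maps from the two-dimensional sphere to the plane. -/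
theorem exists_eq_zero_of_odd_s7 {F : EuclideanSpace ℝ (Fin 3) → ℂ}
    (hF : ∀ x, 1 < ‖x‖ → ContinuousAt F x) (hodd : ∀ x, 1 < ‖x‖ → F (-x) = -F x) :
    ∃ x, 1 < ‖x‖ ∧ F x = 0 := by
  by_contra! hne
  have hn : ∀ p, 1 < ‖sphericalPoint p‖ := fun p => by rw [norm_sphericalPoint]; norm_num
  have hc : Continuous fun p => F (sphericalPoint p) := continuous_iff_continuousAt.2 fun p =>
    ContinuousAt.comp (hF _ (hn p)) continuous_sphericalPoint.continuousAt
  obtain ⟨L, hL, hexp⟩ := exists_continuous_exp_lift hc fun p => hne _ (hn p)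
  have hanti : ∀ p : ℝ × ℝ,
      Complex.exp (L (p.1 + Real.pi, Real.pi - p.2) - L p) = -1 := fun p => by
    refine exp_eq_neg_one_of_exp_eq_neg ?_
    rw [hexp, hexp, sphericalPoint_antipode, hodd _ (hn p)]
  have hconst := eq_of_exp_eq_const (by fun_prop) hanti (0, 0) (Real.pi, Real.pi)
  have hpole := eq_of_exp_eq_const (M := fun s : ℝ => L (s, 0)) (by fun_prop)
    (fun s => (hexp (s, 0)).trans (congrArg F (sphericalPoint_pole s 0))) 0 (Real.pi + Real.pi)
  have h1 := hanti (0, 0)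
  simp only [zero_add, sub_zero, sub_self] at hconst hpole h1
  have h0 : L (Real.pi, Real.pi) - L (0, 0) = 0 := by linear_combination (hconst - hpole) / 2
  rw [h0, Complex.exp_zero] at h1
  norm_num at h1

/-- Near the zero set of an odd function on the sphere, some point is joined to its antipode. -/
theorem exists_joinedIn_neg_s7 {f : EuclideanSpace ℝ (Fin 3) → ℝ} (hf : Continuous f)
    (hodd : ∀ x, f (-x) = -f x) {δ : ℝ} (hδ : 0 < δ) :
    ∃ x, JoinedIn {x | 1 < ‖x‖ ∧ |f x| < δ} x (-x) := by
  classical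
  by_contra! hne
  set U : Set (EuclideanSpace ℝ (Fin 3)) := {x | 1 < ‖x‖ ∧ |f x| < δ} with hU
  have hUo : IsOpen U :=
    (isOpen_lt continuous_const continuous_norm).inter (isOpen_lt hf.abs continuous_const)
  have hUneg : ∀ x, x ∈ U → -x ∈ U := fun x hx => by
    simpa [hU, hodd] using hx
  have hjneg : ∀ x y, JoinedIn U x y → JoinedIn U (-x) (-y) := fun x y h => by
    refine (h.map continuous_neg).mono ?_
    rintro _ ⟨z, hz, rfl⟩
    exact hUneg z hz
  let r : Set (EuclideanSpace ℝ (Fin 3)) → Set (EuclideanSpace ℝ (Fin 3)) → Prop :=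
    WellOrderingRel
  let σ : EuclideanSpace ℝ (Fin 3) → ℝ := fun x =>
    if r (pathComponentIn U x) (pathComponentIn U (-x)) then 1 else -1
  have hσ0 : ∀ x, |σ x| = 1 := fun x => by
    simp only [σ]; split_ifs <;> simp
  have hσodd : ∀ x ∈ U, σ (-x) = -σ x := fun x hx => by
    have hdiff : pathComponentIn U x ≠ pathComponentIn U (-x) := fun h =>
      hne x (h ▸ mem_pathComponentIn_self (hUneg x hx) : -x ∈ pathComponentIn U x)
    simp only [σ, neg_neg]
    rcases trichotomous_of r (pathComponentIn U x) (pathComponentIn U (-x)) with h | h | h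
    · rw [if_neg (asymm_of r h), if_pos h]
    · exact absurd h hdiff
    · rw [if_pos h, if_neg (asymm_of r h), neg_neg]
  have hσc : ∀ x y, JoinedIn U x y → σ y = σ x := fun x y h => by
    simp only [σ]
    rw [pathComponentIn_congr (show y ∈ pathComponentIn U x from h),
      pathComponentIn_congr (show -y ∈ pathComponentIn U (-x) from hjneg x y h)]
  let m : EuclideanSpace ℝ (Fin 3) → ℝ := fun x => max 0 (δ - |f x|)
  have hm : Continuous m := by fun_prop
  have hcont : ∀ x, 1 < ‖x‖ → ContinuousAt (fun x => σ x * m x) x := fun x hx => by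
    by_cases hxU : |f x| < δ
    · have hnear : ∀ᶠ y in 𝓝 x, σ x * m y = σ y * m y := by
        filter_upwards [pathComponentIn_mem_nhds (hUo.mem_nhds ⟨hx, hxU⟩)] with y hy
        rw [hσc x y hy]
      exact (continuous_const.mul hm).continuousAt.congr hnear
    · have hmx : m x = 0 := max_eq_left (by linarith)
      have hm0 : Tendsto m (𝓝 x) (𝓝 0) := hmx ▸ hm.continuousAt
      rw [ContinuousAt, hmx, mul_zero]
      refine squeeze_zero_norm (fun y => ?_) hm0
      rw [Real.norm_eq_abs, abs_mul, hσ0, one_mul, abs_of_nonneg (le_max_left _ _)]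
  obtain ⟨x, hx, hx0⟩ := exists_eq_zero_of_odd_s7
    (F := fun x => (f x : ℂ) + ((σ x * m x : ℝ) : ℂ) * Complex.I)
    (fun x hx => by
      have h1 : ContinuousAt (fun x => ((σ x * m x : ℝ) : ℂ)) x :=
        Complex.continuous_ofReal.continuousAt.comp (hcont x hx)
      have h2 : ContinuousAt (fun x => (f x : ℂ)) x := by fun_prop
      exact h2.add (h1.mul continuousAt_const))
    (fun x hx => by
      have hmneg : m (-x) = m x := by simp only [m, hodd, abs_neg]
      have : σ (-x) * m (-x) = -(σ x * m x) := by
        rw [hmneg]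
        by_cases hxU : |f x| < δ
        · rw [hσodd x ⟨hx, hxU⟩]; ring
        · rw [show m x = 0 from max_eq_left (by linarith)]; simp
      simp only [this, hodd]
      push_cast
      ring)
  have hre := congrArg Complex.re hx0
  have him := congrArg Complex.im hx0
  simp at hre him
  have := hσ0 x
  rcases him with h | h
  · simp [h] at this
  · simp only [m, hre, abs_zero, sub_zero] at h
    rw [max_eq_right hδ.le] at h
    exact hδ.ne' h

theorem exists_common_zero_of_symmetric {f : EuclideanSpace ℝ (Fin 3) → ℝ} (hf : Continuous f)
    (hfodd : ∀ x, f (-x) = -f x)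
    {g : EuclideanSpace ℝ (Fin 3) → EuclideanSpace ℝ (Fin 3) → ℂ}
    (hg : Continuous fun p : EuclideanSpace ℝ (Fin 3) × EuclideanSpace ℝ (Fin 3) => g p.1 p.2)
    (hgodd : ∀ u v, g (-u) v = -g u v) (hsymm : ∀ u v, g u v = g v u)
    (hpos : ∀ u, u ≠ 0 → 0 < (g u u).re) {δ : ℝ} (hδ : 0 < δ) :
    ∃ u v, 1 < ‖u‖ ∧ 1 < ‖v‖ ∧ |f u| < δ ∧ |f v| < δ ∧ g u v = 0 := by
  by_contra! hne
  obtain ⟨x, γ, hγ⟩ := exists_joinedIn_neg_s7 hf hfodd hδ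
  have hx0 : ∀ t, γ t ≠ 0 := fun t h => by
    have := (hγ t).1
    rw [h, norm_zero] at this
    linarith
  let w : ℝ → EuclideanSpace ℝ (Fin 3) := γ.extend
  have hw : Continuous w := γ.continuous_extend
  have hwmem : ∀ t, ∃ s, w t = γ s := fun t => ⟨_, rfl⟩
  have hw0 : w 0 = x := γ.extend_zero
  have hw1 : w 1 = -x := γ.extend_one
  have hgw : Continuous fun p : ℝ × ℝ => g (w p.1) (w p.2) :=
    hg.comp (f := fun p : ℝ × ℝ => (w p.1, w p.2)) (by fun_prop)
  obtain ⟨L, hL, hexp⟩ := exists_continuous_exp_lift hgw fun p => by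
    obtain ⟨s, hs⟩ := hwmem p.1
    obtain ⟨t, ht⟩ := hwmem p.2
    rw [hs, ht]
    exact hne _ _ (hγ s).1 (hγ t).1 (hγ s).2 (hγ t).2
  have hLsymm : ∀ s t, L (s, t) = L (t, s) := fun s t => by
    have := eq_of_exp_eq_const (M := fun p : ℝ × ℝ => L p - L (p.2, p.1)) (c := 1) (by fun_prop)
      (fun p => by
        rw [Complex.exp_sub, hexp, hexp, hsymm, div_self]
        rw [← hexp (p.2, p.1)]
        exact Complex.exp_ne_zero _) (s, t) (0, 0)
    simpa [sub_eq_zero] using this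
  have hstep : ∀ t, Complex.exp (L (1, t) - L (0, t)) = -1 := fun t => by
    refine exp_eq_neg_one_of_exp_eq_neg ?_
    rw [hexp, hexp, hw0, hw1, hgodd]
  have hconst := eq_of_exp_eq_const (by fun_prop) hstep 0 1
  have hslit : ∀ t, g (w t) (w t) ∈ Complex.slitPlane := fun t => by
    obtain ⟨s, hs⟩ := hwmem t
    exact Or.inl (hs ▸ hpos _ (hx0 s))
  have hlog : Continuous fun t => Complex.log (g (w t) (w t)) :=
    (hgw.comp (f := fun t : ℝ => (t, t)) (by fun_prop)).clog hslit
  have hdiag := eq_of_exp_eq_const (M := fun t : ℝ => L (t, t) - Complex.log (g (w t) (w t)))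
    (c := 1) (by fun_prop)
    (fun t => by
      rw [Complex.exp_sub, hexp, Complex.exp_log (Complex.slitPlane_ne_zero (hslit t)), div_self]
      exact Complex.slitPlane_ne_zero (hslit t)) 0 1
  have hends : g (w 1) (w 1) = g (w 0) (w 0) := by
    rw [hw0, hw1, hgodd, hsymm, hgodd, neg_neg]
  simp only [hends] at hdiag
  have h0 : L (1, 0) - L (0, 0) = 0 := by
    linear_combination (hconst - hdiag - hLsymm 0 1) / 2
  have h1 := hstep 0
  rw [h0, Complex.exp_zero] at h1
  norm_num at h1

/-- A continuous, strictly increasing odd approximation of the sign function, sharper for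
larger `k`. -/
noncomputable def smoothSign (k t : ℝ) : ℝ := 2 / Real.pi * Real.arctan (k * t)

theorem continuous_smoothSign (k : ℝ) : Continuous (smoothSign k) := by
  unfold smoothSign; fun_prop

theorem abs_smoothSign_le (k t : ℝ) : |smoothSign k t| ≤ 1 := by
  have h1 := Real.arctan_lt_pi_div_two (k * t)
  have h2 := Real.neg_pi_div_two_lt_arctan (k * t)
  have hp := Real.pi_pos
  rw [smoothSign, abs_mul, abs_of_pos (by positivity), div_mul_eq_mul_div, div_le_one hp]
  have : |Real.arctan (k * t)| ≤ Real.pi / 2 := abs_le.2 ⟨h2.le, h1.le⟩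
  linarith

theorem smoothSign_neg (k t : ℝ) : smoothSign k (-t) = -smoothSign k t := by
  simp [smoothSign, Real.arctan_neg]

theorem smoothSign_strictMono {k : ℝ} (hk : 0 < k) : StrictMono (smoothSign k) := fun a b h => by
  have hp := Real.pi_pos
  exact mul_lt_mul_of_pos_left (Real.arctan_strictMono (mul_lt_mul_of_pos_left h hk))
    (by positivity)

theorem smoothSign_eq_zero {k : ℝ} (hk : 0 < k) {t : ℝ} (h : smoothSign k t = 0) : t = 0 :=
  (smoothSign_strictMono hk).injective (h.trans (by simp [smoothSign]))

theorem tendsto_smoothSign_of_atTop {ι : Type*} {l : Filter ι} {k t : ι → ℝ}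
    (h : Tendsto (fun i => k i * t i) l atTop) :
    Tendsto (fun i => smoothSign (k i) (t i)) l (𝓝 1) := by
  have := ((tendsto_nhds_of_tendsto_nhdsWithin Real.tendsto_arctan_atTop).comp h).const_mul
    (2 / Real.pi)
  rwa [div_mul_div_cancel₀ Real.pi_ne_zero, div_self two_ne_zero] at this

theorem tendsto_smoothSign_of_atBot {ι : Type*} {l : Filter ι} {k t : ι → ℝ}
    (h : Tendsto (fun i => k i * t i) l atBot) :
    Tendsto (fun i => smoothSign (k i) (t i)) l (𝓝 (-1)) := by
  have := ((tendsto_nhds_of_tendsto_nhdsWithin Real.tendsto_arctan_atBot).comp h).const_mul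
    (2 / Real.pi)
  rwa [mul_neg, div_mul_div_cancel₀ Real.pi_ne_zero, div_self two_ne_zero] at this

section Halving

variable {n : ℕ} (m : Measure (EuclideanSpace ℝ (Fin n))) [IsFiniteMeasure m]

theorem continuous_integral_smoothSign (k : ℝ) {X : Type*} [TopologicalSpace X]
    [FirstCountableTopology X] {u : X → EuclideanSpace ℝ (Fin n)} {b : X → ℝ}
    (hu : Continuous u) (hb : Continuous b) :
    Continuous fun y => ∫ x, smoothSign k (⟪u y, x⟫ - b y) ∂m := by
  have hk := continuous_smoothSign k
  refine continuous_of_dominated (bound := fun _ => 1) (fun y => ?_)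
    (fun y => ae_of_all _ fun x => abs_smoothSign_le _ _) (integrable_const _)
    (ae_of_all _ fun x => ?_)
  · exact (by fun_prop : Continuous fun x => smoothSign k (⟪u y, x⟫ - b y)).aestronglyMeasurable
  · fun_prop

theorem integrable_smoothSign (k : ℝ) (u : EuclideanSpace ℝ (Fin n)) (b : ℝ) :
    Integrable (fun x => smoothSign k (⟪u, x⟫ - b)) m := by
  have hk := continuous_smoothSign k
  exact Integrable.of_bound
    (by fun_prop : Continuous fun x => smoothSign k (⟪u, x⟫ - b)).aestronglyMeasurable 1
    (ae_of_all _ fun x => abs_smoothSign_le _ _)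

variable {m}

theorem integral_smoothSign_strictAnti (hm : m ≠ 0) {k : ℝ} (hk : 0 < k)
    (u : EuclideanSpace ℝ (Fin n)) :
    StrictAnti fun b => ∫ x, smoothSign k (⟪u, x⟫ - b) ∂m := fun a b hab => by
  have hlt : ∀ x : EuclideanSpace ℝ (Fin n),
      smoothSign k (⟪u, x⟫ - b) < smoothSign k (⟪u, x⟫ - a) := fun x =>
    smoothSign_strictMono hk (by linarith)
  have hi := (integrable_smoothSign m k u a).sub (integrable_smoothSign m k u b)
  have hpos : 0 < ∫ x, (smoothSign k (⟪u, x⟫ - a) - smoothSign k (⟪u, x⟫ - b)) ∂m := by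
    refine (integral_pos_iff_support_of_nonneg (fun x => (sub_pos.2 (hlt x)).le) hi).2 ?_
    rw [show Function.support _ = Set.univ from
      Set.eq_univ_of_forall fun x => (sub_pos.2 (hlt x)).ne']
    exact Measure.measure_univ_pos.2 hm
  rw [integral_sub (integrable_smoothSign m k u a) (integrable_smoothSign m k u b)] at hpos
  exact sub_pos.1 hpos

theorem exists_integral_smoothSign_eq_zero (hm : m ≠ 0) {k : ℝ} (hk : 0 < k)
    (u : EuclideanSpace ℝ (Fin n)) :
    ∃ b, ∫ x, smoothSign k (⟪u, x⟫ - b) ∂m = 0 := by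
  have := NeZero.mk hm
  have hmr : 0 < m.real Set.univ := measureReal_univ_pos
  have hlim : ∀ (b : ℕ → ℝ) (c : ℝ), (∀ x : EuclideanSpace ℝ (Fin n),
      Tendsto (fun i => smoothSign k (⟪u, x⟫ - b i)) atTop (𝓝 c)) →
      Tendsto (fun i => ∫ x, smoothSign k (⟪u, x⟫ - b i) ∂m) atTop (𝓝 (m.real Set.univ * c)) := by
    intro b c h
    have := tendsto_integral_of_dominated_convergence (μ := m) (fun _ => (1 : ℝ))
      (fun i => (integrable_smoothSign m k u (b i)).aestronglyMeasurable) (integrable_const _)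
      (fun i => ae_of_all _ fun x => abs_smoothSign_le _ _) (ae_of_all _ h)
    simpa using this
  have h1 := hlim (fun i => (i : ℝ)) (-1) fun x => tendsto_smoothSign_of_atBot
    (Tendsto.const_mul_atBot hk (by
      simpa only [sub_eq_add_neg] using tendsto_atBot_add_const_left _ _
        (tendsto_neg_atBot_iff.2 tendsto_natCast_atTop_atTop)))
  have h2 := hlim (fun i => -(i : ℝ)) 1 fun x => tendsto_smoothSign_of_atTop
    (Tendsto.const_mul_atTop hk (by
      simpa only [sub_neg_eq_add] using tendsto_atTop_add_const_left _ _
        tendsto_natCast_atTop_atTop))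
  obtain ⟨i, hi⟩ := (h1.eventually_lt_const (u := 0) (by linarith)).exists
  obtain ⟨j, hj⟩ := (h2.eventually_const_lt (u := 0) (by linarith)).exists
  exact mem_range_of_exists_le_of_exists_ge
    (continuous_integral_smoothSign m k continuous_const continuous_id)
    ⟨_, hi.le⟩ ⟨_, hj.le⟩

/-- A continuous odd choice of offsets of smoothed halving hyperplanes. -/
theorem exists_continuous_halving (hm : m ≠ 0) {k : ℝ} (hk : 0 < k) :
    ∃ h : EuclideanSpace ℝ (Fin n) → ℝ, Continuous h ∧ (∀ u, h (-u) = -h u) ∧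
      ∀ u, ∫ x, smoothSign k (⟪u, x⟫ - h u) ∂m = 0 := by
  choose h hh using exists_integral_smoothSign_eq_zero hm hk
  refine ⟨h, ?_, fun u => ?_, hh⟩
  · have hc : ∀ c : ℝ, Continuous fun u => ∫ x, smoothSign k (⟪u, x⟫ - c) ∂m := fun c =>
      continuous_integral_smoothSign m k continuous_id continuous_const
    rw [continuous_iff_lower_upperSemicontinuous]
    refine ⟨fun u c hcu => ?_, fun u c hcu => ?_⟩
    · have hlt := integral_smoothSign_strictAnti hm hk u hcu
      simp only [hh] at hlt
      filter_upwards [(hc c).continuousAt.eventually_const_lt hlt] with v hv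
      rw [← hh v] at hv
      exact (integral_smoothSign_strictAnti hm hk v).lt_iff_gt.1 hv
    · have hlt := integral_smoothSign_strictAnti hm hk u hcu
      simp only [hh] at hlt
      filter_upwards [(hc c).continuousAt.eventually_lt_const hlt] with v hv
      rw [← hh v] at hv
      exact (integral_smoothSign_strictAnti hm hk v).lt_iff_gt.1 hv
  · refine (integral_smoothSign_strictAnti hm hk (-u)).injective ?_
    have : ∀ x : EuclideanSpace ℝ (Fin n), smoothSign k (⟪-u, x⟫ - -h u) =
        -smoothSign k (⟪u, x⟫ - h u) := fun x => by
      rw [← smoothSign_neg, inner_neg_left]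
      ring_nf
    simp only [hh, this, integral_neg, neg_zero]

end Halving

theorem ae_inner_sub_ne_zero {n : ℕ} {m : Measure (EuclideanSpace ℝ (Fin n))}
    (hm : m ≪ volume) {u : EuclideanSpace ℝ (Fin n)} {b : ℝ}
    (hub : (u, b) ≠ 0) : ∀ᵐ x ∂m, ⟪u, x⟫ - b ≠ 0 := by
  refine hm.ae_le ?_
  by_cases hu : u = 0
  · subst hu
    refine ae_of_all _ fun x hx => hub ?_
    simp only [inner_zero_left, zero_sub, neg_eq_zero] at hx
    rw [hx]
    rfl
  · let f : EuclideanSpace ℝ (Fin n) →ᵃ[ℝ] ℝ := (innerₛₗ ℝ u).toAffineMap - AffineMap.const ℝ _ b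
    have hS := Measure.addHaar_affineSubspace (volume : Measure (EuclideanSpace ℝ (Fin n)))
      ((AffineSubspace.mk' (0 : ℝ) ⊥).comap f) fun h => by
        have hall : ∀ x, ⟪u, x⟫ - b = 0 := fun x => by
          have : x ∈ (AffineSubspace.mk' (0 : ℝ) ⊥).comap f := h ▸ AffineSubspace.mem_top ..
          simpa [f] using this
        have h0 := hall 0
        have h1 := hall u
        simp only [inner_zero_right] at h0
        exact hu (inner_self_eq_zero (𝕜 := ℝ).1 (by linarith))
    change ∀ᵐ x, ⟪u, x⟫ - b ≠ 0
    rw [ae_iff]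
    convert hS using 2
    ext x
    simp [f]

theorem continuous_integral_smoothSign_mul {n : ℕ} (m : Measure (EuclideanSpace ℝ (Fin n)))
    [IsFiniteMeasure m] (k : ℝ) {h : EuclideanSpace ℝ (Fin n) → ℝ} (hh : Continuous h) :
    Continuous fun p : EuclideanSpace ℝ (Fin n) × EuclideanSpace ℝ (Fin n) =>
      ∫ x, smoothSign k (⟪p.1, x⟫ - h p.1) * smoothSign k (⟪p.2, x⟫ - h p.2) ∂m := by
  have hk := continuous_smoothSign k
  refine continuous_of_dominated (bound := fun _ => 1) (fun p => ?_)
    (fun p => ae_of_all _ fun x => ?_) (integrable_const _) (ae_of_all _ fun x => ?_)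
  · exact (by fun_prop : Continuous fun x =>
      smoothSign k (⟪p.1, x⟫ - h p.1) * smoothSign k (⟪p.2, x⟫ - h p.2)).aestronglyMeasurable
  · rw [Real.norm_eq_abs, abs_mul]
    exact mul_le_one₀ (abs_smoothSign_le _ _) (abs_nonneg _) (abs_smoothSign_le _ _)
  · fun_prop

/-- The smoothed equipartition problem has approximate solutions. -/
theorem exists_smooth_equipartition {μ ν : Measure (EuclideanSpace ℝ (Fin 3))}
    [IsFiniteMeasure μ] [IsFiniteMeasure ν] (hμ0 : μ ≠ 0) (hμac : μ ≪ volume)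
    {k : ℝ} (hk : 0 < k) {δ : ℝ} (hδ : 0 < δ) :
    ∃ (u v : EuclideanSpace ℝ (Fin 3)) (a b : ℝ), 1 < ‖u‖ ∧ 1 < ‖v‖ ∧
      ∫ x, smoothSign k (⟪u, x⟫ - a) ∂μ = 0 ∧ ∫ x, smoothSign k (⟪v, x⟫ - b) ∂μ = 0 ∧
      |∫ x, smoothSign k (⟪u, x⟫ - a) ∂ν| < δ ∧ |∫ x, smoothSign k (⟪v, x⟫ - b) ∂ν| < δ ∧
      ∫ x, smoothSign k (⟪u, x⟫ - a) * smoothSign k (⟪v, x⟫ - b) ∂μ = 0 ∧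
      ∫ x, smoothSign k (⟪u, x⟫ - a) * smoothSign k (⟪v, x⟫ - b) ∂ν = 0 := by
  obtain ⟨h, hc, hodd, hh⟩ := exists_continuous_halving hμ0 hk
  have hneg : ∀ u x, smoothSign k (⟪-u, x⟫ - h (-u)) = -smoothSign k (⟪u, x⟫ - h u) :=
    fun u x => by
      rw [← smoothSign_neg, inner_neg_left, hodd]
      ring_nf
  let I : Measure (EuclideanSpace ℝ (Fin 3)) → EuclideanSpace ℝ (Fin 3) →
      EuclideanSpace ℝ (Fin 3) → ℝ := fun m u v =>
    ∫ x, smoothSign k (⟪u, x⟫ - h u) * smoothSign k (⟪v, x⟫ - h v) ∂m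
  have hIcont : Continuous fun p : EuclideanSpace ℝ (Fin 3) × EuclideanSpace ℝ (Fin 3) =>
      (I μ p.1 p.2 : ℂ) + (I ν p.1 p.2 : ℂ) * Complex.I := by
    have h1 := continuous_integral_smoothSign_mul μ k hc
    have h2 := continuous_integral_smoothSign_mul ν k hc
    simp only [I]
    fun_prop
  have hIodd : ∀ m u v, I m (-u) v = -I m u v := fun m u v => by
    simp only [I, hneg, neg_mul, integral_neg]
  have hIsymm : ∀ m u v, I m u v = I m v u := fun m u v => by
    simp only [I, mul_comm]
  have hIpos : ∀ u, u ≠ 0 → 0 < I μ u u := fun u hu => by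
    have hi : Integrable (fun x => smoothSign k (⟪u, x⟫ - h u) * smoothSign k (⟪u, x⟫ - h u)) μ :=
      (integrable_smoothSign μ k u (h u)).mul_bdd (c := 1)
        (integrable_smoothSign μ k u (h u)).aestronglyMeasurable
        (ae_of_all _ fun x => abs_smoothSign_le _ _)
    have hnonneg : ∀ x, 0 ≤ smoothSign k (⟪u, x⟫ - h u) * smoothSign k (⟪u, x⟫ - h u) :=
      fun x => mul_self_nonneg _
    refine lt_of_le_of_ne (integral_nonneg hnonneg) fun h0 => hμ0 ?_
    have hae := (integral_eq_zero_iff_of_nonneg hnonneg hi).1 h0.symm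
    rw [← ae_eq_bot, ← Filter.eventually_false_iff_eq_bot]
    filter_upwards [hae, ae_inner_sub_ne_zero (u := u) (b := h u) hμac
      (fun h => hu (congrArg Prod.fst h))] with x hx hx'
    exact hx' (smoothSign_eq_zero hk (mul_self_eq_zero.1 hx))
  obtain ⟨u, v, hu, hv, hfu, hfv, hg⟩ := exists_common_zero_of_symmetric
    (f := fun u => ∫ x, smoothSign k (⟪u, x⟫ - h u) ∂ν)
    (continuous_integral_smoothSign ν k continuous_id hc)
    (fun u => by simp only [hneg, integral_neg])
    (g := fun u v => (I μ u v : ℂ) + (I ν u v : ℂ) * Complex.I) hIcont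
    (fun u v => by simp only [hIodd]; push_cast; ring)
    (fun u v => by rw [hIsymm μ, hIsymm ν])
    (fun u hu => by simpa using hIpos u hu) hδ
  refine ⟨u, v, h u, h v, hu, hv, hh u, hh v, hfu, hfv, ?_, ?_⟩
  · simpa using congrArg Complex.re hg
  · simpa using congrArg Complex.im hg

/-- Compactness of the space of hyperplanes, including the one at infinity. -/
theorem exists_subseq_tendsto_smoothSign {n : ℕ} {k : ℕ → ℝ} (hk : Tendsto k atTop atTop)
    {u : ℕ → EuclideanSpace ℝ (Fin n)} (hu : ∀ i, 1 < ‖u i‖) (a : ℕ → ℝ) :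
    ∃ (φ : ℕ → ℕ) (w : EuclideanSpace ℝ (Fin n)) (c : ℝ), StrictMono φ ∧ (w, c) ≠ 0 ∧
      ∀ x, ⟪w, x⟫ - c ≠ 0 → Tendsto (fun i => smoothSign (k (φ i)) (⟪u (φ i), x⟫ - a (φ i))) atTop
        (𝓝 (Real.sign (⟪w, x⟫ - c))) := by
  let p : ℕ → EuclideanSpace ℝ (Fin n) × ℝ := fun i => (u i, a i)
  have hp : ∀ i, 1 < ‖p i‖ := fun i => (hu i).trans_le (norm_fst_le (p i))
  have hp0 : ∀ i, ‖p i‖ ≠ 0 := fun i => (zero_lt_one.trans (hp i)).ne'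
  obtain ⟨⟨w, c⟩, hwc, φ, hφ, hlim⟩ :=
    (isCompact_sphere (0 : EuclideanSpace ℝ (Fin n) × ℝ) 1).tendsto_subseq
      (x := fun i => ‖p i‖⁻¹ • p i) fun i => by
        rw [mem_sphere_zero_iff_norm, norm_smul, norm_inv, norm_norm, inv_mul_cancel₀ (hp0 i)]
  have hscale : Tendsto (fun i => k (φ i) * ‖p (φ i)‖) atTop atTop :=
    tendsto_atTop_mono' _ (by
      filter_upwards [(hk.comp hφ.tendsto_atTop).eventually_ge_atTop 0] with i hi
      exact le_mul_of_one_le_right hi (hp _).le) (hk.comp hφ.tendsto_atTop)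
  refine ⟨φ, w, c, hφ, fun h => ?_, fun x hx => ?_⟩
  · rw [h] at hwc
    simp at hwc
  · have ht := (((by fun_prop : Continuous fun q : EuclideanSpace ℝ (Fin n) × ℝ =>
      ⟪q.1, x⟫ - q.2).tendsto (w, c)).comp hlim)
    have heq : ∀ i, k (φ i) * ‖p (φ i)‖ * (⟪(‖p (φ i)‖⁻¹ • p (φ i)).1, x⟫ -
        (‖p (φ i)‖⁻¹ • p (φ i)).2) = k (φ i) * (⟪u (φ i), x⟫ - a (φ i)) := fun i => by
      have := hp0 (φ i)
      simp only [Prod.smul_fst, Prod.smul_snd, real_inner_smul_left, smul_eq_mul]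
      field_simp
      rfl
    rcases lt_or_gt_of_ne hx with hx | hx
    · rw [Real.sign_of_neg hx]
      exact tendsto_smoothSign_of_atBot ((hscale.atTop_mul_neg hx ht).congr heq)
    · rw [Real.sign_of_pos hx]
      exact tendsto_smoothSign_of_atTop ((hscale.atTop_mul_pos hx ht).congr heq)

theorem measurable_sign_inner_sub {n : ℕ} (u : EuclideanSpace ℝ (Fin n)) (a : ℝ) :
    Measurable fun x : EuclideanSpace ℝ (Fin n) => Real.sign (⟪u, x⟫ - a) := by
  have hm : Measurable fun x : EuclideanSpace ℝ (Fin n) => ⟪u, x⟫ - a := by fun_prop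
  exact Measurable.ite (hm measurableSet_Iio) measurable_const
    (Measurable.ite (hm measurableSet_Ioi) measurable_const measurable_const)

theorem measure_quadrant_eq {n : ℕ} {m : Measure (EuclideanSpace ℝ (Fin n))} [IsFiniteMeasure m]
    (hm : m ≪ volume) {u : Fin 2 → EuclideanSpace ℝ (Fin n)} {a : Fin 2 → ℝ}
    (hu : ∀ i, (u i, a i) ≠ 0) (hhalf : ∀ i, ∫ x, Real.sign (⟪u i, x⟫ - a i) ∂m = 0)
    (hprod : ∫ x, Real.sign (⟪u 0, x⟫ - a 0) * Real.sign (⟪u 1, x⟫ - a 1) ∂m = 0)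
    (ε : Fin 2 → Bool) :
    m (⋂ i, closedHalfspace (u i) (a i) (ε i)) = m Set.univ / 4 := by
  let s : Fin 2 → EuclideanSpace ℝ (Fin n) → ℝ := fun i x => Real.sign (⟪u i, x⟫ - a i)
  let e : Fin 2 → ℝ := fun i => if ε i then -1 else 1
  let Q := ⋂ i, closedHalfspace (u i) (a i) (ε i)
  have hQ : MeasurableSet Q := by
    refine MeasurableSet.iInter fun i => ?_
    unfold closedHalfspace
    split_ifs
    · exact measurableSet_le (by fun_prop) measurable_const
    · exact measurableSet_le measurable_const (by fun_prop)
  have hsb : ∀ i x, ‖s i x‖ ≤ 1 := fun i x => by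
    rcases Real.sign_apply_eq (⟪u i, x⟫ - a i) with h | h | h <;> simp [s, h]
  have hsm : ∀ i, AEStronglyMeasurable (s i) m := fun i =>
    (measurable_sign_inner_sub (u i) (a i)).aestronglyMeasurable
  have hsi : ∀ i, Integrable (s i) m := fun i => Integrable.of_bound (hsm i) 1 (ae_of_all _ (hsb i))
  have hpi : Integrable (fun x => s 0 x * s 1 x) m :=
    (hsi 0).mul_bdd (c := 1) (hsm 1) (ae_of_all _ (hsb 1))
  have hind : Q.indicator (fun _ => (1 : ℝ)) =ᵐ[m] fun x =>
      (1 + e 0 * s 0 x + e 1 * s 1 x + e 0 * e 1 * (s 0 x * s 1 x)) / 4 := by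
    filter_upwards [ae_inner_sub_ne_zero hm (hu 0), ae_inner_sub_ne_zero hm (hu 1)] with x h0 h1
    have hfactor : ∀ i, ⟪u i, x⟫ - a i ≠ 0 →
        (closedHalfspace (u i) (a i) (ε i)).indicator (fun _ => (1 : ℝ)) x =
          (1 + e i * s i x) / 2 := fun i hi => by
      rcases lt_or_gt_of_ne hi with h | h
      · have h1 : ⟪u i, x⟫ ≤ a i := by linarith
        have h2 : ¬ a i ≤ ⟪u i, x⟫ := by linarith
        cases hε : ε i <;> simp [closedHalfspace, e, s, hε, h1, h2, Real.sign_of_neg h]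
      · have h1 : ¬ ⟪u i, x⟫ ≤ a i := by linarith
        have h2 : a i ≤ ⟪u i, x⟫ := by linarith
        cases hε : ε i <;> simp [closedHalfspace, e, s, hε, h1, h2, Real.sign_of_pos h]
    have hinter : Q = closedHalfspace (u 0) (a 0) (ε 0) ∩ closedHalfspace (u 1) (a 1) (ε 1) := by
      ext y
      simp [Q, Fin.forall_fin_two]
    have hmul : Q.indicator (fun _ => (1 : ℝ)) x =
        (closedHalfspace (u 0) (a 0) (ε 0)).indicator (fun _ => (1 : ℝ)) x *
          (closedHalfspace (u 1) (a 1) (ε 1)).indicator (fun _ => (1 : ℝ)) x := by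
      rw [hinter]
      simpa using Set.inter_indicator_mul (fun _ => (1 : ℝ)) (fun _ => (1 : ℝ)) x
    rw [hmul, hfactor 0 h0, hfactor 1 h1]
    ring
  have hreal : m.real Q = m.real Set.univ / 4 := by
    have h1 : ∫ x, Q.indicator (fun _ => (1 : ℝ)) x ∂m = m.real Q := by
      rw [integral_indicator_const _ hQ, smul_eq_mul, mul_one]
    have hs : ∀ i, ∫ x, s i x ∂m = 0 := hhalf
    have hp : ∫ x, s 0 x * s 1 x ∂m = 0 := hprod
    rw [← h1, integral_congr_ae hind, integral_div, integral_add (by fun_prop) (by fun_prop),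
      integral_add (by fun_prop) (by fun_prop), integral_add (by fun_prop) (by fun_prop)]
    simp only [integral_const_mul, hs, hp]
    simp
  rw [← ENNReal.toReal_eq_toReal_iff' (measure_ne_top _ _)
    (ENNReal.div_ne_top (measure_ne_top _ _) (by norm_num)), ENNReal.toReal_div]
  exact hreal

theorem normal_ne_zero_of_integral_sign_eq_zero {n : ℕ} {m : Measure (EuclideanSpace ℝ (Fin n))}
    [IsFiniteMeasure m] (hm : m ≠ 0) {u : EuclideanSpace ℝ (Fin n)} {a : ℝ}
    (hua : (u, a) ≠ 0) (h : ∫ x, Real.sign (⟪u, x⟫ - a) ∂m = 0) : u ≠ 0 := by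
  rintro rfl
  have ha : a ≠ 0 := fun ha => hua (by rw [ha]; rfl)
  have := NeZero.mk hm
  simp [Real.sign_eq_zero_iff, ha, (measureReal_univ_pos (μ := m)).ne'] at h

/-- Any two continuous mass distributions `μ, ν` on `ℝ^3` admit a simultaneous
equipartition by two planes: each of the four closed quadrants determined by the planes
carries a quarter of the total mass of each measure. -/
theorem simultaneous_equipartition_two_planes
    (μ ν : Measure (EuclideanSpace ℝ (Fin 3))) [IsFiniteMeasure μ] [IsFiniteMeasure ν]
    (hμ0 : μ ≠ 0) (hμac : μ ≪ volume) (hν0 : ν ≠ 0) (hνac : ν ≪ volume) :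
    ∃ (a : Fin 2 → EuclideanSpace ℝ (Fin 3)) (c : Fin 2 → ℝ),
      (∀ i, a i ≠ 0) ∧
      ∀ ε : Fin 2 → Bool,
        μ (⋂ i, closedHalfspace (a i) (c i) (ε i)) = μ Set.univ / 4 ∧
        ν (⋂ i, closedHalfspace (a i) (c i) (ε i)) = ν Set.univ / 4 := by
  have hk : ∀ i : ℕ, (0 : ℝ) < i + 1 := fun i => by positivity
  have hk' : Tendsto (fun i : ℕ => (i : ℝ) + 1) atTop atTop :=
    tendsto_atTop_add_const_right _ _ tendsto_natCast_atTop_atTop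
  choose u v a b hu hv hμu hμv hνu hνv hμ hν using fun i : ℕ =>
    exists_smooth_equipartition (ν := ν) hμ0 hμac (hk i) (one_div_pos.2 (hk i))
  obtain ⟨φ, w₀, c₀, hφ, hw₀, hlim₀⟩ := exists_subseq_tendsto_smoothSign hk' hu a
  obtain ⟨ψ, w₁, c₁, hψ, hw₁, hlim₁⟩ := exists_subseq_tendsto_smoothSign
    (hk'.comp hφ.tendsto_atTop) (fun i => hv (φ i)) (fun i => b (φ i))
  let θ : ℕ → ℕ := fun i => φ (ψ i)
  have hθ : Tendsto θ atTop atTop := hφ.tendsto_atTop.comp hψ.tendsto_atTop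
  let s : ℕ → EuclideanSpace ℝ (Fin 3) → ℝ := fun i x =>
    smoothSign ((θ i : ℝ) + 1) (⟪u (θ i), x⟫ - a (θ i))
  let t : ℕ → EuclideanSpace ℝ (Fin 3) → ℝ := fun i x =>
    smoothSign ((θ i : ℝ) + 1) (⟪v (θ i), x⟫ - b (θ i))
  have hs : ∀ x, ⟪w₀, x⟫ - c₀ ≠ 0 →
      Tendsto (fun i => s i x) atTop (𝓝 (Real.sign (⟪w₀, x⟫ - c₀))) :=
    fun x hx => (hlim₀ x hx).comp hψ.tendsto_atTop
  have ht : ∀ x, ⟪w₁, x⟫ - c₁ ≠ 0 →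
      Tendsto (fun i => t i x) atTop (𝓝 (Real.sign (⟪w₁, x⟫ - c₁))) := hlim₁
  have hsmall : ∀ F : ℕ → ℝ, (∀ i, |F i| ≤ 1 / ((θ i : ℝ) + 1)) → Tendsto F atTop (𝓝 0) :=
    fun F hF => squeeze_zero_norm hF (tendsto_one_div_add_atTop_nhds_zero_nat.comp hθ)
  have hzero : ∀ i, |(0 : ℝ)| ≤ 1 / ((θ i : ℝ) + 1) := fun i => by
    rw [abs_zero]; exact (one_div_pos.2 (hk _)).le
  have key : ∀ m : Measure (EuclideanSpace ℝ (Fin 3)), IsFiniteMeasure m → m ≪ volume →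
      (∀ i, |∫ x, s i x ∂m| ≤ 1 / ((θ i : ℝ) + 1)) →
      (∀ i, |∫ x, t i x ∂m| ≤ 1 / ((θ i : ℝ) + 1)) →
      (∀ i, ∫ x, s i x * t i x ∂m = 0) →
      ∫ x, Real.sign (⟪w₀, x⟫ - c₀) ∂m = 0 ∧ ∫ x, Real.sign (⟪w₁, x⟫ - c₁) ∂m = 0 ∧
      ∫ x, Real.sign (⟪w₀, x⟫ - c₀) * Real.sign (⟪w₁, x⟫ - c₁) ∂m = 0 := by
    intro m _ hm hsm htm hst
    have hsi : ∀ i, Integrable (s i) m := fun i => integrable_smoothSign m _ _ _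
    have hti : ∀ i, Integrable (t i) m := fun i => integrable_smoothSign m _ _ _
    have hs1 : ∀ i x, ‖s i x‖ ≤ 1 := fun i x => abs_smoothSign_le _ _
    have ht1 : ∀ i x, ‖t i x‖ ≤ 1 := fun i x => abs_smoothSign_le _ _
    have hae₀ := ae_inner_sub_ne_zero hm hw₀
    have hae₁ := ae_inner_sub_ne_zero hm hw₁
    refine ⟨tendsto_nhds_unique (tendsto_integral_of_dominated_convergence (fun _ => 1)
        (fun i => (hsi i).aestronglyMeasurable) (integrable_const _)
        (fun i => ae_of_all _ (hs1 i)) (hae₀.mono hs)) (hsmall _ hsm),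
      tendsto_nhds_unique (tendsto_integral_of_dominated_convergence (fun _ => 1)
        (fun i => (hti i).aestronglyMeasurable) (integrable_const _)
        (fun i => ae_of_all _ (ht1 i)) (hae₁.mono ht)) (hsmall _ htm),
      tendsto_nhds_unique (tendsto_integral_of_dominated_convergence (fun _ => 1)
        (fun i => (hsi i).aestronglyMeasurable.mul (hti i).aestronglyMeasurable)
        (integrable_const _) (fun i => ae_of_all _ fun x => ?_)
        ((hae₀.and hae₁).mono fun x hx => (hs x hx.1).mul (ht x hx.2)))
        (hsmall _ fun i => (hst i).symm ▸ hzero i)⟩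
    rw [Pi.mul_apply, norm_mul]
    exact mul_le_one₀ (hs1 i x) (norm_nonneg _) (ht1 i x)
  obtain ⟨hμ₀, hμ₁, hμ₂⟩ := key μ inferInstance hμac (fun i => (hμu (θ i)).symm ▸ hzero i)
    (fun i => (hμv (θ i)).symm ▸ hzero i) (fun i => hμ (θ i))
  obtain ⟨hν₀, hν₁, hν₂⟩ := key ν inferInstance hνac (fun i => (hνu (θ i)).le)
    (fun i => (hνv (θ i)).le) (fun i => hν (θ i))
  have hw : ∀ i, (![w₀, w₁] i, ![c₀, c₁] i) ≠ 0 := Fin.forall_fin_two.2 ⟨hw₀, hw₁⟩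
  exact ⟨![w₀, w₁], ![c₀, c₁],
    Fin.forall_fin_two.2 ⟨normal_ne_zero_of_integral_sign_eq_zero hμ0 hw₀ hμ₀,
      normal_ne_zero_of_integral_sign_eq_zero hμ0 hw₁ hμ₁⟩,
    fun ε => ⟨measure_quadrant_eq hμac hw (Fin.forall_fin_two.2 ⟨hμ₀, hμ₁⟩) hμ₂ ε,
      measure_quadrant_eq hνac hw (Fin.forall_fin_two.2 ⟨hν₀, hν₁⟩) hν₂ ε⟩⟩
end

section
/- Every continuous mass distribution μ on ℝ^2 admits an equipartition by 2 lines: there exist two lines H_1, H_2 in ℝ^2 such that each of the 4 closed quadrants determined by H_1 and H_2 has measure μ(ℝ^2)/4. -/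
open MeasureTheory RealInnerProductSpace

open Filter Topology

section Bisection

variable {n : ℕ} (ν : Measure (EuclideanSpace ℝ (Fin n)))

/-- The mass of the closed half-space `⟪a, x⟫ ≤ c`, as a real number. -/
noncomputable def halfspaceMass (a : EuclideanSpace ℝ (Fin n)) (c : ℝ) : ℝ :=
  ν.real {x | ⟪a, x⟫ ≤ c}

variable {ν}

lemma measure_hyperplane_eq_zero (hν : ν ≪ volume) {a : EuclideanSpace ℝ (Fin n)} (ha : a ≠ 0)
    (c : ℝ) : ν {x | ⟪a, x⟫ = c} = 0 := by
  apply hν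
  rcases Set.eq_empty_or_nonempty {x : EuclideanSpace ℝ (Fin n) | ⟪a, x⟫ = c} with h | ⟨p, hp⟩
  · rw [h, measure_empty]
  have hset : {x : EuclideanSpace ℝ (Fin n) | ⟪a, x⟫ = c} =
      AffineSubspace.mk' p (innerSL ℝ a).toLinearMap.ker := by
    ext x
    simp only [Set.mem_ofPred_eq] at hp
    simp [AffineSubspace.mem_mk', inner_sub_right, hp, sub_eq_zero]
  rw [hset]
  refine Measure.addHaar_affineSubspace _ _ fun htop => ha ?_
  have hdir := congrArg AffineSubspace.direction htop
  rw [AffineSubspace.direction_mk', AffineSubspace.direction_top] at hdir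
  have : a ∈ (innerSL ℝ a).toLinearMap.ker := hdir ▸ Submodule.mem_top
  simpa using this

lemma measurableSet_halfspace (a : EuclideanSpace ℝ (Fin n)) (c : ℝ) :
    MeasurableSet {x : EuclideanSpace ℝ (Fin n) | ⟪a, x⟫ ≤ c} :=
  measurableSet_le (by fun_prop) measurable_const

variable [IsFiniteMeasure ν]

lemma tendsto_halfspaceMass {ι : Type*} {l : Filter ι} [l.IsCountablyGenerated]
    {a : ι → EuclideanSpace ℝ (Fin n)} {c : ι → ℝ} {s : Set (EuclideanSpace ℝ (Fin n))}
    (hs : MeasurableSet s) (h : ∀ᵐ x ∂ν, ∀ᶠ i in l, ⟪a i, x⟫ ≤ c i ↔ x ∈ s) :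
    Tendsto (fun i => halfspaceMass ν (a i) (c i)) l (𝓝 (ν.real s)) :=
  (ENNReal.tendsto_toReal (measure_ne_top ν s)).comp
    (tendsto_measure_of_ae_tendsto_indicator_of_isFiniteMeasure l hs
      (fun i => measurableSet_halfspace (a i) (c i)) h)

lemma continuous_halfspaceMass {X : Type*} [TopologicalSpace X] [FirstCountableTopology X]
    (hν : ν ≪ volume) {a : X → EuclideanSpace ℝ (Fin n)} {c : X → ℝ} (ha : Continuous a)
    (hc : Continuous c) (ha0 : ∀ t, a t ≠ 0) :
    Continuous fun t => halfspaceMass ν (a t) (c t) := by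
  refine continuous_iff_continuousAt.2 fun t =>
    tendsto_halfspaceMass (measurableSet_halfspace (a t) (c t)) ?_
  have hne : ∀ᵐ x ∂ν, ⟪a t, x⟫ ≠ c t := by
    simpa [ae_iff] using measure_hyperplane_eq_zero hν (ha0 t) (c t)
  filter_upwards [hne] with x hx
  have hcont : Continuous fun t => ⟪a t, x⟫ := by fun_prop
  rcases hx.lt_or_gt with h | h
  · filter_upwards [(hcont.tendsto t).eventually_lt (hc.tendsto t) h] with i hi
    exact iff_of_true hi.le h.le
  · filter_upwards [(hc.tendsto t).eventually_lt (hcont.tendsto t) h] with i hi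
    exact iff_of_false hi.not_ge h.not_ge

lemma tendsto_halfspaceMass_atTop (a : EuclideanSpace ℝ (Fin n)) :
    Tendsto (halfspaceMass ν a) atTop (𝓝 (ν.real Set.univ)) :=
  tendsto_halfspaceMass .univ <| .of_forall fun x => by
    filter_upwards [eventually_ge_atTop ⟪a, x⟫] with c hc
    simp [hc]

lemma tendsto_halfspaceMass_atBot (a : EuclideanSpace ℝ (Fin n)) :
    Tendsto (halfspaceMass ν a) atBot (𝓝 0) := by
  rw [← measureReal_empty (μ := ν)]
  refine tendsto_halfspaceMass .empty <| .of_forall fun x => ?_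
  filter_upwards [eventually_lt_atBot ⟪a, x⟫] with c hc
  simp [hc]

lemma halfspaceMass_mono (a : EuclideanSpace ℝ (Fin n)) : Monotone (halfspaceMass ν a) :=
  fun _ _ h => measureReal_mono fun _ hx => le_trans hx h

lemma measureReal_closedHalfspace (hν : ν ≪ volume) {a : EuclideanSpace ℝ (Fin n)} (ha : a ≠ 0)
    {c : ℝ} (h : halfspaceMass ν a c = ν.real Set.univ / 2) (ε : Bool) :
    ν.real (closedHalfspace a c ε) = ν.real Set.univ / 2 := by
  cases ε with
  | true => simpa [closedHalfspace, halfspaceMass] using h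
  | false =>
    have hae : {x : EuclideanSpace ℝ (Fin n) | c ≤ ⟪a, x⟫} =ᵐ[ν]
        ({x | ⟪a, x⟫ ≤ c}ᶜ : Set (EuclideanSpace ℝ (Fin n))) := by
      have hne : ∀ᵐ x ∂ν, ⟪a, x⟫ ≠ c := by
        simpa [ae_iff] using measure_hyperplane_eq_zero hν ha c
      filter_upwards [hne] with x hx
      apply propext
      change c ≤ ⟪a, x⟫ ↔ ¬ ⟪a, x⟫ ≤ c
      rw [not_le]
      exact ⟨fun h => lt_of_le_of_ne h hx.symm, le_of_lt⟩
    have hset : closedHalfspace a c false = {x | c ≤ ⟪a, x⟫} := by simp [closedHalfspace]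
    rw [hset, measureReal_congr hae, measureReal_compl (measurableSet_halfspace a c)]
    unfold halfspaceMass at h
    linarith

/-- Every direction is normal to a hyperplane bisecting `ν`. -/
lemma exists_halfspaceMass_eq_half (hν : ν ≪ volume) (hpos : 0 < ν.real Set.univ)
    {a : EuclideanSpace ℝ (Fin n)} (ha : a ≠ 0) :
    ∃ c, halfspaceMass ν a c = ν.real Set.univ / 2 :=
  mem_range_of_exists_le_of_exists_ge
    (continuous_halfspaceMass hν continuous_const continuous_id fun _ => ha)
    (((tendsto_halfspaceMass_atBot a).eventually_lt_const (half_pos hpos)).exists.imp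
      fun _ => le_of_lt)
    (((tendsto_halfspaceMass_atTop a).eventually_const_lt (half_lt_self hpos)).exists.imp
      fun _ => le_of_lt)

end Bisection

/-- Two planar mass distributions separated by a vertical line have a common bisecting line. -/
lemma exists_common_bisector {ν₁ ν₂ : Measure (EuclideanSpace ℝ (Fin 2))} [IsFiniteMeasure ν₁]
    [IsFiniteMeasure ν₂] (h₁ : ν₁ ≪ volume) (h₂ : ν₂ ≪ volume) (pos₁ : 0 < ν₁.real Set.univ)
    (pos₂ : 0 < ν₂.real Set.univ) (c : ℝ) (left : ∀ᵐ x ∂ν₁, x 0 < c)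
    (right : ∀ᵐ x ∂ν₂, c < x 0) :
    ∃ (a : EuclideanSpace ℝ (Fin 2)) (b : ℝ), a ≠ 0 ∧
      halfspaceMass ν₁ a b = ν₁.real Set.univ / 2 ∧
      halfspaceMass ν₂ a b = ν₂.real Set.univ / 2 := by
  let a : ℝ → EuclideanSpace ℝ (Fin 2) := fun t => !₂[-t, 1]
  have ha : Continuous a := by
    refine (PiLp.continuous_toLp 2 _).comp (continuous_pi fun i => ?_)
    fin_cases i <;> simp <;> fun_prop
  have ha0 (t : ℝ) : a t ≠ 0 := fun h => by simpa [a] using congrArg (· 1) h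
  have hmem (t : ℝ) (x : EuclideanSpace ℝ (Fin 2)) :
      ⟪a t, x⟫ ≤ -t * c ↔ x 1 ≤ t * (x 0 - c) := by
    simp only [a, PiLp.inner_apply, Fin.sum_univ_two]
    simp
    constructor <;> intro h <;> linarith
  let f : ℝ → ℝ → ℝ := fun t b => halfspaceMass ν₁ (a t) b - ν₁.real Set.univ / 2
  let g : ℝ → ℝ → ℝ := fun t b => halfspaceMass ν₂ (a t) b - ν₂.real Set.univ / 2
  by_contra! hno
  have hfg (t b : ℝ) (hf : f t b = 0) : g t b ≠ 0 := fun hg =>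
    hno (a t) b (ha0 t) (sub_eq_zero.1 hf) (sub_eq_zero.1 hg)
  let U : Set ℝ := {t | ∃ b, 0 < f t b ∧ g t b < 0}
  let V : Set ℝ := {t | ∃ b, f t b < 0 ∧ 0 < g t b}
  have hf (b : ℝ) : Continuous fun t => f t b :=
    (continuous_halfspaceMass h₁ ha continuous_const ha0).sub continuous_const
  have hg (b : ℝ) : Continuous fun t => g t b :=
    (continuous_halfspaceMass h₂ ha continuous_const ha0).sub continuous_const
  have hU : IsOpen U := by
    simp only [U, Set.ofPred_exists]
    exact isOpen_iUnion fun b => (isOpen_lt continuous_const (hf b)).inter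
      (isOpen_lt (hg b) continuous_const)
  have hV : IsOpen V := by
    simp only [V, Set.ofPred_exists]
    exact isOpen_iUnion fun b => (isOpen_lt (hf b) continuous_const).inter
      (isOpen_lt continuous_const (hg b))
  have hdisj : ¬ (U ∩ V).Nonempty := by
    rintro ⟨t, ⟨b, hb₁, hb₂⟩, b', hb₁', hb₂'⟩
    have hlt : b' < b := (halfspaceMass_mono (ν := ν₁) (a t)).reflect_lt (by
      simp only [f] at hb₁ hb₁'; linarith)
    have hgt : b < b' := (halfspaceMass_mono (ν := ν₂) (a t)).reflect_lt (by
      simp only [g] at hb₂ hb₂'; linarith)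
    exact lt_asymm hlt hgt
  have hcover : Set.univ ⊆ U ∪ V := by
    intro t _
    have hsum : Continuous fun b => f t b + g t b :=
      ((continuous_halfspaceMass h₁ continuous_const continuous_id fun _ => ha0 t).sub
        continuous_const).add
      ((continuous_halfspaceMass h₂ continuous_const continuous_id fun _ => ha0 t).sub
        continuous_const)
    have hbot : Tendsto (fun b => f t b + g t b) atBot _ :=
      ((tendsto_halfspaceMass_atBot (a t)).sub_const _).add
        ((tendsto_halfspaceMass_atBot (a t)).sub_const _)
    have htop : Tendsto (fun b => f t b + g t b) atTop _ :=
      ((tendsto_halfspaceMass_atTop (a t)).sub_const _).add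
        ((tendsto_halfspaceMass_atTop (a t)).sub_const _)
    obtain ⟨b, hb⟩ : (0 : ℝ) ∈ Set.range fun b => f t b + g t b :=
      mem_range_of_exists_le_of_exists_ge hsum
        ((hbot.eventually_lt_const (by linarith)).exists.imp fun _ => le_of_lt)
        ((htop.eventually_const_lt (by linarith)).exists.imp fun _ => le_of_lt)
    simp only at hb
    rcases lt_trichotomy (f t b) 0 with h | h | h
    · exact .inr ⟨b, h, by linarith⟩
    · exact absurd (by linarith) (hfg t b h)
    · exact .inl ⟨b, h, by linarith⟩
  have hlim₁ : Tendsto (fun t => f t (-t * c)) atTop (𝓝 (0 - ν₁.real Set.univ / 2)) := by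
    refine Tendsto.sub_const ?_ _
    rw [← measureReal_empty (μ := ν₁)]
    refine tendsto_halfspaceMass .empty ?_
    filter_upwards [left] with x hx
    filter_upwards [(tendsto_id.atTop_mul_const_of_neg (sub_neg.2 hx)).eventually_lt_atBot (x 1)]
      with t ht
    exact iff_of_false (fun h => ht.not_ge ((hmem t x).1 h)) (Set.notMem_empty x)
  have hlim₂ : Tendsto (fun t => g t (-t * c)) atTop
      (𝓝 (ν₂.real Set.univ - ν₂.real Set.univ / 2)) := by
    refine Tendsto.sub_const (tendsto_halfspaceMass .univ ?_) _
    filter_upwards [right] with x hx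
    filter_upwards [(tendsto_id.atTop_mul_const (sub_pos.2 hx)).eventually_ge_atTop (x 1)]
      with t ht
    exact iff_of_true ((hmem t x).2 ht) trivial
  have hlim₁' : Tendsto (fun t => f t (-t * c)) atBot
      (𝓝 (ν₁.real Set.univ - ν₁.real Set.univ / 2)) := by
    refine Tendsto.sub_const (tendsto_halfspaceMass .univ ?_) _
    filter_upwards [left] with x hx
    filter_upwards [(tendsto_id.atBot_mul_const_of_neg (sub_neg.2 hx)).eventually_ge_atTop (x 1)]
      with t ht
    exact iff_of_true ((hmem t x).2 ht) trivial
  have hlim₂' : Tendsto (fun t => g t (-t * c)) atBot (𝓝 (0 - ν₂.real Set.univ / 2)) := by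
    refine Tendsto.sub_const ?_ _
    rw [← measureReal_empty (μ := ν₂)]
    refine tendsto_halfspaceMass .empty ?_
    filter_upwards [right] with x hx
    filter_upwards [(tendsto_id.atBot_mul_const (sub_pos.2 hx)).eventually_lt_atBot (x 1)]
      with t ht
    exact iff_of_false (fun h => ht.not_ge ((hmem t x).1 h)) (Set.notMem_empty x)
  obtain ⟨t, ht⟩ := ((hlim₁.eventually_lt_const (by linarith : _ < (0 : ℝ))).and
    (hlim₂.eventually_const_lt (by linarith : (0 : ℝ) < _))).exists
  obtain ⟨t', ht'⟩ := ((hlim₁'.eventually_const_lt (by linarith : (0 : ℝ) < _)).and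
    (hlim₂'.eventually_lt_const (by linarith : _ < (0 : ℝ)))).exists
  refine hdisj ?_
  simpa using isPreconnected_univ U V hU hV hcover ⟨t', trivial, _, ht'⟩ ⟨t, trivial, _, ht⟩

/-- Every continuous mass distribution on `ℝ^2` admits an equipartition by two lines:
each of the four closed quadrants determined by the lines has measure `μ(ℝ^2)/4`. -/
theorem equipartition_two_lines
    (μ : Measure (EuclideanSpace ℝ (Fin 2))) [IsFiniteMeasure μ]
    (hμ0 : μ ≠ 0) (hac : μ ≪ volume) :
    ∃ (a : Fin 2 → EuclideanSpace ℝ (Fin 2)) (c : Fin 2 → ℝ),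
      (∀ i, a i ≠ 0) ∧
      ∀ ε : Fin 2 → Bool,
        μ (⋂ i, closedHalfspace (a i) (c i) (ε i)) = μ Set.univ / 4 := by
  have hpos : 0 < μ.real Set.univ :=
    ENNReal.toReal_pos (by simpa using hμ0) (measure_ne_top μ _)
  let e : EuclideanSpace ℝ (Fin 2) := EuclideanSpace.single 0 1
  have he : e ≠ 0 := by simp [e]
  have hinner (x : EuclideanSpace ℝ (Fin 2)) : ⟪e, x⟫ = x 0 := by
    simp [e, EuclideanSpace.inner_single_left]
  obtain ⟨c, hc⟩ := exists_halfspaceMass_eq_half hac hpos he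
  have hhalf := measureReal_closedHalfspace hac he hc
  let ν : Bool → Measure (EuclideanSpace ℝ (Fin 2)) := fun ε => μ.restrict (closedHalfspace e c ε)
  have hν (ε : Bool) : ν ε ≪ volume := Measure.restrict_le_self.absolutelyContinuous.trans hac
  have hmeas (a : EuclideanSpace ℝ (Fin 2)) (c : ℝ) (ε : Bool) :
      MeasurableSet (closedHalfspace a c ε) := by
    cases ε
    · simpa [closedHalfspace] using measurableSet_le measurable_const (by fun_prop)
    · simpa [closedHalfspace] using measurableSet_halfspace a c
  have hmass (ε : Bool) : (ν ε).real Set.univ = μ.real Set.univ / 2 := by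
    simpa [ν, Measure.real] using hhalf ε
  have hne (ε : Bool) : ∀ᵐ x ∂ν ε, ⟪e, x⟫ ≠ c := by
    simpa [ae_iff] using measure_hyperplane_eq_zero (hν ε) he c
  have hside (ε : Bool) : ∀ᵐ x ∂ν ε, x ∈ closedHalfspace e c ε := ae_restrict_mem (hmeas e c ε)
  have left : ∀ᵐ x ∂ν true, x 0 < c := by
    filter_upwards [hne true, hside true] with x h h'
    rw [← hinner]
    exact lt_of_le_of_ne (by simpa [closedHalfspace] using h') h
  have right : ∀ᵐ x ∂ν false, c < x 0 := by
    filter_upwards [hne false, hside false] with x h h'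
    rw [← hinner]
    exact lt_of_le_of_ne (by simpa [closedHalfspace] using h') h.symm
  obtain ⟨a, b, ha, htrue, hfalse⟩ := exists_common_bisector (hν true) (hν false)
    (by rw [hmass]; exact half_pos hpos) (by rw [hmass]; exact half_pos hpos) c left right
  refine ⟨![e, a], ![c, b], by simp [Fin.forall_fin_two, he, ha], fun ε => ?_⟩
  have hbisect (ε : Bool) : halfspaceMass (ν ε) a b = (ν ε).real Set.univ / 2 := by
    cases ε
    · exact hfalse
    · exact htrue
  have hquad := measureReal_closedHalfspace (hν (ε 0)) ha (hbisect (ε 0)) (ε 1)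
  rw [hmass, measureReal_restrict_apply (hmeas a b (ε 1))] at hquad
  have hset : (⋂ i, closedHalfspace (![e, a] i) (![c, b] i) (ε i)) =
      closedHalfspace a b (ε 1) ∩ closedHalfspace e c (ε 0) := by
    ext x
    simp [Fin.forall_fin_two, and_comm]
  rw [hset, ← ENNReal.toReal_eq_toReal_iff' (measure_ne_top μ _)
    (ENNReal.div_ne_top (measure_ne_top μ _) (by norm_num)), ENNReal.toReal_div]
  change μ.real _ = μ.real Set.univ / _
  rw [hquad]
  norm_num
  ring
end

section
/- There exists a continuous W_4-equivariant map f : (S^4)^4_δ → U_4 \ {0}. Here (S^4)^4_δ := {(v_1, v_2, v_3, v_4) ∈ (S^4)^4 : v_i ≠ v_j and v_i ≠ −v_j for all i ≠ j}, and equivariance means f(g · v) = g · f(v) for every g in the group W_4 = (ℤ/2)^4 ⋊ S_4 with the actions described in the context. -/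
/-- The configuration space `(S^4)^4_δ` of `4`-tuples of unit vectors in `ℝ^5`, no two of
which are equal or antipodal. -/
def SphereConfigδ : Set (Fin 4 → EuclideanSpace ℝ (Fin 5)) :=
  {v | (∀ i, ‖v i‖ = 1) ∧ ∀ i j, i ≠ j → v i ≠ v j ∧ v i ≠ -v j}

/-- The sign `±1` attached to a bit. -/
def bitSign (b : Bool) : ℝ := if b then -1 else 1

/-- The sum of a linear, a bilinear, a trilinear and a quadrilinear form on `ℝ⁵`. -/
def multilinearSum (p q r s : EuclideanSpace ℝ (Fin 5)) : ℝ :=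
  p 0 + (p 1 * q 1 + p 2 * q 2 + p 3 * q 3) + (p 1 * q 2 * r 2 + p 4 * q 1 * r 1) +
    p 1 * q 2 * r 3 * s 4

/-- The standard inner product of the projections to the middle three coordinates. -/
def pairForm (p q : EuclideanSpace ℝ (Fin 5)) : ℝ :=
  p 1 * q 1 + p 2 * q 2 + p 3 * q 3

/-- The symmetrized trilinear part of `multilinearSum`. -/
def tripleForm (p q r : EuclideanSpace ℝ (Fin 5)) : ℝ :=
  p 1 * q 2 * r 2 + p 2 * q 1 * r 2 + p 2 * q 2 * r 1 +
    (p 4 * q 1 * r 1 + p 1 * q 4 * r 1 + p 1 * q 1 * r 4)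

/-- The symmetrized quadrilinear part of `multilinearSum`: the permanent of the last four
coordinates of four vectors. -/
def quadForm (p q r s : EuclideanSpace ℝ (Fin 5)) : ℝ :=
  p 1 * q 2 * r 3 * s 4 + p 1 * q 2 * s 3 * r 4 + p 1 * r 2 * q 3 * s 4 +
    p 1 * r 2 * s 3 * q 4 + p 1 * s 2 * q 3 * r 4 + p 1 * s 2 * r 3 * q 4 +
    q 1 * p 2 * r 3 * s 4 + q 1 * p 2 * s 3 * r 4 + q 1 * r 2 * p 3 * s 4 +
    q 1 * r 2 * s 3 * p 4 + q 1 * s 2 * p 3 * r 4 + q 1 * s 2 * r 3 * p 4 +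
    r 1 * p 2 * q 3 * s 4 + r 1 * p 2 * s 3 * q 4 + r 1 * q 2 * p 3 * s 4 +
    r 1 * q 2 * s 3 * p 4 + r 1 * s 2 * p 3 * q 4 + r 1 * s 2 * q 3 * p 4 +
    s 1 * p 2 * q 3 * r 4 + s 1 * p 2 * r 3 * q 4 + s 1 * q 2 * p 3 * r 4 +
    s 1 * q 2 * r 3 * p 4 + s 1 * r 2 * p 3 * q 4 + s 1 * r 2 * q 3 * p 4

/-- The symmetrization of `multilinearSum` over all permutations of the four vectors. -/
def symmetricSum (u : Fin 4 → EuclideanSpace ℝ (Fin 5)) : ℝ :=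
  ∑ τ : Equiv.Perm (Fin 4), multilinearSum (u (τ 0)) (u (τ 1)) (u (τ 2)) (u (τ 3))

/-- The function on the cube whose value at `β` is `symmetricSum` of the configuration with
signs changed according to `β`. -/
def cubeMap (v : Fin 4 → EuclideanSpace ℝ (Fin 5)) (β : Fin 4 → Bool) : ℝ :=
  symmetricSum fun i => bitSign (β i) • v i

theorem symmetricSum_comp_perm (u : Fin 4 → EuclideanSpace ℝ (Fin 5)) (σ : Equiv.Perm (Fin 4)) :
    symmetricSum (fun i => u (σ i)) = symmetricSum u :=
  Equiv.sum_comp (Equiv.mulLeft σ)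
    fun τ : Equiv.Perm (Fin 4) => multilinearSum (u (τ 0)) (u (τ 1)) (u (τ 2)) (u (τ 3))

theorem cubeMap_perm (v : Fin 4 → EuclideanSpace ℝ (Fin 5)) (σ : Equiv.Perm (Fin 4))
    (β : Fin 4 → Bool) : cubeMap (fun j => v (σ⁻¹ j)) β = cubeMap v (β ∘ σ) := by
  unfold cubeMap
  rw [← symmetricSum_comp_perm _ σ]
  simp

theorem cubeMap_update_neg (v : Fin 4 → EuclideanSpace ℝ (Fin 5)) (i : Fin 4)
    (β : Fin 4 → Bool) :
    cubeMap (Function.update v i (-v i)) β = cubeMap v (Function.update β i (!β i)) := by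
  unfold cubeMap
  congr 1
  funext j
  by_cases h : j = i
  · subst h
    cases β j <;> simp [bitSign]
  · simp [h]

theorem continuous_cubeMap : Continuous cubeMap := by
  unfold cubeMap symmetricSum multilinearSum
  fun_prop

theorem sum_perm_fin_four (g : Fin 4 → Fin 4 → Fin 4 → Fin 4 → ℝ) :
    ∑ τ : Equiv.Perm (Fin 4), g (τ 0) (τ 1) (τ 2) (τ 3) =
      g 0 1 2 3 + g 0 1 3 2 + g 0 2 1 3 + g 0 2 3 1 + g 0 3 1 2 + g 0 3 2 1 +
      g 1 0 2 3 + g 1 0 3 2 + g 1 2 0 3 + g 1 2 3 0 + g 1 3 0 2 + g 1 3 2 0 +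
      g 2 0 1 3 + g 2 0 3 1 + g 2 1 0 3 + g 2 1 3 0 + g 2 3 0 1 + g 2 3 1 0 +
      g 3 0 1 2 + g 3 0 2 1 + g 3 1 0 2 + g 3 1 2 0 + g 3 2 0 1 + g 3 2 1 0 := by
  have h : (Finset.univ : Finset (Equiv.Perm (Fin 4))).val.map
        (fun τ => (τ 0, τ 1, τ 2, τ 3)) =
      ((Finset.univ : Finset (Fin 4 × Fin 4 × Fin 4 × Fin 4)).filter fun t =>
        t.1 ≠ t.2.1 ∧ t.1 ≠ t.2.2.1 ∧ t.1 ≠ t.2.2.2 ∧ t.2.1 ≠ t.2.2.1 ∧ t.2.1 ≠ t.2.2.2 ∧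
          t.2.2.1 ≠ t.2.2.2).val := by
    decide +kernel
  have h' := congrArg (fun s => (s.map fun t => g t.1 t.2.1 t.2.2.1 t.2.2.2).sum) h
  simp only [Multiset.map_map] at h'
  refine h'.trans ?_
  change ∑ t ∈ _, _ = _
  simp [Finset.sum_filter, Fintype.sum_prod_type, Fin.sum_univ_four]
  ring

theorem sum_cube_four (g : (Fin 4 → Bool) → ℝ) :
    ∑ β, g β =
      g ![false, false, false, false] + g ![false, false, false, true] +
      g ![false, false, true, false] + g ![false, false, true, true] +
      g ![false, true, false, false] + g ![false, true, false, true] +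
      g ![false, true, true, false] + g ![false, true, true, true] +
      g ![true, false, false, false] + g ![true, false, false, true] +
      g ![true, false, true, false] + g ![true, false, true, true] +
      g ![true, true, false, false] + g ![true, true, false, true] +
      g ![true, true, true, false] + g ![true, true, true, true] := by
  have h : (Finset.univ : Finset (Fin 4 → Bool)).val =
      {![false, false, false, false],
       ![false, false, false, true],
       ![false, false, true, false],
       ![false, false, true, true],
       ![false, true, false, false],
       ![false, true, false, true],
       ![false, true, true, false],
       ![false, true, true, true],
       ![true, false, false, false],
       ![true, false, false, true],
       ![true, false, true, false],
       ![true, false, true, true],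
       ![true, true, false, false],
       ![true, true, false, true],
       ![true, true, true, false],
       ![true, true, true, true]} := by
    decide +kernel
  change (Finset.univ.val.map g).sum = _
  simp only [h, Multiset.insert_eq_cons, Multiset.map_cons, Multiset.sum_cons,
    Multiset.map_singleton, Multiset.sum_singleton]
  ring

/-- The multilinear polynomial in the signs of `β`, with zero constant term and coefficients `c`
indexed by nonempty sets of bit positions. -/
def signPolynomial (c0 c1 c2 c3 c01 c02 c03 c12 c13 c23 c012 c013 c023 c123 c0123 : ℝ)
    (β : Fin 4 → Bool) : ℝ :=
  bitSign (β 0) * c0 + bitSign (β 1) * c1 + bitSign (β 2) * c2 + bitSign (β 3) * c3 +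
  bitSign (β 0) * bitSign (β 1) * c01 + bitSign (β 0) * bitSign (β 2) * c02 +
  bitSign (β 0) * bitSign (β 3) * c03 + bitSign (β 1) * bitSign (β 2) * c12 +
  bitSign (β 1) * bitSign (β 3) * c13 + bitSign (β 2) * bitSign (β 3) * c23 +
  bitSign (β 0) * bitSign (β 1) * bitSign (β 2) * c012 +
  bitSign (β 0) * bitSign (β 1) * bitSign (β 3) * c013 +
  bitSign (β 0) * bitSign (β 2) * bitSign (β 3) * c023 +
  bitSign (β 1) * bitSign (β 2) * bitSign (β 3) * c123 +
  bitSign (β 0) * bitSign (β 1) * bitSign (β 2) * bitSign (β 3) * c0123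

theorem sum_signPolynomial (c0 c1 c2 c3 c01 c02 c03 c12 c13 c23 c012 c013 c023 c123 c0123 : ℝ) :
    ∑ β, signPolynomial c0 c1 c2 c3 c01 c02 c03 c12 c13 c23 c012 c013 c023 c123 c0123 β = 0 := by
  rw [sum_cube_four]
  simp only [signPolynomial, bitSign, Matrix.cons_val, if_true, if_false, Bool.false_eq_true]
  ring

theorem coeff_eq_zero_of_signPolynomial_eq_zero
    {c0 c1 c2 c3 c01 c02 c03 c12 c13 c23 c012 c013 c023 c123 c0123 : ℝ}
    (h : signPolynomial c0 c1 c2 c3 c01 c02 c03 c12 c13 c23 c012 c013 c023 c123 c0123 = 0) :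
    c0 = 0 ∧ c01 = 0 ∧ c012 = 0 ∧ c0123 = 0 := by
  have h0000 := congrFun h ![false, false, false, false]
  have h0001 := congrFun h ![false, false, false, true]
  have h0010 := congrFun h ![false, false, true, false]
  have h0011 := congrFun h ![false, false, true, true]
  have h0100 := congrFun h ![false, true, false, false]
  have h0101 := congrFun h ![false, true, false, true]
  have h0110 := congrFun h ![false, true, true, false]
  have h0111 := congrFun h ![false, true, true, true]
  have h1000 := congrFun h ![true, false, false, false]
  have h1001 := congrFun h ![true, false, false, true]
  have h1010 := congrFun h ![true, false, true, false]
  have h1011 := congrFun h ![true, false, true, true]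
  have h1100 := congrFun h ![true, true, false, false]
  have h1101 := congrFun h ![true, true, false, true]
  have h1110 := congrFun h ![true, true, true, false]
  have h1111 := congrFun h ![true, true, true, true]
  simp only [signPolynomial, Pi.zero_apply, bitSign, Matrix.cons_val, if_true, if_false,
    Bool.false_eq_true] at *
  refine ⟨?_, ?_, ?_, ?_⟩ <;> linarith

theorem cubeMap_eq_signPolynomial (v : Fin 4 → EuclideanSpace ℝ (Fin 5)) :
    cubeMap v = signPolynomial
      (6 * v 0 0) (6 * v 1 0) (6 * v 2 0) (6 * v 3 0) (4 * pairForm (v 0) (v 1))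
      (4 * pairForm (v 0) (v 2)) (4 * pairForm (v 0) (v 3)) (4 * pairForm (v 1) (v 2))
      (4 * pairForm (v 1) (v 3)) (4 * pairForm (v 2) (v 3)) (2 * tripleForm (v 0) (v 1) (v 2))
      (2 * tripleForm (v 0) (v 1) (v 3)) (2 * tripleForm (v 0) (v 2) (v 3))
      (2 * tripleForm (v 1) (v 2) (v 3)) (quadForm (v 0) (v 1) (v 2) (v 3)) := by
  funext β
  rw [cubeMap, symmetricSum, sum_perm_fin_four fun i j k l => multilinearSum
    (bitSign (β i) • v i) (bitSign (β j) • v j) (bitSign (β k) • v k) (bitSign (β l) • v l)]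
  simp only [multilinearSum, signPolynomial, pairForm, tripleForm, quadForm, PiLp.smul_apply,
    smul_eq_mul]
  ring

theorem sum_cubeMap (v : Fin 4 → EuclideanSpace ℝ (Fin 5)) : ∑ β, cubeMap v β = 0 := by
  rw [cubeMap_eq_signPolynomial, sum_signPolynomial]

theorem forms_eq_zero_of_cubeMap_eq_zero {v : Fin 4 → EuclideanSpace ℝ (Fin 5)}
    (h : cubeMap v = 0) :
    v 0 0 = 0 ∧ pairForm (v 0) (v 1) = 0 ∧ tripleForm (v 0) (v 1) (v 2) = 0 ∧
      quadForm (v 0) (v 1) (v 2) (v 3) = 0 := by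
  rw [cubeMap_eq_signPolynomial] at h
  simpa using coeff_eq_zero_of_signPolynomial_eq_zero h

theorem cubeMap_comp_perm_eq_zero {v : Fin 4 → EuclideanSpace ℝ (Fin 5)} (h : cubeMap v = 0)
    (σ : Equiv.Perm (Fin 4)) : cubeMap (v ∘ σ) = 0 := by
  funext β
  simpa [Function.comp_def, h] using cubeMap_perm v σ⁻¹ β

theorem exists_perm_extending {i j k l : Fin 4} (hij : i ≠ j) (hik : i ≠ k) (hil : i ≠ l)
    (hjk : j ≠ k) (hjl : j ≠ l) (hkl : k ≠ l) :
    ∃ σ : Equiv.Perm (Fin 4), σ 0 = i ∧ σ 1 = j ∧ σ 2 = k ∧ σ 3 = l := by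
  have h : Function.Injective ![i, j, k, l] := by
    intro a b
    fin_cases a <;> fin_cases b <;> simp [*, Ne.symm]
  exact ⟨Equiv.ofBijective _ (Finite.injective_iff_bijective.mp h), rfl, rfl, rfl, rfl⟩

theorem forms_eq_zero_of_cubeMap_eq_zero_of_ne {v : Fin 4 → EuclideanSpace ℝ (Fin 5)}
    (h : cubeMap v = 0) {i j k l : Fin 4} (hij : i ≠ j) (hik : i ≠ k) (hil : i ≠ l)
    (hjk : j ≠ k) (hjl : j ≠ l) (hkl : k ≠ l) :
    v i 0 = 0 ∧ pairForm (v i) (v j) = 0 ∧ tripleForm (v i) (v j) (v k) = 0 ∧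
      quadForm (v i) (v j) (v k) (v l) = 0 := by
  obtain ⟨σ, rfl, rfl, rfl, rfl⟩ := exists_perm_extending hij hik hil hjk hjl hkl
  exact forms_eq_zero_of_cubeMap_eq_zero (cubeMap_comp_perm_eq_zero h σ)

/-- Among more than `m` pairwise orthogonal vectors in `ℝᵐ` at least one vanishes. -/
theorem exists_eq_zero_of_pairwise_orthogonal {m n : ℕ} (hmn : m < n)
    (u : Fin n → EuclideanSpace ℝ (Fin m)) (hu : Pairwise fun i j => inner ℝ (u i) (u j) = 0) :
    ∃ i, u i = 0 := by
  by_contra! h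
  have := (linearIndependent_of_ne_zero_of_inner_eq_zero h hu).fintype_card_le_finrank
  simp at this
  omega

theorem eq_or_eq_neg_of_eq_zero_of_ne_four {p q : EuclideanSpace ℝ (Fin 5)}
    (hp : ‖p‖ = 1) (hq : ‖q‖ = 1) (hp0 : ∀ i, i ≠ 4 → p i = 0) (hq0 : ∀ i, i ≠ 4 → q i = 0) :
    p = q ∨ p = -q := by
  have hp2 : p 4 ^ 2 = 1 := by
    have := EuclideanSpace.real_norm_sq_eq p
    simpa [Fin.sum_univ_five, hp, hp0] using this.symm
  have hq2 : q 4 ^ 2 = 1 := by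
    have := EuclideanSpace.real_norm_sq_eq q
    simpa [Fin.sum_univ_five, hq, hq0] using this.symm
  refine (sq_eq_sq_iff_eq_or_eq_neg.mp (hp2.trans hq2.symm)).imp ?_ ?_ <;>
  · intro h
    ext i
    by_cases hi : i = 4
    · subst hi; simpa using h
    · simp [hp0 i hi, hq0 i hi]

/-- No two nonzero orthogonal vectors in the plane have zero product of first coordinates and zero
permanent. -/
theorem false_of_orthogonal_of_permanent_eq_zero {b₁ c₁ b₂ c₂ : ℝ} (h : b₁ ≠ 0 ∨ c₁ ≠ 0)
    (h' : b₂ ≠ 0 ∨ c₂ ≠ 0) (hbb : b₁ * b₂ = 0) (horth : b₁ * b₂ + c₁ * c₂ = 0)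
    (hper : b₁ * c₂ + c₁ * b₂ = 0) : False := by
  have hcc : c₁ * c₂ = 0 := by linarith
  rcases mul_eq_zero.mp hbb with hb | hb <;> rcases mul_eq_zero.mp hcc with hc | hc <;>
    simp_all

/-- The four vectors cannot have a vanishing image under `cubeMap` if the first one, `v i`, lies on
the last coordinate axis and the second one has nonzero second coordinate. -/
theorem false_of_cubeMap_eq_zero_of_axis {v : Fin 4 → EuclideanSpace ℝ (Fin 5)}
    (h : cubeMap v = 0) {i j k l : Fin 4} (hij : i ≠ j) (hik : i ≠ k) (hil : i ≠ l)
    (hjk : j ≠ k) (hjl : j ≠ l) (hkl : k ≠ l)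
    (hi : v i 1 = 0 ∧ v i 2 = 0 ∧ v i 3 = 0) (hi4 : v i 4 ≠ 0) (hj : v j 1 ≠ 0)
    (hk : v k 1 ≠ 0 ∨ v k 2 ≠ 0 ∨ v k 3 ≠ 0) (hl : v l 1 ≠ 0 ∨ v l 2 ≠ 0 ∨ v l 3 ≠ 0) :
    False := by
  obtain ⟨hi1, hi2, hi3⟩ := hi
  obtain ⟨-, -, hijk, hper⟩ :=
    forms_eq_zero_of_cubeMap_eq_zero_of_ne h hij hik hil hjk hjl hkl
  obtain ⟨-, -, hijl, -⟩ :=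
    forms_eq_zero_of_cubeMap_eq_zero_of_ne h hij hil hik hjl hjk hkl.symm
  obtain ⟨-, -, hjkl, -⟩ :=
    forms_eq_zero_of_cubeMap_eq_zero_of_ne h hjk hjl hij.symm hkl hik.symm hil.symm
  obtain ⟨-, horth, -, -⟩ :=
    forms_eq_zero_of_cubeMap_eq_zero_of_ne h hkl hik.symm hjk.symm hil.symm hjl.symm hij
  have hk1 : v k 1 = 0 := by simpa [tripleForm, hi1, hi2, hi4, hj] using hijk
  have hl1 : v l 1 = 0 := by simpa [tripleForm, hi1, hi2, hi4, hj] using hijl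
  refine false_of_orthogonal_of_permanent_eq_zero (b₁ := v k 2) (c₁ := v k 3) (b₂ := v l 2)
    (c₂ := v l 3) (by simpa [hk1] using hk) (by simpa [hl1] using hl) ?_ ?_ ?_
  · simpa [tripleForm, hk1, hl1, hj] using hjkl
  · simpa [pairForm, hk1] using horth
  · refine (mul_eq_zero.mp (?_ : v j 1 * v i 4 * _ = 0)).resolve_left (mul_ne_zero hj hi4)
    rw [← hper]
    simp only [quadForm, hi1, hi2, hi3, hk1, hl1]
    ring

theorem cubeMap_ne_zero {v : Fin 4 → EuclideanSpace ℝ (Fin 5)} (hv : v ∈ SphereConfigδ) :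
    cubeMap v ≠ 0 := by
  intro h
  have hcompl : ∀ i j : Fin 4, i ≠ j → ∃ k l, i ≠ k ∧ i ≠ l ∧ j ≠ k ∧ j ≠ l ∧ k ≠ l := by decide
  have hfirst : ∀ i, v i 0 = 0 := by
    intro i
    obtain ⟨j, hij⟩ := exists_ne i
    obtain ⟨k, l, hik, hil, hjk, hjl, hkl⟩ := hcompl i j hij.symm
    exact (forms_eq_zero_of_cubeMap_eq_zero_of_ne h hij.symm hik hil hjk hjl hkl).1
  have horth : ∀ i j, i ≠ j → pairForm (v i) (v j) = 0 := by
    intro i j hij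
    obtain ⟨k, l, hik, hil, hjk, hjl, hkl⟩ := hcompl i j hij
    exact (forms_eq_zero_of_cubeMap_eq_zero_of_ne h hij hik hil hjk hjl hkl).2.1
  obtain ⟨i, hi⟩ : ∃ i, v i 1 = 0 ∧ v i 2 = 0 ∧ v i 3 = 0 := by
    obtain ⟨i, hi⟩ := exists_eq_zero_of_pairwise_orthogonal (by norm_num : 3 < 4)
      (fun i => !₂[v i 1, v i 2, v i 3]) fun i j hij => by
        have := horth i j hij
        simp only [pairForm] at this
        simp [PiLp.inner_apply, Fin.sum_univ_three]
        linarith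
    exact ⟨i, by simpa using congrArg (· 0) hi, by simpa using congrArg (· 1) hi,
      by simpa using congrArg (· 2) hi⟩
  have haxis : ∀ j, (v j 1 = 0 ∧ v j 2 = 0 ∧ v j 3 = 0) → ∀ t, t ≠ 4 → v j t = 0 := by
    rintro j ⟨h1, h2, h3⟩ t ht
    have h0 := hfirst j
    fin_cases t <;> first | assumption | exact absurd rfl ht
  have hne : ∀ j, i ≠ j → v j 1 ≠ 0 ∨ v j 2 ≠ 0 ∨ v j 3 ≠ 0 := by
    intro j hij
    by_contra! hj
    exact (eq_or_eq_neg_of_eq_zero_of_ne_four (hv.1 i) (hv.1 j) (haxis i hi) (haxis j hj)).elim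
      (hv.2 i j hij).1 (hv.2 i j hij).2
  have hi4 : v i 4 ≠ 0 := by
    intro h4
    have : v i = 0 := by
      ext t
      by_cases ht : t = 4
      · simpa [ht] using h4
      · simpa using haxis i hi t ht
    simpa [this] using hv.1 i
  obtain ⟨j, hij, hj⟩ : ∃ j, i ≠ j ∧ v j 1 ≠ 0 := by
    by_contra! hzero
    obtain ⟨t, ht⟩ := exists_eq_zero_of_pairwise_orthogonal (by norm_num : 2 < 3)
      (fun t => !₂[v (i.succAbove t) 2, v (i.succAbove t) 3]) fun s t hst => by
        have := horth _ _ (i.succAbove_right_injective.ne hst)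
        simp only [pairForm, hzero _ (i.succAbove_ne s).symm] at this
        simp [PiLp.inner_apply]
        linarith
    have h2 : v (i.succAbove t) 2 = 0 := by simpa using congrArg (· 0) ht
    have h3 : v (i.succAbove t) 3 = 0 := by simpa using congrArg (· 1) ht
    simpa [h2, h3, hzero _ (i.succAbove_ne t).symm] using hne _ (i.succAbove_ne t).symm
  obtain ⟨k, l, hik, hil, hjk, hjl, hkl⟩ := hcompl i j hij
  exact false_of_cubeMap_eq_zero_of_axis h hij hik hil hjk hjl hkl hi hi4 hj (hne k hik)
    (hne l hil)

/-- There exists a continuous `W₄`-equivariant map `f : (S⁴)⁴_δ → U₄ \ {0}`, where `U₄` is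
the `15`-dimensional subspace of functions `w : {0,1}⁴ → ℝ` with `∑ β, w β = 0`.
Equivariance is expressed via the generators of `W₄ = (ℤ/2)⁴ ⋊ S₄`: the `i`-th sign change
`v ↦ (v with v i replaced by -v i)` corresponds to flipping the `i`-th bit of the index
`β`, and a permutation `σ` acting on the tuple by `(σ·v) j = v (σ⁻¹ j)` corresponds to
`β ↦ β ∘ σ`. -/
theorem exists_equivariant_map :
    ∃ f : (Fin 4 → EuclideanSpace ℝ (Fin 5)) → ((Fin 4 → Bool) → ℝ),
      ContinuousOn f SphereConfigδ ∧
      (∀ v ∈ SphereConfigδ, ∑ β : Fin 4 → Bool, f v β = 0) ∧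
      (∀ v ∈ SphereConfigδ, f v ≠ 0) ∧
      (∀ v ∈ SphereConfigδ, ∀ i : Fin 4, ∀ β : Fin 4 → Bool,
        f (Function.update v i (-v i)) β = f v (Function.update β i (!β i))) ∧
      (∀ v ∈ SphereConfigδ, ∀ σ : Equiv.Perm (Fin 4), ∀ β : Fin 4 → Bool,
        f (fun j => v (σ⁻¹ j)) β = f v (β ∘ σ)) := by
  exact ⟨cubeMap, continuous_cubeMap.continuousOn, fun v _ => sum_cubeMap v,
    fun _ hv => cubeMap_ne_zero hv, fun v _ i β => cubeMap_update_neg v i β,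
    fun v _ σ β => cubeMap_perm v σ β⟩
end
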